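/- Let s ≥ 2 and let a_1, …, a_s be positive integers with a_1 = … = a_{s−1} = 2 and a_s = 6, and set m = Σ_{i=1}^s (a_i − 1) + 1. If m ≥ 8, then F_v(a_1, …, a_s; m − 1) = m + 9; equivalently, for every integer r ≥ 2, F_v(2_r, 6; r + 5) = r + 15. -/

import Mathlib

/-- `G →v (a₁, …, aₛ)`: for every coloring of the vertices of `G` with `s` colors there is a
color `i` and a monochromatic clique of size `aᵢ` in color `i`. The list `a` records
`a₁, …, aₛ`. -/
def VArrow {V : Type*} (G : SimpleGraph V) (a : List ℕ) : Prop :=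
  ∀ c : V → Fin a.length, ∃ i : Fin a.length, ∃ s : Finset V,
    G.IsNClique (a.get i) s ∧ ∀ v ∈ s, c v = i

/-- The vertex Folkman number `F_v(a₁, …, aₛ; q)`: the minimum number of vertices of a
`K_q`-free graph `G` with `G →v (a₁, …, aₛ)`. -/
noncomputable def folkman (a : List ℕ) (q : ℕ) : ℕ :=
  sInf {n : ℕ | ∃ G : SimpleGraph (Fin n), G.CliqueFree q ∧ VArrow G a}

noncomputable section

namespace IndepCert

/-- `k x`, arranged so that the kernel evaluates `x` to a literal first. -/
def force {α : Type} (x : ℕ) (k : ℕ → α) : α :=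
  @Nat.rec (fun _ => α) (k 0) (fun m _ => k m) (Nat.add x 1)

def sel {α : Type} (b : Bool) (x y : α) : α := @Bool.rec (fun _ => α) y x b

def tb (m i : ℕ) : Bool := Nat.beq (Nat.land (Nat.shiftRight m i) 1) 1

def row (G v : ℕ) : ℕ := Nat.shiftRight G (Nat.mul 32 v)

def setPair (M u v c : ℕ) : ℕ :=
  Nat.xor (Nat.land c 18446744073709551615)
    (Nat.lor (Nat.lor M (Nat.shiftLeft 1 (Nat.add (Nat.mul 32 u) v)))
      (Nat.shiftLeft 1 (Nat.add (Nat.mul 32 v) u)))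

def nth (l : List ℕ) (i : ℕ) : ℕ :=
  @List.rec ℕ (fun _ => ℕ → ℕ) (fun _ => 0)
    (fun a _ ih i => @Nat.rec (fun _ => ℕ) a (fun j _ => ih j) i) l i

/-- Every set in the family `T` belongs to the family `B`. -/
def killed (T B : ℕ) : Bool := Nat.beq (Nat.land T B) T

def anyKilled (T : ℕ) (cl : List ℕ) : Bool :=
  @List.rec ℕ (fun _ => Bool) false (fun m _ ih => sel (killed T m) true ih) cl

/-- Number of elements of a bitset contained in `{0, …, 19}`. -/
def popcount (x : ℕ) : ℕ :=
  Nat.mod (Nat.land (Nat.mul x 2462627735819477471478834772908959182061088422696729859886664622502584576226632519972005200658167352298026533126145)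
    1291125554700094681454528120150733151374004819596536383975174637135793331478721023188113305127324549703733114332013133825) 2097151

/-- Remove the least element of a bitset. -/
def dropLow (x : ℕ) : ℕ := Nat.land x (Nat.sub x 1)

/-- The least element of a nonempty bitset. -/
def low (x : ℕ) : ℕ := popcount (Nat.sub (Nat.xor x (dropLow x)) 1)

/-- The element of the bitset `x` that has exactly `j` elements of `x` below it. -/
def pick (j x : ℕ) : ℕ := @Nat.rec (fun _ => ℕ → ℕ) low (fun _ ih x => ih (dropLow x)) j x

/-- Row `i` of a triangular array: the bits number `i (i - 1) / 2 + j` with `j < i`. -/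
def triRow (E i : ℕ) : ℕ := Nat.shiftRight E (Nat.div (Nat.mul i (Nat.sub i 1)) 2)

/-- The numbers `5 * j` for the elements `j < i` of the bitset `m`. -/
def elems (m i : ℕ) : List ℕ :=
  @Nat.rec (fun _ => List ℕ) [] (fun j ih => sel (tb m j) (Nat.mul 5 j :: ih) ih) i

/-- The entry of `perm` at bit position `p`. -/
def img (perm p : ℕ) : ℕ := Nat.land (Nat.shiftRight perm p) 31

/-- Restrict `cand` to common neighbours of the images of the elements of `es`. -/
def inter (G perm : ℕ) (es : List ℕ) (cand : ℕ) : ℕ :=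
  @List.rec ℕ (fun _ => ℕ → ℕ) (fun cand => cand)
    (fun p _ ih cand => ih (Nat.land cand (row G (img perm p)))) es cand

/-- Remove from `cand` the neighbours of the images of the elements of `ds`. -/
def excl (G perm : ℕ) (ds : List ℕ) (cand : ℕ) : ℕ :=
  @List.rec ℕ (fun _ => ℕ → ℕ) (fun cand => cand)
    (fun p _ ih cand => ih (Nat.xor cand (Nat.land cand (row G (img perm p))))) ds cand

/-- Parameters of a refutation: `n` vertices, every `r` cliques are avoided by an independent
`6`-set, and `tri` says whether triangles are excluded. -/
structure Params where
  n : ℕ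
  r : ℕ
  tri : Bool

/-- A clause: among `k` vertices spanning the edges `E`, some pair in `D` is an edge. -/
structure Clause where
  k : ℕ
  E : ℕ
  D : ℕ

/-- Row `i` of a clause: the pairs with earlier vertices in `E` and in `D`. The number of rows from
this one on is `left`. -/
structure Row where
  pos : ℕ
  left : ℕ
  es : List ℕ
  ds : List ℕ

def rowsFrom (E D k i : ℕ) : List Row :=
  @Nat.rec (fun _ => ℕ → List Row) (fun _ => [])
    (fun m ih i =>
      ⟨Nat.mul 5 i, Nat.succ m, elems (triRow E i) i, elems (triRow D i) i⟩ :: ih (Nat.succ i)) k i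

def rows (l : Clause) : List Row :=
  @Clause.rec (fun _ => List Row) (fun k E D => rowsFrom E D k 0) l

/-- The family of sets containing `u`. -/
def point (X u : ℕ) : ℕ :=
  Nat.land (Nat.shiftRight X (Nat.mul 16384 u)) (Nat.sub (Nat.pow 2 16384) 1)

def killTest (X T : ℕ) (cl : List ℕ) (u v : ℕ) : Bool :=
  anyKilled (Nat.xor T (Nat.land T (Nat.lor (point X u) (point X v)))) cl

/-- The pair `u v` is certainly not an edge. -/
def known (P : Params) (X G D T : ℕ) (cl : List ℕ) (u v : ℕ) : Bool :=
  sel (tb D (Nat.add (Nat.mul 32 u) v)) true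
    (sel (sel P.tri (Nat.beq (Nat.land (Nat.land (row G u) (row G v)) 524287) 0) true)
      (sel (Nat.beq P.r 2) (killTest X T cl u v) false)
      true)

/-- A way of choosing an element of a bitset (the second argument) as the image of a vertex,
depending on the row of the vertex and the images of the earlier vertices, and driven by a code;
the choice and the remaining code are passed on. -/
abbrev Choice := Row → ℕ → ℕ → ℕ → (ℕ → ℕ → ℕ) → ℕ

def chooseAny (cand c : ℕ) (k : ℕ → ℕ → ℕ) : ℕ :=
  force (pick (Nat.mod c (popcount cand)) cand) fun v => force (Nat.div c (popcount cand)) (k v)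

def chooseLow (cand c : ℕ) (k : ℕ → ℕ → ℕ) : ℕ := force (low cand) fun v => k v c

/-- Pass over an initial segment of the candidates, but keep at least `left` of them. -/
def skip (left : ℕ) (k : ℕ → ℕ → ℕ) (fuel cand c : ℕ) : ℕ :=
  @Nat.rec (fun _ => ℕ → ℕ → ℕ) (fun _ _ => 0)
    (fun _ ih cand c => sel (Nat.ble (popcount cand) left) (chooseLow cand c k)
      (force (Nat.div c 2) fun c' => sel (tb c 0) (force (dropLow cand) fun cand' => ih cand' c')
        (chooseLow cand c' k)))
    fuel cand c

def anyChoice : Choice := fun _ _ cand c k => chooseAny cand c k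

/-- Choose the images in increasing order. -/
def increasing : Choice := fun r perm cand c k =>
  @Row.rec (fun _ => ℕ) (fun pos left _ _ =>
    force (Nat.succ (img perm (Nat.sub pos 5))) fun s =>
    force (Nat.shiftLeft (Nat.shiftRight cand s) s) fun cand' => skip left k 32 cand' c) r

/-- Choose the least candidate for a vertex, other than the first one, without earlier neighbours. -/
def leastFree : Choice := fun r _ cand c k =>
  @Row.rec (fun _ => ℕ) (fun pos _ es _ =>
    @List.rec ℕ (fun _ => ℕ)
      (@Nat.rec (fun _ => ℕ) (chooseAny cand c k) (fun _ _ => chooseLow cand c k) pos)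
      (fun _ _ _ => chooseAny cand c k) es) r

/-- Add to the list `todo` the pairs of `v` with images of elements of `d`. -/
def addPairs (kn : ℕ → ℕ → Bool) (perm v : ℕ) (k : List ℕ → ℕ) (ds : List ℕ)
    (todo : List ℕ) : ℕ :=
  @List.rec ℕ (fun _ => List ℕ → ℕ) k
    (fun p _ ih todo => force (img perm p) fun w =>
      sel (kn v w) (ih todo) (ih (Nat.add (Nat.mul 32 v) w :: todo)))
    ds todo

def placeAt (kn : ℕ → ℕ → Bool) (ih : ℕ → ℕ → List ℕ → ℕ → ℕ) (pos : ℕ) (ds : List ℕ)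
    (perm free : ℕ) (todo : List ℕ) (cand v c : ℕ) : ℕ :=
  sel (tb cand v)
    (addPairs kn perm v (fun todo' =>
      ih (Nat.add perm (Nat.shiftLeft v pos)) (Nat.xor free (Nat.shiftLeft 1 v)) todo' c) ds todo)
    0

def place (ch : Choice) (kn : ℕ → ℕ → Bool) (ih : ℕ → ℕ → List ℕ → ℕ → ℕ) (r : Row) (pos : ℕ)
    (ds : List ℕ) (perm free : ℕ) (todo : List ℕ) (c cand : ℕ) : ℕ :=
  ch r perm cand c (placeAt kn ih pos ds perm free todo cand)

/-- Read an embedding of the clause from the code `c`, and collect the images of the pairs of the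
clause that are not known to be non-edges. -/
def build (ch : Choice) (kn : ℕ → ℕ → Bool) (G : ℕ) (fin : List ℕ → ℕ → ℕ) (rs : List Row)
    (perm free : ℕ) (todo : List ℕ) (c : ℕ) : ℕ :=
  @List.rec Row (fun _ => ℕ → ℕ → List ℕ → ℕ → ℕ) (fun _ _ todo c => fin todo c)
    (fun r _ ih perm free todo c =>
      @Row.rec (fun _ => ℕ) (fun pos _ es ds =>
        force (excl G perm ds (inter G perm es free)) (place ch kn ih r pos ds perm free todo c)) r)
    rs perm free todo c

def tag (c : ℕ) : ℕ :=
  Nat.lor 4294967295 (Nat.shiftLeft (Nat.land c 4294967295) 32)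

/-- Add the edge `u v` to a state. -/
def addEdge {α : Type} (X G T : ℕ) (cl : List ℕ) (u v c : ℕ)
    (k : ℕ → ℕ → List ℕ → α) : α :=
  force (setPair G u v c) fun G' =>
  force (Nat.xor (Nat.xor T (Nat.land T (Nat.land (point X u) (point X v)))) (Nat.land c 4294967295)) fun T' =>
  force (Nat.lor (Nat.lor (point X u) (point X v)) (tag c)) fun B =>
  k G' T' (B :: cl)

def loopEdge (X : ℕ) (rec : ℕ → ℕ → ℕ → List ℕ → ℕ → ℕ) (G T : ℕ) (cl : List ℕ)
    (D c u v : ℕ) (ih : ℕ → ℕ → ℕ) : ℕ :=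
  @Nat.rec (fun _ => ℕ) 0
    (fun c' _ => force (setPair D u v c') fun D' => ih D' c')
    (addEdge X G T cl u v c fun G' T' cl' => rec G' D T' cl' c)

/-- Refute the extension by each pair in `todo`. -/
def loop (X : ℕ) (rec : ℕ → ℕ → ℕ → List ℕ → ℕ → ℕ) (G T : ℕ) (cl : List ℕ)
    (D : ℕ) (todo : List ℕ) (c : ℕ) : ℕ :=
  @List.rec ℕ (fun _ => ℕ → ℕ → ℕ) (fun _ c => Nat.succ c)
    (fun p _ ih D c => force (Nat.shiftRight p 5) fun u => force (Nat.land p 31) fun v =>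
      loopEdge X rec G T cl D c u v ih)
    todo D c

def vertices (n : ℕ) : ℕ := Nat.shiftLeft (Nat.sub (Nat.pow 2 n) 1) 2

def useClause (P : Params) (X : ℕ) (rec : ℕ → ℕ → ℕ → List ℕ → ℕ → ℕ) (ch : Choice)
    (G D T : ℕ) (cl : List ℕ) (c : ℕ) (l : Clause) : ℕ :=
  build ch (known P X G D T cl) G (fun todo c => loop X rec G T cl D todo c)
    (rows l) 0 (vertices P.n) [] c

def nthRow (t : List (List Clause)) (i : ℕ) : List Clause :=
  @List.rec (List Clause) (fun _ => ℕ → List Clause) (fun _ => [])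
    (fun a _ ih i => @Nat.rec (fun _ => List Clause) a (fun j _ => ih j) i) t i

def nthClause (t : List Clause) (i : ℕ) (k : Clause → ℕ) : ℕ :=
  @List.rec Clause (fun _ => ℕ → ℕ) (fun _ => 0)
    (fun a _ ih i => @Nat.rec (fun _ => ℕ) (k a) (fun j _ => ih j) i) t i

def lookup (t : List (List Clause)) (i : ℕ) (k : Clause → ℕ) : ℕ :=
  nthClause (nthRow t (Nat.shiftRight i 5)) (Nat.land i 31) k

/-- The family of the sets in `T` that do not belong to the family `m`. -/
def unhit (T m : ℕ) : ℕ :=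
  Nat.xor (Nat.xor T (Nat.land T m))
    (Nat.land (Nat.xor T (Nat.shiftRight m 32)) 4294967295)

/-- Some `r + 1` of the cliques in `cl` meet every set in `T`. -/
def closes (r T : ℕ) (cl : List ℕ) : Bool :=
  @Nat.rec (fun _ => ℕ → List ℕ → Bool) anyKilled
    (fun _ ih T cl => @List.rec ℕ (fun _ => Bool) false
      (fun m l ihl => sel (force (unhit T m) fun T' => ih T' l) true ihl) cl)
    r T cl

/-- The product of the bitset `s` with the elements of `s` below `n`. -/
def square (s n : ℕ) : ℕ :=
  @Nat.rec (fun _ => ℕ) 0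
    (fun i ih => sel (tb s i) (Nat.lor ih (Nat.shiftLeft s (Nat.mul 32 i))) ih) n

/-- The sets in `T` that contain all elements of `s` below `n`. -/
def above (X T s n : ℕ) : ℕ :=
  @Nat.rec (fun _ => ℕ) T (fun i ih => sel (tb s i) (Nat.land ih (point X i)) ih) n

def refer (P : Params) (t : List (List Clause)) (idx : ℕ) (X : ℕ)
    (rec : ℕ → ℕ → ℕ → List ℕ → ℕ → ℕ) (ch : Choice) (G D T : ℕ) (cl : List ℕ) (id c : ℕ) : ℕ :=
  force id fun id => force c fun c =>
    sel (Nat.ble (Nat.succ id) idx) (lookup t id (useClause P X rec ch G D T cl c)) 0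

/-- Branch on whether `u v` is an edge. -/
def splitPair (X : ℕ) (rec : ℕ → ℕ → ℕ → List ℕ → ℕ → ℕ) (G D T : ℕ) (cl : List ℕ)
    (u v c : ℕ) : ℕ :=
  force u fun u => force v fun v => force c fun c =>
    loopEdge X rec G T cl D c u v fun D' c' => rec G D' T cl c'

/-- Branch on whether `s` is independent. -/
def splitSet (n X : ℕ) (rec : ℕ → ℕ → ℕ → List ℕ → ℕ → ℕ) (G D T : ℕ) (cl : List ℕ)
    (s c : ℕ) : ℕ :=
  force s fun s => force c fun c =>
  @Nat.rec (fun _ => ℕ) 0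
    (fun c' _ => force (Nat.xor T (above X T s (Nat.add n 2))) fun T' => rec G D T' cl c')
    (force (Nat.lor D (square s (Nat.add n 2))) fun D' => rec G D' T cl c)

def addTriangle (X : ℕ) (rec : ℕ → ℕ → ℕ → List ℕ → ℕ → ℕ) (G D T : ℕ) (cl : List ℕ)
    (u v w c : ℕ) : ℕ :=
  sel (tb G (Nat.add (Nat.mul 32 u) v)) (sel (tb G (Nat.add (Nat.mul 32 u) w))
    (sel (tb G (Nat.add (Nat.mul 32 v) w))
      (force c fun c =>
        force (Nat.lor (Nat.lor (Nat.lor (point X u) (point X v)) (point X w)) (tag c)) fun B =>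
        rec G D T (B :: cl) c) 0) 0) 0

/-- Apply the function number `i` of a list to `c`; if `i` is too large, use `k`. -/
def nthOp (k : ℕ → ℕ → ℕ) (fs : List (ℕ → ℕ)) (i c : ℕ) : ℕ :=
  @List.rec (ℕ → ℕ) (fun _ => ℕ → ℕ → ℕ) k
    (fun f _ ih i c => @Nat.rec (fun _ => ℕ) (f c) (fun j _ => ih j c) i) fs i c

/-- For each residue modulo `64`, the kind of step coded by it, the number of residues coding this
kind, and the number of smaller ones among them, packed in four, six and six bits. -/
def steps : ℕ :=
  56354154902513973031804878654402574018730094375429839679155519064813878283735450844060841434955931311647390832874701003037471967621152697177412441720338397475393348291580575639811625251381321482156802074595144101509051267296839200821789136921344025767330708534151373712631402775997947800458577357365345060288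

/-- Separate the number of the first step from a code. -/
def split (c : ℕ) (k : ℕ → ℕ → ℕ) : ℕ :=
  force (Nat.land (Nat.shiftRight steps (Nat.mul 16 (Nat.mod c 64))) 65535) fun w =>
    k (Nat.shiftRight w 12)
      (Nat.add (Nat.mul (Nat.land (Nat.shiftRight w 6) 63) (Nat.div c 64)) (Nat.land w 63))

/-- Interpret the code `c` as a refutation of a state, with the edges `G`, the non-edges `D`, the
family `T` of possibly independent `6`-sets and the list `cl` of families hit by known cliques.
A positive value is the successor of the remaining code. -/
def run (P : Params) (t : List (List Clause)) (sids : List ℕ) (idx : ℕ) (X : ℕ)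
    (fuel G D T : ℕ) (cl : List ℕ) (c : ℕ) : ℕ :=
  @Nat.rec (fun _ => ℕ → ℕ → ℕ → List ℕ → ℕ → ℕ) (fun _ _ _ _ _ => 0)
    (fun _ rec G D T cl c => split c
      (nthOp (fun i c => refer P t idx X rec leastFree G D T cl (nth sids i) c)
        [fun c => sel (closes (Nat.sub P.r 1) T cl) (Nat.succ c) 0,
         fun c => splitPair X rec G D T cl (Nat.add 2 (Nat.mod c P.n))
            (Nat.add 2 (Nat.mod (Nat.mod (Nat.div c P.n) (Nat.mod c P.n)) P.n))
            (Nat.div (Nat.div c P.n) (Nat.mod c P.n)),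
         fun c => refer P t idx X rec increasing G D T cl 0 c,
         fun c => refer P t idx X rec anyChoice G D T cl (Nat.mod c idx) (Nat.div c idx),
         fun c => splitSet P.n X rec G D T cl (Nat.shiftLeft (Nat.mod c (Nat.pow 2 P.n)) 2)
            (Nat.div c (Nat.pow 2 P.n)),
         fun c => addTriangle X rec G D T cl (Nat.add 2 (Nat.mod c P.n))
            (Nat.add 2 (Nat.mod (Nat.div c P.n) P.n))
            (Nat.add 2 (Nat.mod (Nat.div (Nat.div c P.n) P.n) P.n))
            (Nat.div (Nat.div (Nat.div c P.n) P.n) P.n)]))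
    fuel G D T cl c

def identity (n : ℕ) : ℕ :=
  @Nat.rec (fun _ => ℕ) 0
    (fun i ih => Nat.lor ih (Nat.shiftLeft (Nat.add 2 i) (Nat.mul 5 i))) n

/-- Add the edges between `u` and the entries of `perm` at the positions in `es`. -/
def initEdges (X perm u : ℕ) (k : ℕ → ℕ → List ℕ → ℕ) (es : List ℕ) (G T : ℕ)
    (cl : List ℕ) : ℕ :=
  @List.rec ℕ (fun _ => ℕ → ℕ → List ℕ → ℕ) k
    (fun p _ ih G T cl => force (img perm p) fun v => addEdge X G T cl u v 0 ih)
    es G T cl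

/-- Add the non-edges between `u` and the entries of `perm` at the positions in `ds`. -/
def initNonedges (perm u : ℕ) (k : ℕ → ℕ) (ds : List ℕ) (D : ℕ) : ℕ :=
  @List.rec ℕ (fun _ => ℕ → ℕ) k
    (fun p _ ih D => force (setPair D u (img perm p) 0) ih) ds D

def init (X perm : ℕ) (fin : ℕ → ℕ → ℕ → List ℕ → ℕ) (rs : List Row)
    (G D T : ℕ) (cl : List ℕ) : ℕ :=
  @List.rec Row (fun _ => ℕ → ℕ → ℕ → List ℕ → ℕ) fin
    (fun r _ ih G D T cl =>
      @Row.rec (fun _ => ℕ) (fun pos _ es ds =>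
        force (img perm pos) fun u =>
        initNonedges perm u (fun D' => initEdges X perm u
          (fun G' T' cl' => ih G' D' T' cl') es G T cl) ds D) r)
    rs G D T cl

/-- Check the clauses number `idx, idx + 1, …` of the table against the list of codes. -/
def checkFrom (P : Params) (t : List (List Clause)) (sids : List ℕ) (X : ℕ) (T : ℕ)
    (codes : List ℕ) (idx : ℕ) : Bool :=
  @List.rec ℕ (fun _ => ℕ → Bool) (fun _ => true)
    (fun c _ ih idx =>
      @Nat.rec (fun _ => Bool) false (fun _ _ => force (Nat.succ idx) ih)
        (lookup t idx fun l =>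
          sel (Nat.ble l.k P.n)
            (init X (identity P.n) (fun G D T cl => run P t sids idx X 300 G D T cl c)
              (rows l) 0 0 T []) 0))
    codes idx

/-- Binomial coefficients. -/
def binom (n k : ℕ) : ℕ :=
  @Nat.rec (fun _ => ℕ → ℕ) (fun k => sel (Nat.beq k 0) 1 0)
    (fun _ ih k => @Nat.rec (fun _ => ℕ) 1 (fun j _ => Nat.add (ih (Nat.succ j)) (ih j)) k) n k

/-- The family of those `k`-subsets of `{0, …, n - 1}` that contain `u`, as a bitset of ranks. -/
def pointFamily (u n k : ℕ) : ℕ :=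
  @Nat.rec (fun _ => ℕ → ℕ) (fun _ => 0)
    (fun i ih k => @Nat.rec (fun _ => ℕ) 0
      (fun j _ => sel (Nat.beq u i)
        (Nat.shiftLeft (Nat.sub (Nat.pow 2 (binom i j)) 1) (binom i (Nat.succ j)))
        (Nat.lor (ih (Nat.succ j)) (Nat.shiftLeft (ih j) (binom i (Nat.succ j))))) k) n k

/-- The families `pointFamily i n k` for `i < m`, packed together. -/
def points (n k m X : ℕ) (f : ℕ → Bool) : Bool :=
  @Nat.rec (fun _ => ℕ → Bool) f
    (fun i ih X => force (Nat.lor X (Nat.shiftLeft (Nat.add (Nat.shiftLeft (pointFamily i n k) 64)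
      (Nat.shiftLeft (Nat.mul (Nat.succ i) 123456789) 32)) (Nat.mul 16384 (Nat.add i 2)))) ih) m X

def check (P : Params) (t : List (List Clause)) (sids codes : List ℕ) (idx : ℕ) : Bool :=
  points P.n 6 P.n 0 fun X =>
    force (Nat.shiftLeft (Nat.sub (Nat.pow 2 (binom P.n 6)) 1) 64) fun T =>
      checkFrom P t sids X T codes idx

end IndepCert

namespace IndepCert

theorem land_eq (a b : ℕ) : Nat.land a b = a &&& b := rfl
theorem lor_eq (a b : ℕ) : Nat.lor a b = a ||| b := rfl
theorem xor_eq (a b : ℕ) : Nat.xor a b = a ^^^ b := rfl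
theorem shiftLeft_eq (a b : ℕ) : Nat.shiftLeft a b = a <<< b := rfl
theorem shiftRight_eq (a b : ℕ) : Nat.shiftRight a b = a >>> b := rfl

theorem force_eq {α : Type} (x : ℕ) (k : ℕ → α) : force x k = k x := by
  cases x <;> rfl

theorem sel_eq {α : Type} (b : Bool) (x y : α) : sel b x y = bif b then x else y := by
  cases b <;> rfl

theorem tb_eq (m i : ℕ) : tb m i = m.testBit i := by
  have h : m.testBit i = decide ((m >>> i) &&& 1 = 1) := by
    rw [Nat.testBit, Nat.and_comm, Nat.and_one_is_mod]
    rcases Nat.mod_two_eq_zero_or_one (m >>> i) with h | h <;> simp [h]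
  rw [h, Bool.eq_iff_iff, tb, Nat.beq_eq, decide_eq_true_eq]
  rfl

theorem testBit_row (G u v : ℕ) : (row G u).testBit v = G.testBit (32 * u + v) := by
  simp [row]

theorem img_lt (perm p : ℕ) : img perm p < 32 :=
  lt_of_le_of_lt (Nat.and_le_right (n := perm >>> p) (m := 31)) (by norm_num)

theorem killed_iff (T B : ℕ) : killed T B = true ↔ ∀ p, T.testBit p = true → B.testBit p = true := by
  rw [killed, Nat.beq_eq, land_eq]
  constructor
  · intro h p hp
    have := congrArg (fun x => Nat.testBit x p) h
    simpa [hp] using this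
  · intro h
    apply Nat.eq_of_testBit_eq
    intro p
    rw [Nat.testBit_and]
    cases hp : T.testBit p
    · rfl
    · simp [h p hp]

theorem anyKilled_iff (T : ℕ) (cl : List ℕ) :
    anyKilled T cl = true ↔ ∃ m ∈ cl, killed T m = true := by
  induction cl with
  | nil => simp [anyKilled]
  | cons m cl ih =>
    have h : anyKilled T (m :: cl) = sel (killed T m) true (anyKilled T cl) := rfl
    rw [h, sel_eq]
    cases hk : killed T m <;> simp [hk, ih]

theorem mem_elems (m i p : ℕ) :
    p ∈ elems m i ↔ ∃ j < i, m.testBit j = true ∧ p = 5 * j := by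
  induction i with
  | zero => simp [elems]
  | succ i ih =>
    have hs : elems m (i + 1) = sel (tb m i) (5 * i :: elems m i) (elems m i) := rfl
    rw [hs, sel_eq, tb_eq]
    cases hb : m.testBit i
    · simp only [cond_false, ih]
      constructor
      · rintro ⟨j, hj, h⟩
        exact ⟨j, by omega, h⟩
      · rintro ⟨j, hj, h, hp⟩
        refine ⟨j, ?_, h, hp⟩
        rcases Nat.lt_succ_iff_lt_or_eq.1 hj with h' | rfl
        · exact h'
        · simp [hb] at h
    · simp only [cond_true, List.mem_cons, ih]
      constructor
      · rintro (rfl | ⟨j, hj, h⟩)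
        · exact ⟨i, by omega, hb, rfl⟩
        · exact ⟨j, by omega, h⟩
      · rintro ⟨j, hj, h, hp⟩
        rcases Nat.lt_succ_iff_lt_or_eq.1 hj with h' | rfl
        · exact Or.inr ⟨j, h', h, hp⟩
        · exact Or.inl hp

theorem testBit_inter (G perm : ℕ) (es : List ℕ) (cand v : ℕ)
    (h : (inter G perm es cand).testBit v = true) :
    cand.testBit v = true ∧ ∀ p ∈ es, G.testBit (32 * img perm p + v) = true := by
  induction es generalizing cand with
  | nil => exact ⟨h, by simp⟩
  | cons p es ih =>
    have h' : inter G perm (p :: es) cand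
      = inter G perm es (Nat.land cand (row G (img perm p))) := rfl
    rw [h'] at h
    obtain ⟨h1, h2⟩ := ih _ h
    rw [land_eq, Nat.testBit_and, testBit_row, Bool.and_eq_true] at h1
    refine ⟨h1.1, ?_⟩
    simpa using ⟨h1.2, h2⟩

theorem testBit_excl (G perm : ℕ) (ds : List ℕ) (cand v : ℕ)
    (h : (excl G perm ds cand).testBit v = true) : cand.testBit v = true := by
  induction ds generalizing cand with
  | nil => exact h
  | cons p ds ih =>
    have h' : excl G perm (p :: ds) cand
      = excl G perm ds (Nat.xor cand (Nat.land cand (row G (img perm p)))) := rfl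
    rw [h'] at h
    have h1 := ih _ h
    rw [xor_eq, land_eq, Nat.testBit_xor, Nat.testBit_and] at h1
    revert h1
    cases cand.testBit v <;> simp

theorem testBit_setPair (M u v c p : ℕ) (hp : 64 ≤ p) :
    (setPair M u v c).testBit p = true ↔
      M.testBit p = true ∨ p = 32 * u + v ∨ p = 32 * v + u := by
  have hc : (18446744073709551615 : ℕ).testBit p = false :=
    Nat.testBit_lt_two_pow (lt_of_lt_of_le (by norm_num) (Nat.pow_le_pow_right (by norm_num) hp))
  simp only [setPair, xor_eq, land_eq, lor_eq, shiftLeft_eq, Nat.testBit_xor, Nat.testBit_and, hc,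
    Bool.and_false, Bool.false_xor, Nat.testBit_or, Bool.or_eq_true, Nat.one_shiftLeft,
    Nat.testBit_two_pow, decide_eq_true_eq, Nat.add_eq, Nat.mul_eq]
  tauto

theorem testBit_tag (c p : ℕ) (hp : 64 ≤ p) : (tag c).testBit p = false := by
  have h1 : (4294967295 : ℕ).testBit p = false :=
    Nat.testBit_lt_two_pow (lt_of_lt_of_le (by norm_num) (Nat.pow_le_pow_right (by norm_num) hp))
  have h2 : (4294967295 : ℕ).testBit (p - 32) = false :=
    Nat.testBit_lt_two_pow (lt_of_lt_of_le (b := 2 ^ 32) (by norm_num)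
      (Nat.pow_le_pow_right (by norm_num) (by omega)))
  simp [tag, h1, h2]

end IndepCert

namespace IndepCert

/-- The numbers used as names of the vertices. -/
def Name (n u : ℕ) : Prop := 2 ≤ u ∧ u < n + 2

/-- The bit number `p` stands for the set `I`. -/
def Codes {V : Type*} (f : ℕ → V) (X n : ℕ) (I : Finset V) (p : ℕ) : Prop :=
  64 ≤ p ∧ ∀ u, Name n u → ((point X u).testBit p = true ↔ f u ∈ I)

/-- The graph `H`, with vertices named by `f`, is described by the state `G`, `D`, `T`, `cl`. -/
structure Sat {V : Type*} (H : SimpleGraph V) (f : ℕ → V) (X n G D T : ℕ) (cl : List ℕ) :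
    Prop where
  edges : ∀ u w, Name n u → w < 32 → G.testBit (32 * u + w) = true →
    Name n w ∧ H.Adj (f u) (f w)
  nonedges : ∀ u w, Name n u → Name n w → D.testBit (32 * u + w) = true → ¬ H.Adj (f u) (f w)
  sets : ∀ I : Finset V, H.IsNIndepSet 6 I → ∃ p, Codes f X n I p ∧ T.testBit p = true
  cliques : ∀ m ∈ cl, ∃ C : Finset V, H.IsClique (C : Set V) ∧
    ∀ I p, H.IsNIndepSet 6 I → Codes f X n I p → m.testBit p = true → ¬ Disjoint C I

/-- Any `r` cliques are avoided by an independent set of size `k`. -/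
def Unstabbed {V : Type*} (H : SimpleGraph V) (k r : ℕ) : Prop :=
  ∀ L : List (Finset V), L.length = r → (∀ C ∈ L, H.IsClique (C : Set V)) →
    ∃ I : Finset V, H.IsNIndepSet k I ∧ ∀ C ∈ L, Disjoint C I

section

variable {V : Type*} {H : SimpleGraph V} {f : ℕ → V} {X n : ℕ} {G D T : ℕ} {cl : List ℕ}

theorem addEdge_spec {α : Type} (hn : n ≤ 30) (hS : Sat H f X n G D T cl) {u v : ℕ}
    (hu : Name n u) (hv : Name n v) (huv : H.Adj (f u) (f v)) (c : ℕ)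
    (k : ℕ → ℕ → List ℕ → α) :
    ∃ G' T' cl', addEdge X G T cl u v c k = k G' T' cl' ∧ Sat H f X n G' D T' cl' := by
  classical
  refine ⟨setPair G u v c, (T.xor (T.land ((point X u).land (point X v)))).xor (c.land 4294967295),
    ((point X u).lor (point X v)).lor (tag c) :: cl, by simp only [addEdge, force_eq],
    ?_, hS.nonedges, ?_, ?_⟩
  · intro a b ha hb h
    obtain ⟨hu1, hu2⟩ := hu
    obtain ⟨hv1, hv2⟩ := hv
    rw [testBit_setPair _ _ _ _ _ (by have := ha.1; omega)] at h
    rcases h with h | h | h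
    · exact hS.edges a b ha hb h
    · obtain ⟨rfl, rfl⟩ : a = u ∧ b = v := by omega
      exact ⟨⟨hv1, hv2⟩, huv⟩
    · obtain ⟨rfl, rfl⟩ : a = v ∧ b = u := by omega
      exact ⟨⟨hu1, hu2⟩, huv.symm⟩
  · intro I hI
    obtain ⟨p, hp, hT⟩ := hS.sets I hI
    refine ⟨p, hp, ?_⟩
    have hc : (4294967295 : ℕ).testBit p = false :=
      Nat.testBit_lt_two_pow
        (lt_of_lt_of_le (by norm_num) (Nat.pow_le_pow_right (by norm_num) hp.1))
    have h : ¬ ((point X u).testBit p = true ∧ (point X v).testBit p = true) := by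
      rw [hp.2 u hu, hp.2 v hv]
      exact fun h => hI.isIndepSet h.1 h.2 huv.ne huv
    simp only [xor_eq, land_eq, Nat.testBit_xor, Nat.testBit_and, hc, hT]
    revert h
    cases (point X u).testBit p <;> cases (point X v).testBit p <;> simp
  · intro m hm
    rcases List.mem_cons.1 hm with rfl | hm
    · refine ⟨{f u, f v}, by simp [SimpleGraph.isClique_iff, Set.pairwise_insert, huv, huv.symm],
        fun I p hI hp hb => ?_⟩
      rw [lor_eq, lor_eq, Nat.testBit_or, testBit_tag _ _ hp.1, Nat.testBit_or, Bool.or_false,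
        Bool.or_eq_true, hp.2 u hu, hp.2 v hv] at hb
      rw [Finset.not_disjoint_iff]
      rcases hb with h | h
      · exact ⟨f u, by simp, h⟩
      · exact ⟨f v, by simp, h⟩
    · exact hS.cliques m hm

theorem Sat.setPair (hS : Sat H f X n G D T cl) (hn : n ≤ 30) {u v : ℕ} (hu : u < 32) (hv : v < 32)
    (huv : ¬ H.Adj (f u) (f v)) (c : ℕ) : Sat H f X n G (setPair D u v c) T cl := by
  refine ⟨hS.edges, fun a b ha hb h => ?_, hS.sets, hS.cliques⟩
  have ha' := ha.2
  have hb' := hb.2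
  rw [testBit_setPair _ _ _ _ _ (by have := ha.1; omega)] at h
  rcases h with h | h | h
  · exact hS.nonedges a b ha hb h
  · obtain ⟨rfl, rfl⟩ : a = u ∧ b = v := by omega
    exact huv
  · obtain ⟨rfl, rfl⟩ : a = v ∧ b = u := by omega
    exact fun h => huv h.symm

/-- The interpreter `rec` is sound. -/
def Sound (H : SimpleGraph V) (f : ℕ → V) (X n : ℕ)
    (rec : ℕ → ℕ → ℕ → List ℕ → ℕ → ℕ) : Prop :=
  ∀ G D T cl c, rec G D T cl c ≠ 0 → ¬ Sat H f X n G D T cl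

variable {rec : ℕ → ℕ → ℕ → List ℕ → ℕ → ℕ}

theorem loopEdge_spec (hn : n ≤ 30) (hrec : Sound H f X n rec) (hS : Sat H f X n G D T cl)
    {u v : ℕ} (hu : u < 32) (hv : v < 32) (huv : H.Adj (f u) (f v) → Name n u ∧ Name n v)
    {c : ℕ} {ih : ℕ → ℕ → ℕ} (h : loopEdge X rec G T cl D c u v ih ≠ 0) :
    ¬ H.Adj (f u) (f v) ∧ ∃ D' c', ih D' c' ≠ 0 ∧ Sat H f X n G D' T cl := by
  rw [loopEdge] at h
  generalize hx : addEdge X G T cl u v c _ = x at h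
  cases x with
  | zero => exact absurd rfl h
  | succ c' =>
    have hadj : ¬ H.Adj (f u) (f v) := by
      intro hadj
      obtain ⟨hu', hv'⟩ := huv hadj
      obtain ⟨G', T', cl', h1, h2⟩ := addEdge_spec hn hS hu' hv' hadj c
        fun G' T' cl' => rec G' D T' cl' c
      rw [h1] at hx
      exact hrec _ _ _ _ _ (by rw [hx]; exact Nat.succ_ne_zero _) h2
    refine ⟨hadj, _, c', ?_, hS.setPair hn hu hv hadj c'⟩
    simpa only [force_eq] using h

theorem loop_spec (hn : n ≤ 30) (hrec : Sound H f X n rec) (todo : List ℕ) (c : ℕ)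
    (hS : Sat H f X n G D T cl)
    (htodo : ∀ p ∈ todo, ∃ u v, Name n u ∧ Name n v ∧ p = 32 * u + v)
    (h : loop X rec G T cl D todo c ≠ 0) {u v : ℕ} (hv : Name n v)
    (huv : 32 * u + v ∈ todo) : ¬ H.Adj (f u) (f v) := by
  induction todo generalizing D c with
  | nil => simp at huv
  | cons p todo ih =>
    have h' : loop X rec G T cl D (p :: todo) c =
      force (Nat.shiftRight p 5) fun u => force (Nat.land p 31) fun v =>
      loopEdge X rec G T cl D c u v fun D' c' => loop X rec G T cl D' todo c' := rfl
    rw [h'] at h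
    simp only [force_eq] at h
    obtain ⟨a, b, ha, hb, rfl⟩ := htodo p (by simp)
    have ha' := ha.2
    have hb' := hb.2
    have h1 : (32 * a + b).shiftRight 5 = a := by
      rw [shiftRight_eq, Nat.shiftRight_eq_div_pow]
      omega
    have h2 : Nat.land (32 * a + b) 31 = b := by
      rw [land_eq, show 31 = 2 ^ 5 - 1 by norm_num, Nat.and_two_pow_sub_one_eq_mod]
      omega
    rw [h1, h2] at h
    obtain ⟨hadj, D', c', hc, hS'⟩ :=
      loopEdge_spec hn hrec hS (by omega) (by omega) (fun _ => ⟨ha, hb⟩) h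
    rcases List.mem_cons.1 huv with h0 | h0
    · have hv' := hv.2
      obtain ⟨rfl, rfl⟩ : u = a ∧ v = b := by omega
      exact hadj
    · exact ih _ hS' (fun q hq => htodo q (by simp [hq])) hc h0

end

end IndepCert

namespace IndepCert

theorem img_eq (perm p : ℕ) : img perm p = perm / 2 ^ p % 32 := by
  rw [img, land_eq, shiftRight_eq, Nat.shiftRight_eq_div_pow, show 31 = 2 ^ 5 - 1 by norm_num,
    Nat.and_two_pow_sub_one_eq_mod]

theorem img_add_of_lt (perm v : ℕ) {i j : ℕ} (hj : j < i) :
    img (perm + v <<< (5 * i)) (5 * j) = img perm (5 * j) := by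
  obtain ⟨t, rfl⟩ := Nat.exists_eq_add_of_lt hj
  rw [img_eq, img_eq, Nat.shiftLeft_eq,
    show v * 2 ^ (5 * (j + t + 1)) = 2 ^ (5 * j) * (32 * (2 ^ (5 * t) * v)) by ring,
    Nat.add_mul_div_left _ _ (by positivity), Nat.add_mul_mod_self_left]

theorem img_add_self {perm v i : ℕ} (hp : perm < 2 ^ (5 * i)) (hv : v < 32) :
    img (perm + v <<< (5 * i)) (5 * i) = v := by
  rw [img_eq, Nat.shiftLeft_eq, mul_comm, Nat.add_mul_div_left _ _ (by positivity),
    Nat.div_eq_of_lt hp, zero_add, Nat.mod_eq_of_lt hv]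

theorem testBit_vertices (n v : ℕ) : (vertices n).testBit v = true ↔ Name n v := by
  simp only [vertices, shiftLeft_eq, Nat.sub_eq, Nat.pow_eq, Nat.testBit_shiftLeft,
    Nat.testBit_two_pow_sub_one, Bool.and_eq_true, decide_eq_true_eq, Name]
  omega

/-- The clause holds in the graph `H`. -/
def Clause.Valid {V : Type*} (H : SimpleGraph V) (l : Clause) : Prop :=
  ∀ g : ℕ → V, Set.InjOn g (Set.Iio l.k) →
    (∀ i < l.k, ∀ j < i, (triRow l.E i).testBit j = true → H.Adj (g i) (g j)) →
    ∃ i < l.k, ∃ j < i, (triRow l.D i).testBit j = true ∧ H.Adj (g i) (g j)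

section

variable {V : Type*} {H : SimpleGraph V} {f : ℕ → V} {X n : ℕ} {G D T : ℕ} {cl : List ℕ}

/-- The graph satisfies the standing assumptions of a refutation. -/
structure Params.Holds (P : Params) (H : SimpleGraph V) : Prop where
  pos : 0 < P.n
  le : P.n ≤ 30
  one_le : 1 ≤ P.r
  unstabbed : Unstabbed H 6 P.r
  triangle : P.tri = true → H.CliqueFree 3

theorem known_spec {P : Params} (hP : P.Holds H) (hS : Sat H f X P.n G D T cl) {u v : ℕ}
    (hu : Name P.n u) (hv : Name P.n v) (h : known P X G D T cl u v = true) :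
    ¬ H.Adj (f u) (f v) := by
  classical
  intro hadj
  rw [known, sel_eq, tb_eq] at h
  cases hD : D.testBit (Nat.add (Nat.mul 32 u) v) with
  | true => exact hS.nonedges u v hu hv hD hadj
  | false =>
    rw [hD, cond_false, sel_eq, sel_eq] at h
    cases hc : (bif P.tri then Nat.beq (Nat.land (Nat.land (row G u) (row G v)) 524287) 0 else true)
      with
    | false =>
      cases ht : P.tri with
      | false => simp [ht] at hc
      | true =>
        rw [ht, cond_true] at hc
        obtain ⟨w, hw⟩ : ∃ w, (Nat.land (Nat.land (row G u) (row G v)) 524287).testBit w = true := by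
          by_contra! hcon
          have h0 : Nat.land (Nat.land (row G u) (row G v)) 524287 = 0 :=
            Nat.eq_of_testBit_eq fun i => by rw [Nat.zero_testBit]; exact Bool.eq_false_iff.2 (hcon i)
          rw [h0] at hc
          simp at hc
        rw [land_eq, land_eq, Nat.testBit_and, Nat.testBit_and, Bool.and_eq_true, Bool.and_eq_true,
          testBit_row, testBit_row] at hw
        have hw32 : w < 32 := by
          by_contra! hcon
          rw [Nat.testBit_lt_two_pow (lt_of_lt_of_le (b := 2 ^ 32) (by norm_num)
            (Nat.pow_le_pow_right (by norm_num) hcon))] at hw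
          simp at hw
        have h1 := (hS.edges u w hu hw32 hw.1.1).2
        have h2 := (hS.edges v w hv hw32 hw.1.2).2
        exact hP.triangle ht {f u, f v, f w} (SimpleGraph.is3Clique_triple_iff.2 ⟨hadj, h1, h2⟩)
    | true =>
      rw [hc, cond_true, sel_eq] at h
      cases hr : Nat.beq P.r 2 with
      | false => simp [hr] at h
      | true =>
        rw [hr, cond_true, killTest, anyKilled_iff] at h
        obtain ⟨m, hm, hk⟩ := h
        rw [killed_iff] at hk
        obtain ⟨C, hC, hCI⟩ := hS.cliques m hm
        have hr2 : P.r = 2 := Nat.eq_of_beq_eq_true hr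
        obtain ⟨I, hI, hdis⟩ := hP.unstabbed [{f u, f v}, C] (by simp [hr2]) (by
          rintro C' hC'
          rcases List.mem_pair.1 hC' with rfl | rfl
          · simp [SimpleGraph.isClique_iff, Set.pairwise_insert, hadj, hadj.symm]
          · exact hC)
        obtain ⟨p, hp, hT⟩ := hS.sets I hI
        refine hCI I p hI hp (hk p ?_) (hdis C (by simp))
        have h1 := hdis {f u, f v} (by simp)
        have hu' : (point X u).testBit p = false := by
          rw [← Bool.not_eq_true, hp.2 u hu]
          exact Finset.disjoint_left.1 h1 (by simp)
        have hv' : (point X v).testBit p = false := by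
          rw [← Bool.not_eq_true, hp.2 v hv]
          exact Finset.disjoint_left.1 h1 (by simp)
        simp [hT, hu', hv']

theorem addPairs_spec (kn : ℕ → ℕ → Bool) (perm v : ℕ) (k : List ℕ → ℕ) (ds todo : List ℕ)
    (h : addPairs kn perm v k ds todo ≠ 0) :
    ∃ todo', k todo' ≠ 0 ∧ todo ⊆ todo' ∧
      (∀ p ∈ ds, kn v (img perm p) = true ∨ 32 * v + img perm p ∈ todo') ∧
      ∀ q ∈ todo', q ∈ todo ∨ ∃ p ∈ ds, q = 32 * v + img perm p := by
  induction ds generalizing todo with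
  | nil => exact ⟨todo, h, fun _ h => h, by simp, fun q hq => Or.inl hq⟩
  | cons p ds ih =>
    have h' : addPairs kn perm v k (p :: ds) todo = force (img perm p) fun w =>
      sel (kn v w) (addPairs kn perm v k ds todo)
        (addPairs kn perm v k ds ((32 * v + w) :: todo)) := rfl
    rw [h', force_eq, sel_eq] at h
    cases hk : kn v (img perm p)
    · rw [hk, cond_false] at h
      obtain ⟨todo', h1, h2, h3, h4⟩ := ih _ h
      refine ⟨todo', h1, fun q hq => h2 (List.mem_cons_of_mem _ hq), fun q hq => ?_, fun q hq => ?_⟩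
      · rcases List.mem_cons.1 hq with rfl | hq
        · exact Or.inr (h2 (by simp))
        · exact h3 q hq
      · rcases h4 q hq with h | ⟨p', hp', h⟩
        · rcases List.mem_cons.1 h with h | h
          · exact Or.inr ⟨p, by simp, h⟩
          · exact Or.inl h
        · exact Or.inr ⟨p', by simp [hp'], h⟩
    · rw [hk, cond_true] at h
      obtain ⟨todo', h1, h2, h3, h4⟩ := ih _ h
      refine ⟨todo', h1, h2, fun q hq => ?_, fun q hq => ?_⟩
      · rcases List.mem_cons.1 hq with rfl | hq
        · exact Or.inl hk
        · exact h3 q hq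
      · rcases h4 q hq with h | ⟨p', hp', h⟩
        · exact Or.inl h
        · exact Or.inr ⟨p', by simp [hp'], h⟩

/-- The first `i` vertices of the clause with edges `E` and pairs `F` are embedded. -/
structure Embeds (H : SimpleGraph V) (f : ℕ → V) (n E F i perm free : ℕ) (todo : List ℕ) :
    Prop where
  perm_lt : perm < 2 ^ (5 * i)
  free : ∀ v, free.testBit v = true → Name n v ∧ ∀ j < i, img perm (5 * j) ≠ v
  name : ∀ j < i, Name n (img perm (5 * j))
  inj : ∀ a < i, ∀ b < a, img perm (5 * b) ≠ img perm (5 * a)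
  edges : ∀ a < i, ∀ b < a, (triRow E a).testBit b = true →
    H.Adj (f (img perm (5 * a))) (f (img perm (5 * b)))
  pairs : ∀ a < i, ∀ b < a, (triRow F a).testBit b = true →
    ¬ H.Adj (f (img perm (5 * a))) (f (img perm (5 * b))) ∨
      32 * img perm (5 * a) + img perm (5 * b) ∈ todo
  todo : ∀ p ∈ todo, ∃ u v, Name n u ∧ Name n v ∧ p = 32 * u + v

theorem Embeds.succ {E F i perm free : ℕ} {todo todo' : List ℕ} (hn : n ≤ 30)
    (h : Embeds H f n E F i perm free todo) {v : ℕ} (hv : free.testBit v = true)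
    (hE : ∀ b < i, (triRow E i).testBit b = true → H.Adj (f v) (f (img perm (5 * b))))
    (hF : ∀ b < i, (triRow F i).testBit b = true →
      ¬ H.Adj (f v) (f (img perm (5 * b))) ∨ 32 * v + img perm (5 * b) ∈ todo')
    (hsub : todo ⊆ todo')
    (htodo : ∀ q ∈ todo', q ∈ todo ∨ ∃ b < i, q = 32 * v + img perm (5 * b)) :
    Embeds H f n E F (i + 1) (perm + v <<< (5 * i)) (free ^^^ (1 <<< v)) todo' := by
  obtain ⟨hvn, hvj⟩ := h.free v hv
  have hv32 : v < 32 := by have := hvn.2; omega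
  have hself := img_add_self h.perm_lt hv32
  have hlt : ∀ j < i, img (perm + v <<< (5 * i)) (5 * j) = img perm (5 * j) :=
    fun j hj => img_add_of_lt perm v hj
  refine ⟨?_, ?_, ?_, ?_, ?_, ?_, ?_⟩
  · rw [Nat.shiftLeft_eq, show 2 ^ (5 * (i + 1)) = 32 * 2 ^ (5 * i) by ring]
    have := h.perm_lt
    have : v * 2 ^ (5 * i) ≤ 31 * 2 ^ (5 * i) := Nat.mul_le_mul_right _ (by omega)
    omega
  · intro w hw
    rw [Nat.testBit_xor, Nat.one_shiftLeft, Nat.testBit_two_pow] at hw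
    have hwv : v ≠ w := by
      rintro rfl
      simp [hv] at hw
    rw [decide_eq_false hwv, Bool.xor_false] at hw
    refine ⟨(h.free w hw).1, fun j hj => ?_⟩
    rcases Nat.lt_succ_iff_lt_or_eq.1 hj with hj | rfl
    · rw [hlt j hj]
      exact (h.free w hw).2 j hj
    · rwa [hself]
  · intro j hj
    rcases Nat.lt_succ_iff_lt_or_eq.1 hj with hj | rfl
    · rw [hlt j hj]
      exact h.name j hj
    · rwa [hself]
  · intro a ha b hb
    rcases Nat.lt_succ_iff_lt_or_eq.1 ha with ha | rfl
    · rw [hlt a ha, hlt b (hb.trans ha)]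
      exact h.inj a ha b hb
    · rw [hself, hlt b hb]
      exact hvj b hb
  · intro a ha b hb hab
    rcases Nat.lt_succ_iff_lt_or_eq.1 ha with ha | rfl
    · rw [hlt a ha, hlt b (hb.trans ha)]
      exact h.edges a ha b hb hab
    · rw [hself, hlt b hb]
      exact hE b hb hab
  · intro a ha b hb hab
    rcases Nat.lt_succ_iff_lt_or_eq.1 ha with ha | rfl
    · rw [hlt a ha, hlt b (hb.trans ha)]
      exact (h.pairs a ha b hb hab).imp id fun h => hsub h
    · rw [hself, hlt b hb]
      exact hF b hb hab
  · intro q hq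
    rcases htodo q hq with hq | ⟨b, hb, rfl⟩
    · exact h.todo q hq
    · exact ⟨v, _, hvn, h.name b hb, rfl⟩

/-- Whatever is chosen, it is passed on. -/
def IsChoice (ch : Choice) : Prop :=
  ∀ r perm cand c k, ch r perm cand c k ≠ 0 → ∃ v c', k v c' ≠ 0

theorem chooseAny_spec {cand c : ℕ} {k : ℕ → ℕ → ℕ} (h : chooseAny cand c k ≠ 0) :
    ∃ v c', k v c' ≠ 0 := by
  rw [chooseAny, force_eq, force_eq] at h
  exact ⟨_, _, h⟩

theorem chooseLow_spec {cand c : ℕ} {k : ℕ → ℕ → ℕ} (h : chooseLow cand c k ≠ 0) :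
    ∃ v c', k v c' ≠ 0 := by
  rw [chooseLow, force_eq] at h
  exact ⟨_, _, h⟩

theorem skip_spec {left : ℕ} {k : ℕ → ℕ → ℕ} (fuel : ℕ) {cand c : ℕ}
    (h : skip left k fuel cand c ≠ 0) : ∃ v c', k v c' ≠ 0 := by
  induction fuel generalizing cand c with
  | zero => exact absurd rfl h
  | succ fuel ih =>
    have h' : skip left k (fuel + 1) cand c =
      sel (Nat.ble (popcount cand) left) (chooseLow cand c k)
        (force (Nat.div c 2) fun c' => sel (tb c 0)
          (force (dropLow cand) fun cand' => skip left k fuel cand' c') (chooseLow cand c' k)) := rfl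
    rw [h', sel_eq, force_eq, force_eq, sel_eq] at h
    cases h1 : Nat.ble (popcount cand) left with
    | true =>
      rw [h1, cond_true] at h
      exact chooseLow_spec h
    | false =>
      rw [h1, cond_false] at h
      cases h2 : tb c 0 with
      | true =>
        rw [h2, cond_true] at h
        exact ih h
      | false =>
        rw [h2, cond_false] at h
        exact chooseLow_spec h

theorem isChoice_anyChoice : IsChoice anyChoice := fun _ _ _ _ _ h => chooseAny_spec h

theorem isChoice_increasing : IsChoice increasing := by
  rintro ⟨pos, left, es, ds⟩ perm cand c k h
  simp only [increasing, force_eq] at h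
  exact skip_spec _ h

theorem isChoice_leastFree : IsChoice leastFree := by
  rintro ⟨pos, left, es, ds⟩ perm cand c k h
  cases es with
  | nil =>
    cases pos with
    | zero => exact chooseAny_spec h
    | succ pos => exact chooseLow_spec h
  | cons p es => exact chooseAny_spec h

theorem build_spec {P : Params} (hP : P.Holds H) (hS : Sat H f X P.n G D T cl)
    {ch : Choice} (hch : IsChoice ch) (fin : List ℕ → ℕ → ℕ) {E F : ℕ} (k i : ℕ) {perm free : ℕ}
    {todo : List ℕ} {c : ℕ} (hemb : Embeds H f P.n E F i perm free todo)
    (h : build ch (known P X G D T cl) G fin (rowsFrom E F k i) perm free todo c ≠ 0) :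
    ∃ perm free todo c, Embeds H f P.n E F (i + k) perm free todo ∧ fin todo c ≠ 0 := by
  induction k generalizing i perm free todo c with
  | zero => exact ⟨perm, free, todo, c, hemb, h⟩
  | succ k ih =>
    have h' : build ch (known P X G D T cl) G fin (rowsFrom E F (k + 1) i) perm free todo c =
      force (excl G perm (elems (triRow F i) i) (inter G perm (elems (triRow E i) i) free))
        (place ch (known P X G D T cl)
          (build ch (known P X G D T cl) G fin (rowsFrom E F k (i + 1)))
          ⟨5 * i, k.succ, elems (triRow E i) i, elems (triRow F i) i⟩
          (5 * i) (elems (triRow F i) i) perm free todo c) := rfl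
    rw [h', force_eq, place] at h
    set c₂ := excl G perm (elems (triRow F i) i) (inter G perm (elems (triRow E i) i) free) with hc₂
    obtain ⟨v, c', h⟩ := hch _ _ _ _ _ h
    rw [placeAt, sel_eq, tb_eq] at h
    cases hv : c₂.testBit v with
    | false => simp [hv] at h
    | true =>
      rw [hv, cond_true] at h
      obtain ⟨todo', h1, h2, h3, h4⟩ := addPairs_spec _ _ _ _ _ _ h
      obtain ⟨hfree, hG⟩ := testBit_inter _ _ _ _ _ (testBit_excl _ _ _ _ _ hv)
      have hvn := (hemb.free v hfree).1
      have hle := hP.le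
      have := ih (i + 1) (hemb.succ hP.le hfree ?_ ?_ h2 ?_) h1
      · rwa [Nat.add_assoc, Nat.add_comm 1 k] at this
      · intro b hb hbit
        have h5 := hG (5 * b) ((mem_elems _ _ _).2 ⟨b, hb, hbit, rfl⟩)
        exact (hS.edges _ _ (hemb.name b hb) (by have := hvn.2; omega) h5).2.symm
      · intro b hb hbit
        refine (h3 (5 * b) ((mem_elems _ _ _).2 ⟨b, hb, hbit, rfl⟩)).imp (fun h5 => ?_) id
        exact known_spec hP hS hvn (hemb.name b hb) h5
      · intro q hq
        refine (h4 q hq).imp id ?_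
        rintro ⟨p, hp, rfl⟩
        obtain ⟨b, hb, -, rfl⟩ := (mem_elems _ _ _).1 hp
        exact ⟨b, hb, rfl⟩

theorem useClause_sound {P : Params} (hP : P.Holds H)
    {rec : ℕ → ℕ → ℕ → List ℕ → ℕ → ℕ} (hrec : Sound H f X P.n rec)
    (hf : Set.InjOn f {u | Name P.n u}) {ch : Choice} (hch : IsChoice ch)
    {l : Clause} (hl : l.Valid H) {c : ℕ}
    (h : useClause P X rec ch G D T cl c l ≠ 0) : ¬ Sat H f X P.n G D T cl := by
  intro hS
  obtain ⟨k, E, F⟩ := l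
  have h' : useClause P X rec ch G D T cl c ⟨k, E, F⟩ =
    build ch (known P X G D T cl) G (fun todo c => loop X rec G T cl D todo c)
      (rowsFrom E F k 0) 0 (vertices P.n) [] c := rfl
  rw [h'] at h
  have hemb : Embeds H f P.n E F 0 0 (vertices P.n) [] :=
    ⟨by simp, fun v hv => ⟨(testBit_vertices _ _).1 hv, by simp⟩, by simp, by simp, by simp,
      by simp, by simp⟩
  obtain ⟨perm, free, todo, c, hemb, h⟩ := build_spec hP hS hch _ k 0 hemb h
  rw [zero_add] at hemb
  obtain ⟨a, ha, b, hb, hbit, hadj⟩ := hl (fun i => f (img perm (5 * i))) (by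
    intro a ha b hb hab
    have h1 := hf (hemb.name a ha) (hemb.name b hb) hab
    rcases lt_trichotomy a b with hlt | rfl | hlt
    · exact absurd h1 (hemb.inj b hb a hlt)
    · rfl
    · exact absurd h1.symm (hemb.inj a ha b hlt)) hemb.edges
  rcases hemb.pairs a ha b hb hbit with h1 | h1
  · exact h1 hadj
  · exact loop_spec hP.le hrec todo c hS hemb.todo h (hemb.name b (lt_trans hb ha)) h1 hadj

end

end IndepCert

namespace IndepCert

/-- The clause number `i` of a table. -/
def entry (t : List (List Clause)) (i : ℕ) : Option Clause := (t.getD (i >>> 5) [])[i &&& 31]?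

theorem lookup_spec (t : List (List Clause)) (i : ℕ) (k : Clause → ℕ) (h : lookup t i k ≠ 0) :
    ∃ l, entry t i = some l ∧ k l ≠ 0 := by
  have hrow : ∀ (t : List (List Clause)) i, nthRow t i = t.getD i [] := by
    intro t
    induction t with
    | nil => exact fun i => rfl
    | cons a t ih =>
      intro i
      cases i with
      | zero => rfl
      | succ i => exact (ih i).trans (by simp)
  have hcl : ∀ (t : List Clause) i, nthClause t i k ≠ 0 → ∃ l, t[i]? = some l ∧ k l ≠ 0 := by
    intro t
    induction t with
    | nil => exact fun i h => absurd rfl h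
    | cons a t ih =>
      intro i h
      cases i with
      | zero => exact ⟨a, rfl, h⟩
      | succ i => simpa using ih i h
  rw [lookup, hrow] at h
  exact hcl _ _ h

theorem testBit_above (X T s n p : ℕ) (h : (above X T s n).testBit p = true) :
    T.testBit p = true ∧ ∀ u < n, s.testBit u = true → (point X u).testBit p = true := by
  induction n with
  | zero => exact ⟨h, by simp⟩
  | succ n ih =>
    have h' : above X T s (n + 1) = sel (tb s n) (Nat.land (above X T s n) (point X n)) (above X T s n) :=
      rfl
    rw [h', sel_eq, tb_eq] at h
    cases hs : s.testBit n with
    | false =>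
      rw [hs, cond_false] at h
      refine ⟨(ih h).1, fun u hu hsu => ?_⟩
      rcases Nat.lt_succ_iff_lt_or_eq.1 hu with hu | rfl
      · exact (ih h).2 u hu hsu
      · simp [hs] at hsu
    | true =>
      rw [hs, cond_true, land_eq, Nat.testBit_and, Bool.and_eq_true] at h
      refine ⟨(ih h.1).1, fun u hu hsu => ?_⟩
      rcases Nat.lt_succ_iff_lt_or_eq.1 hu with hu | rfl
      · exact (ih h.1).2 u hu hsu
      · exact h.2

theorem testBit_square {s : ℕ} (hs : s < 2 ^ 32) (n : ℕ) {u v : ℕ} (hv : v < 32)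
    (h : (square s n).testBit (32 * u + v) = true) : s.testBit u = true ∧ s.testBit v = true := by
  induction n with
  | zero => simp [square] at h
  | succ n ih =>
    have h' : square s (n + 1) = sel (tb s n) (Nat.lor (square s n) (Nat.shiftLeft s (Nat.mul 32 n)))
      (square s n) := rfl
    rw [h', sel_eq, tb_eq] at h
    cases hb : s.testBit n with
    | false =>
      rw [hb, cond_false] at h
      exact ih h
    | true =>
      rw [hb, cond_true, lor_eq, Nat.testBit_or, Bool.or_eq_true] at h
      rcases h with h | h
      · exact ih h
      · simp only [shiftLeft_eq, Nat.mul_eq, Nat.testBit_shiftLeft, Bool.and_eq_true,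
          decide_eq_true_eq] at h
        have : 32 * u + v - 32 * n < 32 := by
          by_contra! hcon
          rw [Nat.testBit_lt_two_pow (lt_of_lt_of_le hs
            (Nat.pow_le_pow_right (by norm_num) hcon))] at h
          simp at h
        obtain rfl : u = n := by omega
        rw [Nat.add_sub_cancel_left] at h
        exact ⟨hb, h.2⟩

theorem nthOp_spec (k : ℕ → ℕ → ℕ) (fs : List (ℕ → ℕ)) (i c : ℕ) (h : nthOp k fs i c ≠ 0) :
    (∃ i, k i c ≠ 0) ∨ ∃ f ∈ fs, f c ≠ 0 := by
  induction fs generalizing i with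
  | nil => exact Or.inl ⟨i, h⟩
  | cons f fs ih =>
    cases i with
    | zero => exact Or.inr ⟨f, by simp, h⟩
    | succ i =>
      rcases ih i h with h | ⟨g, hg, h⟩
      · exact Or.inl h
      · exact Or.inr ⟨g, by simp [hg], h⟩

theorem testBit_unhit (T m p : ℕ) (hp : 64 ≤ p) :
    (unhit T m).testBit p = (T.testBit p && !m.testBit p) := by
  have hc : (4294967295 : ℕ).testBit p = false :=
    Nat.testBit_lt_two_pow (lt_of_lt_of_le (by norm_num) (Nat.pow_le_pow_right (by norm_num) hp))
  simp only [unhit, xor_eq, land_eq, Nat.testBit_xor, Nat.testBit_and, hc, Bool.and_false,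
    Bool.xor_false]
  cases T.testBit p <;> cases m.testBit p <;> rfl

theorem closes_spec (r T : ℕ) (cl : List ℕ) (h : closes r T cl = true) :
    ∃ L : List ℕ, L.length = r + 1 ∧ (∀ m ∈ L, m ∈ cl) ∧
      ∀ p, 64 ≤ p → T.testBit p = true → ∃ m ∈ L, m.testBit p = true := by
  induction r generalizing T cl with
  | zero =>
    obtain ⟨m, hm, hk⟩ := (anyKilled_iff T cl).1 h
    exact ⟨[m], rfl, by simpa using hm, fun p _ hp => ⟨m, by simp, (killed_iff T m).1 hk p hp⟩⟩
  | succ r ih =>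
    induction cl with
    | nil => exact absurd h Bool.false_ne_true
    | cons m cl ihl =>
      have h' : closes (r + 1) T (m :: cl)
        = sel (force (unhit T m) fun T' => closes r T' cl) true (closes (r + 1) T cl) := rfl
      rw [h', sel_eq, force_eq] at h
      cases hc : closes r (unhit T m) cl with
      | true =>
        obtain ⟨L, h1, h2, h3⟩ := ih _ _ hc
        refine ⟨m :: L, by simp [h1], fun x hx => ?_, fun p hp hT => ?_⟩
        · exact (List.mem_cons.1 hx).elim (fun h => by simp [h]) fun h => by simp [h2 x h]
        · cases hm : m.testBit p with
          | true => exact ⟨m, by simp, hm⟩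
          | false =>
            obtain ⟨x, hx, h⟩ := h3 p hp (by rw [testBit_unhit _ _ _ hp, hT, hm]; rfl)
            exact ⟨x, by simp [hx], h⟩
      | false =>
        rw [hc, cond_false] at h
        obtain ⟨L, h1, h2, h3⟩ := ihl h
        exact ⟨L, h1, fun x hx => by simp [h2 x hx], h3⟩

section

variable {V : Type*} {H : SimpleGraph V} {f : ℕ → V} {X n : ℕ} {G D T : ℕ} {cl : List ℕ}
  {rec : ℕ → ℕ → ℕ → List ℕ → ℕ → ℕ}

theorem closes_sound {r : ℕ} (hr : 1 ≤ r) (hH : Unstabbed H 6 r)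
    (h : closes (Nat.sub r 1) T cl = true) : ¬ Sat H f X n G D T cl := by
  intro hS
  obtain ⟨L, h1, h2, h3⟩ := closes_spec _ _ _ h
  have hC : ∀ m : ℕ, ∃ C : Finset V, H.IsClique (C : Set V) ∧ (m ∈ cl →
      ∀ I p, H.IsNIndepSet 6 I → Codes f X n I p → m.testBit p = true → ¬ Disjoint C I) := by
    intro m
    by_cases hm : m ∈ cl
    · obtain ⟨C, hC, h⟩ := hS.cliques m hm
      exact ⟨C, hC, fun _ => h⟩
    · exact ⟨∅, by simp, fun h => absurd h hm⟩
  choose C hC hCI using hC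
  obtain ⟨I, hI, hdis⟩ := hH (L.map C) (by rw [List.length_map, h1]; exact Nat.sub_add_cancel hr) (by
    intro D hD
    obtain ⟨m, -, rfl⟩ := List.mem_map.1 hD
    exact hC m)
  obtain ⟨p, hp, hT⟩ := hS.sets I hI
  obtain ⟨m, hm, h⟩ := h3 p hp.1 hT
  exact hCI m (h2 m hm) I p hI hp h (hdis _ (List.mem_map_of_mem hm))

theorem splitPair_sound (hn : n ≤ 30) (hrec : Sound H f X n rec) {u v c : ℕ} (hu : Name n u)
    (hv : Name n v) (h : splitPair X rec G D T cl u v c ≠ 0) : ¬ Sat H f X n G D T cl := by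
  intro hS
  rw [splitPair, force_eq, force_eq, force_eq] at h
  obtain ⟨-, D', c', hc, hS'⟩ := loopEdge_spec hn hrec hS (by have := hu.2; omega)
    (by have := hv.2; omega) (fun _ => ⟨hu, hv⟩) h
  exact hrec _ _ _ _ _ hc hS'

theorem splitSet_sound (hn : n ≤ 30) (hrec : Sound H f X n rec) {s c : ℕ}
    (hs : ∀ u, s.testBit u = true → Name n u)
    (h : splitSet n X rec G D T cl s c ≠ 0) : ¬ Sat H f X n G D T cl := by
  intro hS
  rw [splitSet, force_eq, force_eq] at h
  generalize hx : force (Nat.lor D (square s (Nat.add n 2))) _ = x at h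
  rw [force_eq] at hx
  cases x with
  | zero => exact absurd rfl h
  | succ c' =>
    have hadj : ∃ u v, s.testBit u = true ∧ s.testBit v = true ∧ H.Adj (f u) (f v) := by
      by_contra! hcon
      refine hrec _ _ _ _ _ (by rw [hx]; exact Nat.succ_ne_zero _)
        ⟨hS.edges, fun u v hu hv huv => ?_, hS.sets, hS.cliques⟩
      rw [lor_eq, Nat.testBit_or, Bool.or_eq_true] at huv
      rcases huv with huv | huv
      · exact hS.nonedges u v hu hv huv
      · have hs32 : s < 2 ^ 32 := Nat.lt_pow_two_of_testBit _ fun i hi => by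
          by_contra hcon
          have := (hs i (by simpa using hcon)).2
          omega
        obtain ⟨h1, h2⟩ := testBit_square hs32 _ (by have := hv.2; omega) huv
        exact hcon u v h1 h2
    obtain ⟨u, v, hu, hv, huv⟩ := hadj
    have h' : force (Nat.xor T (above X T s (Nat.add n 2))) (fun T' => rec G D T' cl c') ≠ 0 := h
    rw [force_eq] at h'
    refine hrec _ _ _ _ _ h' ⟨hS.edges, hS.nonedges, fun I hI => ?_, hS.cliques⟩
    obtain ⟨p, hp, hT⟩ := hS.sets I hI
    refine ⟨p, hp, ?_⟩
    have hab : (above X T s (Nat.add n 2)).testBit p = false := by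
      rw [← Bool.not_eq_true]
      intro hab
      have h1 := (testBit_above _ _ _ _ _ hab).2
      have hu' := (hp.2 u (hs u hu)).1 (h1 u (hs u hu).2 hu)
      have hv' := (hp.2 v (hs v hv)).1 (h1 v (hs v hv).2 hv)
      exact hI.isIndepSet hu' hv' huv.ne huv
    simp [hT, hab]

theorem addTriangle_sound (hn : n ≤ 30) (hrec : Sound H f X n rec) {u v w c : ℕ}
    (hu : Name n u) (hv : Name n v) (hw : Name n w)
    (h : addTriangle X rec G D T cl u v w c ≠ 0) : ¬ Sat H f X n G D T cl := by
  classical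
  intro hS
  rw [addTriangle, sel_eq, sel_eq, sel_eq, tb_eq, tb_eq, tb_eq] at h
  cases huv : G.testBit (Nat.add (Nat.mul 32 u) v) with
  | false =>
    rw [huv] at h
    exact absurd rfl h
  | true =>
  cases huw : G.testBit (Nat.add (Nat.mul 32 u) w) with
  | false =>
    rw [huv, huw] at h
    exact absurd rfl h
  | true =>
  cases hvw : G.testBit (Nat.add (Nat.mul 32 v) w) with
  | false =>
    rw [huv, huw, hvw] at h
    exact absurd rfl h
  | true =>
  rw [huv, huw, hvw, cond_true, cond_true, cond_true, force_eq, force_eq] at h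
  have h1 := (hS.edges u v hu (by have := hv.2; omega) huv).2
  have h2 := (hS.edges u w hu (by have := hw.2; omega) huw).2
  have h3 := (hS.edges v w hv (by have := hw.2; omega) hvw).2
  refine hrec _ _ _ _ _ h ⟨hS.edges, hS.nonedges, hS.sets, fun m hm => ?_⟩
  rcases List.mem_cons.1 hm with rfl | hm
  · refine ⟨{f u, f v, f w}, by
      simp [SimpleGraph.isClique_iff, Set.pairwise_insert, h1, h1.symm, h2, h2.symm, h3, h3.symm],
      fun I p hI hp hb => ?_⟩
    rw [lor_eq, lor_eq, lor_eq, Nat.testBit_or, testBit_tag _ _ hp.1, Nat.testBit_or,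
      Nat.testBit_or, Bool.or_false, Bool.or_eq_true, Bool.or_eq_true, hp.2 u hu, hp.2 v hv,
      hp.2 w hw] at hb
    rw [Finset.not_disjoint_iff]
    rcases hb with (h | h) | h
    · exact ⟨f u, by simp, h⟩
    · exact ⟨f v, by simp, h⟩
    · exact ⟨f w, by simp, h⟩
  · exact hS.cliques m hm

theorem refer_sound {P : Params} (hP : P.Holds H) (hrec : Sound H f X P.n rec)
    (hf : Set.InjOn f {u | Name P.n u}) {t : List (List Clause)} {idx : ℕ}
    {ch : Choice} (hch : IsChoice ch)
    (ht : ∀ i < idx, ∀ l, entry t i = some l → l.Valid H) {id c : ℕ}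
    (h : refer P t idx X rec ch G D T cl id c ≠ 0) : ¬ Sat H f X P.n G D T cl := by
  rw [refer, force_eq, force_eq, sel_eq] at h
  cases hb : Nat.ble (Nat.succ id) idx with
  | false => simp [hb] at h
  | true =>
    rw [hb, cond_true] at h
    obtain ⟨l, hl, h⟩ := lookup_spec _ _ _ h
    exact useClause_sound hP hrec hf hch (ht id (Nat.le_of_ble_eq_true hb) l hl) h

theorem run_sound {P : Params} (hP : P.Holds H) (hf : Set.InjOn f {u | Name P.n u})
    (t : List (List Clause)) (sids : List ℕ) (idx : ℕ)
    (ht : ∀ i < idx, ∀ l, entry t i = some l → l.Valid H) (fuel : ℕ) :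
    Sound H f X P.n (run P t sids idx X fuel) := by
  have hname : ∀ c, Name P.n (Nat.add 2 (Nat.mod c P.n)) := fun c =>
    ⟨Nat.le_add_right _ _, by
      have : c % P.n < P.n := Nat.mod_lt _ hP.pos
      change 2 + c % P.n < P.n + 2
      omega⟩
  induction fuel with
  | zero => exact fun G D T cl c h => absurd rfl h
  | succ fuel ih =>
    intro G D T cl c h
    change split c (nthOp _ _) ≠ 0 at h
    rw [split, force_eq] at h
    rcases nthOp_spec _ _ _ _ h with ⟨i, h⟩ | ⟨g, hg, h⟩
    · exact refer_sound hP ih hf isChoice_leastFree ht h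
    simp only [List.mem_cons, List.not_mem_nil, or_false] at hg
    rcases hg with rfl | rfl | rfl | rfl | rfl | rfl
    · beta_reduce at h
      rw [sel_eq] at h
      cases hc : closes (Nat.sub P.r 1) T cl with
      | true => exact closes_sound hP.one_le hP.unstabbed hc
      | false =>
        rw [hc] at h
        exact absurd rfl h
    · exact splitPair_sound hP.le ih (hname _) (hname _) h
    · exact refer_sound hP ih hf isChoice_increasing ht h
    · exact refer_sound hP ih hf isChoice_anyChoice ht h
    · refine splitSet_sound hP.le ih (fun u hu => ?_) h
      simp only [shiftLeft_eq, Nat.testBit_shiftLeft, Bool.and_eq_true, decide_eq_true_eq] at hu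
      refine ⟨hu.1, ?_⟩
      by_contra! hcon
      have hlt : ∀ x, Nat.mod x (Nat.pow 2 P.n) < 2 ^ (u - 2) := fun x =>
        lt_of_lt_of_le (Nat.mod_lt _ (Nat.two_pow_pos _))
          (Nat.pow_le_pow_right (by norm_num) (by omega))
      rw [Nat.testBit_lt_two_pow (hlt _)] at hu
      simp at hu
    · exact addTriangle_sound hP.le ih (hname _) (hname _) (hname _) h

end

end IndepCert

namespace IndepCert

theorem img_identity {n i : ℕ} (hn : n ≤ 30) (hi : i < n) : img (identity n) (5 * i) = 2 + i := by
  have hs : ∀ n, identity (n + 1) = identity n ||| ((2 + n) <<< (5 * n)) := fun _ => rfl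
  have hlt : ∀ m, m ≤ 30 → identity m < 2 ^ (5 * m) ∧
      identity (m + 1) = identity m + (2 + m) <<< (5 * m) := by
    intro m
    induction m with
    | zero => exact fun _ => ⟨by simp [identity], by rw [hs]; rfl⟩
    | succ m ih =>
      intro hm
      obtain ⟨h1, h2⟩ := ih (by omega)
      have h3 : identity (m + 1) < 2 ^ (5 * (m + 1)) := by
        rw [h2, Nat.shiftLeft_eq, show 2 ^ (5 * (m + 1)) = 32 * 2 ^ (5 * m) by ring]
        have : (2 + m) * 2 ^ (5 * m) ≤ 31 * 2 ^ (5 * m) := Nat.mul_le_mul_right _ (by omega)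
        omega
      exact ⟨h3, by rw [hs, Nat.or_comm, ← Nat.shiftLeft_add_eq_or_of_lt h3, add_comm]⟩
  induction n with
  | zero => omega
  | succ n ih =>
    rw [(hlt n (by omega)).2]
    rcases Nat.lt_succ_iff_lt_or_eq.1 hi with hi | rfl
    · rw [img_add_of_lt _ _ hi, ih (by omega) hi]
    · rw [img_add_self (hlt i (by omega)).1 (by omega)]

theorem mem_rowsFrom (E F k i : ℕ) (r : Row) (hr : r ∈ rowsFrom E F k i) :
    ∃ a left, a < i + k ∧ r = ⟨5 * a, left, elems (triRow E a) a, elems (triRow F a) a⟩ := by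
  induction k generalizing i with
  | zero => simp [rowsFrom] at hr
  | succ k ih =>
    have h : rowsFrom E F (k + 1) i =
      ⟨5 * i, k.succ, elems (triRow E i) i, elems (triRow F i) i⟩ :: rowsFrom E F k (i + 1) := rfl
    rw [h] at hr
    rcases List.mem_cons.1 hr with rfl | hr
    · exact ⟨i, _, by omega, rfl⟩
    · obtain ⟨a, left, h1, h2⟩ := ih _ hr
      exact ⟨a, left, by omega, h2⟩

theorem pointFamily_lt (u n k : ℕ) : pointFamily u n k < 2 ^ binom n k := by
  induction n generalizing k with
  | zero => exact Nat.two_pow_pos _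
  | succ n ih =>
    cases k with
    | zero => exact Nat.two_pow_pos _
    | succ k =>
      have h1 : binom (n + 1) (k + 1) = binom n (k + 1) + binom n k := rfl
      have h2 : pointFamily u (n + 1) (k + 1) = sel (Nat.beq u n)
        (((2 ^ binom n k) - 1) <<< binom n (k + 1))
        (pointFamily u n (k + 1) ||| (pointFamily u n k <<< binom n (k + 1))) := rfl
      have h3 : ∀ x < 2 ^ binom n k, x <<< binom n (k + 1) < 2 ^ (binom n (k + 1) + binom n k) := by
        intro x hx
        rw [Nat.shiftLeft_eq, pow_add, mul_comm]
        exact Nat.mul_lt_mul_of_pos_left hx (Nat.two_pow_pos _)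
      rw [h1, h2, sel_eq]
      cases Nat.beq u n with
      | true => exact h3 _ (Nat.sub_lt (Nat.two_pow_pos _) one_pos)
      | false =>
        exact Nat.or_lt_two_pow ((ih _).trans_le (Nat.pow_le_pow_right (by norm_num) (by omega)))
          (h3 _ (ih _))

theorem exists_rank (n k : ℕ) (J : Finset ℕ) (hJ : J ⊆ Finset.range n) (hk : J.card = k) :
    ∃ p < binom n k, ∀ u < n, ((pointFamily u n k).testBit p = true ↔ u ∈ J) := by
  induction n generalizing k J with
  | zero =>
    obtain rfl : J = ∅ := by simpa using hJ
    subst hk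
    exact ⟨0, by decide, by simp⟩
  | succ n ih =>
    cases k with
    | zero =>
      obtain rfl : J = ∅ := by simpa using hk
      exact ⟨0, Nat.one_pos, fun u _ => by simp [pointFamily]⟩
    | succ k =>
      have h1 : binom (n + 1) (k + 1) = binom n (k + 1) + binom n k := rfl
      have h2 : ∀ u, pointFamily u (n + 1) (k + 1) = sel (Nat.beq u n)
        (((2 ^ binom n k) - 1) <<< binom n (k + 1))
        (pointFamily u n (k + 1) ||| (pointFamily u n k <<< binom n (k + 1))) := fun _ => rfl
      by_cases hn : n ∈ J
      · obtain ⟨p, hp, hpu⟩ := ih k (J.erase n) (fun x hx => by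
          have := hJ (Finset.mem_of_mem_erase hx)
          have := Finset.ne_of_mem_erase hx
          simp at *
          omega) (by rw [Finset.card_erase_of_mem hn, hk]; rfl)
        refine ⟨p + binom n (k + 1), by omega, fun u hu => ?_⟩
        rw [h2, sel_eq]
        cases hb : Nat.beq u n with
        | true =>
          obtain rfl := Nat.eq_of_beq_eq_true hb
          simp [hn, hp]
        | false =>
          have hne : u ≠ n := Nat.ne_of_beq_eq_false hb
          rw [cond_false, Nat.testBit_or, Nat.testBit_lt_two_pow (i := p + binom n (k + 1))
            ((pointFamily_lt u n (k + 1)).trans_le (Nat.pow_le_pow_right (by norm_num) (by omega)))]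
          simp [hpu u (by omega), hne]
      · obtain ⟨p, hp, hpu⟩ := ih (k + 1) J (fun x hx => by
          have := hJ hx
          have : x ≠ n := fun h => hn (h ▸ hx)
          simp at *
          omega) hk
        refine ⟨p, by omega, fun u hu => ?_⟩
        rw [h2, sel_eq]
        cases hb : Nat.beq u n with
        | true =>
          obtain rfl := Nat.eq_of_beq_eq_true hb
          simp [hn, hp]
        | false =>
          have hne : u ≠ n := Nat.ne_of_beq_eq_false hb
          simp [hpu u (by omega), hp]

theorem testBit_point (X u p : ℕ) :
    (point X u).testBit p = (decide (p < 16384) && X.testBit (16384 * u + p)) := by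
  rw [point, land_eq, shiftRight_eq, Nat.testBit_and, Nat.testBit_shiftRight, Nat.sub_eq,
    Nat.pow_eq, Nat.testBit_two_pow_sub_one, Bool.and_comm]
  rfl

/-- The bits from number 64 on of the `u`-th component of `X` are those of the family of
`6`-subsets of `{2, …, n + 1}` containing `u`. -/
def IsPoints (X n : ℕ) : Prop :=
  ∀ i < n, ∀ p < binom n 6, (point X (i + 2)).testBit (p + 64) = (pointFamily i n 6).testBit p

set_option exponentiation.threshold 20000 in
theorem points_spec {n : ℕ} (hn : n ≤ 30) (hb : 64 + binom n 6 ≤ 16384) (F : ℕ → Bool)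
    (h : points n 6 n 0 F = true) : ∃ X, IsPoints X n ∧ F X = true := by
  have key : ∀ m ≤ n, ∀ X, (∀ i, m ≤ i → i < n → ∀ p < binom n 6,
      (point X (i + 2)).testBit (p + 64) = (pointFamily i n 6).testBit p) →
      (∀ q < 16384 * (m + 2), X.testBit q = false) →
      points n 6 m X F = true → ∃ X, IsPoints X n ∧ F X = true := by
    intro m
    induction m with
    | zero => exact fun _ X hX _ h => ⟨X, fun i hi => hX i (Nat.zero_le _) hi, h⟩
    | succ m ih =>
      intro hm X hX hX0 h
      set Y := (pointFamily m n 6 <<< 64 + ((m + 1) * 123456789) <<< 32) with hY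
      have h' : points n 6 (m + 1) X F = force (X ||| Y <<< (16384 * (m + 2)))
        (fun X => points n 6 m X F) := rfl
      rw [h', force_eq] at h
      have hjunk : ((m + 1) * 123456789) <<< 32 < 2 ^ 64 := by
        rw [Nat.shiftLeft_eq]
        omega
      have hYbit : ∀ p, Y.testBit (p + 64) = (pointFamily m n 6).testBit p := by
        intro p
        rw [hY, Nat.shiftLeft_add_eq_or_of_lt hjunk, Nat.testBit_or,
          Nat.testBit_lt_two_pow (x := ((m + 1) * 123456789) <<< 32)
            (hjunk.trans_le (Nat.pow_le_pow_right (by norm_num) (by omega)))]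
        simp
      have hYlt : Y < 2 ^ 16384 := by
        have h1 : pointFamily m n 6 + 1 ≤ 2 ^ binom n 6 := pointFamily_lt m n 6
        calc Y < pointFamily m n 6 * 2 ^ 64 + 2 ^ 64 := by
              rw [hY, Nat.shiftLeft_eq]
              exact Nat.add_lt_add_left hjunk _
          _ = 2 ^ 64 * (pointFamily m n 6 + 1) := by ring
          _ ≤ 2 ^ 64 * 2 ^ binom n 6 := Nat.mul_le_mul_left _ h1
          _ = 2 ^ (64 + binom n 6) := by rw [pow_add]
          _ ≤ 2 ^ 16384 := Nat.pow_le_pow_right (by norm_num) hb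
      refine ih (by omega) _ (fun i hi hin p hp => ?_) (fun q hq => ?_) h
      · rw [testBit_point, Nat.testBit_or, Nat.testBit_shiftLeft]
        rcases eq_or_lt_of_le hi with rfl | hi
        · rw [hX0 _ (by omega)]
          simp only [Nat.add_sub_cancel_left, hYbit]
          simp
          omega
        · rw [← hX i hi hin p hp, testBit_point,
            Nat.testBit_lt_two_pow (x := Y) (hYlt.trans_le
              (Nat.pow_le_pow_right (by norm_num) (by omega)))]
          simp
      · rw [Nat.testBit_or, hX0 q (by omega), Nat.testBit_shiftLeft]
        simp
        omega
  exact key n le_rfl 0 (fun i h1 h2 => absurd h1 (by omega)) (by simp) h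

section

variable {V : Type*} {H : SimpleGraph V} {f : ℕ → V} {X n : ℕ} {G D T : ℕ} {cl : List ℕ}

theorem initEdges_spec (hn : n ≤ 30) (hS : Sat H f X n G D T cl) {perm u : ℕ} (hu : Name n u)
    (k : ℕ → ℕ → List ℕ → ℕ) (es : List ℕ)
    (hes : ∀ p ∈ es, Name n (img perm p) ∧ H.Adj (f u) (f (img perm p)))
    (h : initEdges X perm u k es G T cl ≠ 0) :
    ∃ G T cl, Sat H f X n G D T cl ∧ k G T cl ≠ 0 := by
  induction es generalizing G T cl with
  | nil => exact ⟨G, T, cl, hS, h⟩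
  | cons p es ih =>
    have h' : initEdges X perm u k (p :: es) G T cl = force (img perm p) fun v =>
      addEdge X G T cl u v 0 (initEdges X perm u k es) := rfl
    rw [h', force_eq] at h
    obtain ⟨h1, h2⟩ := hes p (by simp)
    obtain ⟨G', T', cl', h3, h4⟩ := addEdge_spec hn hS hu h1 h2 0 (initEdges X perm u k es)
    rw [h3] at h
    exact ih h4 (fun q hq => hes q (by simp [hq])) h

theorem initNonedges_spec (hn : n ≤ 30) (hS : Sat H f X n G D T cl) {perm u : ℕ} (hu : Name n u)
    (k : ℕ → ℕ) (ds : List ℕ) (hds : ∀ p ∈ ds, ¬ H.Adj (f u) (f (img perm p)))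
    (h : initNonedges perm u k ds D ≠ 0) : ∃ D, Sat H f X n G D T cl ∧ k D ≠ 0 := by
  induction ds generalizing D with
  | nil => exact ⟨D, hS, h⟩
  | cons p ds ih =>
    have h' : initNonedges perm u k (p :: ds) D
      = force (setPair D u (img perm p) 0) (initNonedges perm u k ds) := rfl
    rw [h', force_eq] at h
    exact ih (hS.setPair hn (by have := hu.2; omega) (img_lt _ _) (hds p (by simp)) 0)
      (fun q hq => hds q (by simp [hq])) h

theorem init_spec (hn : n ≤ 30) (hS : Sat H f X n G D T cl) {perm : ℕ}
    (fin : ℕ → ℕ → ℕ → List ℕ → ℕ) (rs : List Row)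
    (hrs : ∀ r ∈ rs, Name n (img perm r.pos) ∧
      (∀ p ∈ r.es, Name n (img perm p) ∧ H.Adj (f (img perm r.pos)) (f (img perm p))) ∧
      ∀ p ∈ r.ds, ¬ H.Adj (f (img perm r.pos)) (f (img perm p)))
    (h : init X perm fin rs G D T cl ≠ 0) :
    ∃ G D T cl, Sat H f X n G D T cl ∧ fin G D T cl ≠ 0 := by
  induction rs generalizing G D T cl with
  | nil => exact ⟨G, D, T, cl, hS, h⟩
  | cons r rs ih =>
    have h' : init X perm fin (r :: rs) G D T cl = force (img perm r.pos) fun u =>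
        initNonedges perm u (fun D' => initEdges X perm u
          (fun G' T' cl' => init X perm fin rs G' D' T' cl') r.es G T cl) r.ds D := rfl
    rw [h', force_eq] at h
    obtain ⟨h1, h2, h3⟩ := hrs r (by simp)
    obtain ⟨D', hS', h⟩ := initNonedges_spec hn hS h1 _ _ h3 h
    obtain ⟨G', T', cl', hS'', h⟩ := initEdges_spec hn hS' h1 _ _ h2 h
    exact ih hS'' (fun q hq => hrs q (by simp [hq])) h

theorem sat_start [Fintype V] [DecidableEq V] (hX : IsPoints X n)
    (e : Fin n ≃ V) (hf : ∀ i : Fin n, f (i + 2) = e i) :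
    Sat H f X n 0 0 ((2 ^ binom n 6 - 1) <<< 64) [] := by
  refine ⟨by simp, by simp, fun I hI => ?_, by simp⟩
  obtain ⟨p, hp, hpu⟩ := exists_rank n 6 ((I.map e.symm.toEmbedding).map Fin.valEmbedding)
    (fun x hx => by
      obtain ⟨y, -, rfl⟩ := Finset.mem_map.1 hx
      exact Finset.mem_range.2 y.2) (by simp [hI.card_eq])
  refine ⟨p + 64, ⟨by omega, fun u hu => ?_⟩, by simp [hp]⟩
  obtain ⟨i, rfl⟩ := Nat.exists_eq_add_of_le' hu.1
  have hi : i < n := by have := hu.2; omega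
  rw [hX i hi p hp, hpu i hi, show f (i + 2) = e ⟨i, hi⟩ from hf ⟨i, hi⟩]
  simp only [Finset.mem_map, Equiv.coe_toEmbedding, Fin.valEmbedding_apply]
  constructor
  · rintro ⟨_, ⟨v, hv, rfl⟩, rfl⟩
    simpa using hv
  · exact fun h => ⟨⟨i, hi⟩, ⟨_, h, by simp⟩, rfl⟩

/-- Soundness of the checker. -/
theorem valid_of_check [Fintype V] [DecidableEq V] {P : Params} (hP : P.Holds H)
    (hcard : Fintype.card V = P.n) (hb : 64 + binom P.n 6 ≤ 16384) (t : List (List Clause))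
    (sids codes : List ℕ) (idx : ℕ) (h : check P t sids codes idx = true)
    (hv : ∀ i < idx, ∀ l, entry t i = some l → l.Valid H) :
    ∀ i < idx + codes.length, ∀ l, entry t i = some l → l.Valid H := by
  obtain ⟨X, hX, hc⟩ := points_spec hP.le hb _ h
  rw [force_eq] at hc
  clear h
  induction codes generalizing idx with
  | nil => simpa using hv
  | cons c codes ih =>
    have h' : checkFrom P t sids X (Nat.shiftLeft (Nat.sub (Nat.pow 2 (binom P.n 6)) 1) 64)
        (c :: codes) idx = @Nat.rec (fun _ => Bool) false
      (fun _ _ => force (Nat.succ idx) (checkFrom P t sids X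
        (Nat.shiftLeft (Nat.sub (Nat.pow 2 (binom P.n 6)) 1) 64) codes))
        (lookup t idx fun l =>
          sel (Nat.ble l.k P.n)
            (init X (identity P.n) (fun G D T cl => run P t sids idx X 300 G D T cl c)
              (rows l) 0 0 (Nat.shiftLeft (Nat.sub (Nat.pow 2 (binom P.n 6)) 1) 64) []) 0) := rfl
    rw [h'] at hc
    generalize hx : lookup t idx _ = x at hc
    cases x with
    | zero => exact absurd hc (by simp)
    | succ x =>
    have h1 : force (Nat.succ idx) (checkFrom P t sids X
        (Nat.shiftLeft (Nat.sub (Nat.pow 2 (binom P.n 6)) 1) 64) codes) = true := hc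
    rw [force_eq] at h1
    obtain ⟨l, hl, hlk⟩ := lookup_spec _ _ _ (by rw [hx]; exact Nat.succ_ne_zero _)
    have hval : l.Valid H := by
      intro g hg hE
      by_contra! hD
      cases hle : Nat.ble l.k P.n with
      | false => simp [hle, sel_eq] at hlk
      | true =>
      have hkn : l.k ≤ P.n := Nat.le_of_ble_eq_true hle
      have hn := hP.le
      rw [hle, sel_eq, cond_true] at hlk
      obtain ⟨e, he⟩ : ∃ e : Fin P.n ≃ V, ∀ i : Fin P.n, i.1 < l.k → e i = g i := by
        obtain ⟨e, he⟩ := Finset.exists_equiv_extend_of_card_eq (α := Fin P.n)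
          (t := (Finset.univ : Finset V)) (s := Finset.univ.filter fun i : Fin P.n => i.1 < l.k)
          (f := fun i => g i.1) (by simp [hcard]) (by simp) (by
            intro a ha b hb hab
            simp at ha hb
            exact Fin.ext (hg ha hb hab))
        exact ⟨e.trans (Equiv.subtypeUnivEquiv (by simp)), fun i hi => he i (by simpa using hi)⟩
      let f : ℕ → V := fun u => if hu : u - 2 < P.n then e ⟨u - 2, hu⟩ else e ⟨0, hP.pos⟩
      have hf : ∀ i : Fin P.n, f (i + 2) = e i := fun i => by simp [f]
      have hfg : ∀ i, i < l.k → f (2 + i) = g i := fun i hi => by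
        rw [add_comm, hf ⟨i, by omega⟩, he _ hi]
      have hinj : Set.InjOn f {u | Name P.n u} := by
        rintro a ⟨ha1, ha2⟩ b ⟨hb1, hb2⟩ hab
        obtain ⟨a, rfl⟩ := Nat.exists_eq_add_of_le' ha1
        obtain ⟨b, rfl⟩ := Nat.exists_eq_add_of_le' hb1
        rw [hf ⟨a, by omega⟩, hf ⟨b, by omega⟩, e.apply_eq_iff_eq, Fin.mk.injEq] at hab
        rw [hab]
      have hrows : ∀ r ∈ rows l, Name P.n (img (identity P.n) r.pos) ∧
          (∀ p ∈ r.es, Name P.n (img (identity P.n) p) ∧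
            H.Adj (f (img (identity P.n) r.pos)) (f (img (identity P.n) p))) ∧
          ∀ p ∈ r.ds, ¬ H.Adj (f (img (identity P.n) r.pos)) (f (img (identity P.n) p)) := by
        intro r hr
        obtain ⟨a, left, ha, rfl⟩ := mem_rowsFrom l.E l.D l.k 0 r hr
        have hid : ∀ b < l.k, Name P.n (img (identity P.n) (5 * b)) ∧
            f (img (identity P.n) (5 * b)) = g b := fun b hb => by
          rw [img_identity hn (by omega), hfg b hb]
          exact ⟨⟨by omega, by omega⟩, rfl⟩
        rw [zero_add] at ha
        refine ⟨(hid a ha).1, fun p hp => ?_, fun p hp => ?_⟩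
        · obtain ⟨b, hb, hbit, rfl⟩ := (mem_elems _ _ _).1 hp
          refine ⟨(hid b (hb.trans ha)).1, ?_⟩
          rw [(hid a ha).2, (hid b (hb.trans ha)).2]
          exact hE a ha b hb hbit
        · obtain ⟨b, hb, hbit, rfl⟩ := (mem_elems _ _ _).1 hp
          rw [(hid a ha).2, (hid b (hb.trans ha)).2]
          exact hD a ha b hb hbit
      obtain ⟨G, D, T, cl, hS, hrun⟩ := init_spec hn (sat_start hX e hf) _ _ hrows hlk
      exact run_sound hP hinj t sids idx hv 300 G D T cl c hrun hS
    have := ih (idx + 1) (fun i hi l' hl' => by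
      by_cases hii : i < idx
      · exact hv i hii l' hl'
      · obtain rfl : i = idx := by omega
        rw [hl] at hl'
        obtain rfl := Option.some.inj hl'
        exact hval) h1
    rwa [List.length_cons, Nat.add_comm codes.length, ← Nat.add_assoc]

end

end IndepCert

namespace IndepCert

def clauses0 : List Clause := [
  ⟨7, 0, 2097151⟩,
  ⟨16, 664613998511890748030198684471790181, 25400315161364955144⟩,
  ⟨16, 664613998511956861158690608967098901, 4761171366428836906306⟩,
  ⟨16, 664613999131607012291423698680302117, 292472307580936⟩,
  ⟨16, 664614001606731410718849439644271141, 31119657252392383026178⟩,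
  ⟨16, 664613999131758054195853942997426709, 96800629226843686978978114⟩,
  ⟨16, 664613998550340255931471537127868181, 9673818662537610152640514⟩,
  ⟨16, 664613998511890766474708600952472101, 14637427491138⟩,
  ⟨16, 664613999131682497467333170940100749, 19258400812979901863458⟩,
  ⟨16, 664613999131682514761155645555622029, 38147866751374168593954⟩,
  ⟨16, 664613998550264771854862657212424725, 23815036307014418754⟩,
  ⟨16, 664613999130738024179476376508776997, 92162281210218105283656⟩,
  ⟨16, 664613997970292017734364834801651885, 21256017463726450935106⟩,
  ⟨16, 664613999131611660870930273419731619, 23061253659472954368⟩,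
  ⟨16, 664613998511919082227952428571967781, 22229774976247243784⟩,
  ⟨16, 664614001026220334502214597685691925, 37362319905597161506⟩,
  ⟨16, 664613999207807046341830818046427245, 221370041637154199554⟩,
  ⟨16, 664614001142201729108610046802527765, 23526815242372780330⟩,
  ⟨16, 664614001026144850416765536975241509, 15312238779052336136⟩,
  ⟨16, 664614000988743634094163222517268565, 38227855458921616386⟩,
  ⟨16, 664614008569842481329620206143148565, 18915129223928611946⟩,
  ⟨16, 332490175696053139283057750507004579, 47513076736⟩,
  ⟨16, 174937040114394173498732055634595, 99833795569190932087816⟩,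
  ⟨16, 664614001026147137813030676959641893, 15312238782839792648⟩,
  ⟨16, 664619069268722784816278814410150421, 23526817441396032618⟩,
  ⟨16, 664614001611116156257707708879216813, 19037045148529975165250⟩,
  ⟨16, 664619069152665684763610973989814565, 81704042608147336922394534920⟩,
  ⟨16, 685388257167391583253880236464415395, 2475917931289635192328683520⟩,
  ⟨16, 10394756005537798247885482539139365, 50396504838589221184520⟩,
  ⟨16, 685383188440960163504760786290491941, 3062449189731991874⟩,
  ⟨16, 664613998550264771846004987176993061, 15312238779052336136⟩,
  ⟨16, 664613998821064376800320613233205421, 39956674765845594434⟩]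

def clauses1 : List Clause := [
  ⟨16, 664613998530922180101851951846678669, 25833224519515537442⟩,
  ⟨16, 664613999439883336047909768622785813, 5330054840490⟩,
  ⟨16, 664613999140220535005230433730335333, 21840947809641459493912⟩,
  ⟨16, 664613999130851359831142429750477077, 2954380047790257250⟩,
  ⟨16, 664613998066694485515152757700710573, 2361183256072254292290⟩,
  ⟨16, 664613999132966989238839579107147877, 88175514768447935686152⟩,
  ⟨16, 664613999285140813265907201421609483, 1896030167642029225467972⟩,
  ⟨16, 664613998514034702411187312278913317, 22301832707724125192⟩,
  ⟨16, 664613997892835919461372264121909795, 14988588231960592⟩,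
  ⟨16, 664613999149750252075925253760500261, 57355698498⟩,
  ⟨16, 664613999207769836998224899520626981, 21524497067592⟩,
  ⟨16, 664613999131758054195870435338429029, 9042383895265280⟩,
  ⟨16, 664613999169234754603926106596753581, 239807708176958099458⟩,
  ⟨16, 664613998512863555523400515965698581, 39381902863402500098⟩,
  ⟨16, 664613999149891923043407372300341773, 309830997133903997723771202⟩,
  ⟨16, 664613998511881598435005093089133093, 12862280565567560714⟩,
  ⟨16, 664613998511740849767873229819625749, 25281520145625298538⟩,
  ⟨16, 664613999130700817105713003912757541, 8315058646600⟩,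
  ⟨16, 664613999130851359831142438213273109, 1549526502191635956002⟩,
  ⟨16, 664613998047656186640238498738610453, 21293026666071638122⟩,
  ⟨16, 664613999140069991635734055921680677, 12850665909832⟩,
  ⟨16, 664613997892836067035324853798322707, 14847849661470724⟩,
  ⟨16, 664613998511805865317086106733265445, 14249710736900418⟩,
  ⟨16, 664619069771635667521512472891662949, 111154178⟩,
  ⟨16, 664613999285291596686156576965937677, 40435263020910161953090⟩,
  ⟨16, 664613999207769322759205047947498085, 24835918242824⟩,
  ⟨16, 664613999439885383671397183258886437, 6509108960194120⟩,
  ⟨16, 664613997892836067035324853798322707, 14284895379521924⟩,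
  ⟨16, 664613999207778692552272987725800037, 28975269155842⟩,
  ⟨16, 664613999439883105462484044644352293, 10977539929435720⟩,
  ⟨16, 664613997892920730682242089608036883, 57626263940⟩,
  ⟨16, 664613999130549202163232101133992485, 0⟩]

def clauses2 : List Clause := [
  ⟨16, 664613999130398307823730823485473317, 0⟩,
  ⟨16, 332317140151333045133782576716071205, 45526564381130720322568⟩,
  ⟨16, 664613999130400373904103006392303715, 9218307097886720⟩,
  ⟨16, 332317140151333192135742861356303661, 14981035524096⟩,
  ⟨16, 332317140151333044561790271679890733, 53200409923078331138112⟩,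
  ⟨16, 332307078174769908221611463579549989, 13264540760056904⟩,
  ⟨16, 166153509995604891834999576661606501, 15312238778511270920⟩,
  ⟨16, 332317140151333035326059672722522661, 31064317020171254371330⟩,
  ⟨16, 332317140151333045138251007205589541, 49953782967342303548418⟩,
  ⟨16, 101412048094157480628675249447525, 407710232677031582869127170⟩,
  ⟨16, 669319516996699400404377638277221, 408919158496294365639245832⟩,
  ⟨16, 166173784359826071162895137730740773, 13545983524732928⟩,
  ⟨16, 166173784363585051827089827685220901, 14536790934820703863106⟩,
  ⟨16, 81764102216448230285144719639075, 34911935735775133720⟩,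
  ⟨16, 81210104517181011022372498588195, 62054847086587235565592⟩,
  ⟨16, 332317140151333062463616339856083469, 99540948304083451805730⟩,
  ⟨16, 664613997895031663096587660331896973, 504403845493948704⟩,
  ⟨16, 101412048095033736992228782383651, 372651383903703714532786240⟩,
  ⟨16, 664613999130398087572939255707083301, 9671406575001800665991490⟩,
  ⟨16, 664613999130398091047467356335383077, 309485009821415471832896962⟩,
  ⟨16, 332317140151333044125504032143852069, 45231416475676489192458⟩,
  ⟨16, 41543451118932152717848814256407075, 29148704792706559000⟩,
  ⟨16, 2606607789495058023690454936076837, 52757688067096058299400⟩,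
  ⟨16, 83665636107524770976539624882723, 66051235323752492056⟩,
  ⟨16, 81447789004730712592166020989475, 59693663842944799484952⟩,
  ⟨16, 166158571332817138904822918728925731, 13006395752033135640⟩,
  ⟨16, 20789469843823297754995770266748517, 370233532264052243701334026⟩,
  ⟨16, 664634281540001738380923865726997029, 636301180192685496484937891848⟩,
  ⟨16, 166174100033308255202610190388085029, 167184243492591019342439432⟩,
  ⟨16, 166153520523006450036150839044210725, 6649846456942536⟩,
  ⟨16, 86200550456376737971240796439075, 12701586511211544⟩,
  ⟨16, 60847228886698495364963974004835, 340312618225388393611081748⟩]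

def clauses3 : List Clause := [
  ⟨16, 324521030824206502030887649542163, 6685030829031364⟩,
  ⟨16, 162264231083997565043216911695907, 6649846456942552⟩,
  ⟨16, 162265466529428295583872911950355, 53200409923215774351680⟩,
  ⟨16, 41539643138306943078874411938365989, 7508908682412354⟩,
  ⟨16, 332317141388970851848457202203377957, 186522334239937680918291464⟩,
  ⟨16, 335295131185453829848534690578725, 100128938548516316741706⟩,
  ⟨16, 81132743125006129674190621508131, 22590063633632058560⟩,
  ⟨16, 166173783120658198145506104937878179, 53545216448815739510465544⟩,
  ⟨16, 41539643138302511248610686114218517, 58117172875732942954⟩,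
  ⟨16, 332317141388970852104036496222241061, 205870017294211742609449992⟩,
  ⟨16, 664613997892911283643362972493955619, 15348267575800768528⟩,
  ⟨16, 664613999130397985014751848475673125, 48773191341127300546882⟩,
  ⟨16, 664613999130402735051298602956120149, 188177464072300731611712847906⟩,
  ⟨16, 332309534247901661369089211791573525, 10871985202558274⟩,
  ⟨16, 1303146209717754334651383355016485, 21653313124431667784⟩,
  ⟨16, 101412048098584699206399832375843, 411337010140238331458912448⟩,
  ⟨16, 86201633502786180133362907234851, 25688546087289585736⟩,
  ⟨16, 1303146074318652824880005274149157, 12429934995972081224⟩,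
  ⟨16, 2596188672141286669521111694705189, 6521212260678925634⟩,
  ⟨16, 664613998202112951754879943251624229, 11012723764653640⟩,
  ⟨16, 664613997894913677870093409019052299, 72069551493224980⟩,
  ⟨16, 664613997931162562916057719092953189, 14812687030563850⟩,
  ⟨16, 664613999130397994238211846696911397, 49953782963494012853258⟩,
  ⟨16, 332317140151333046286809649875271789, 52314966207815120814082⟩,
  ⟨16, 1298114525207425669849546810852909, 30336264684838064450⟩,
  ⟨16, 166173781882727601287002269846356269, 214282470461589270240133186⟩,
  ⟨16, 101412048093909035051597299991075, 476619004403090414786061384⟩,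
  ⟨16, 166173781882722878920519400201142573, 214291546259673535339528258⟩,
  ⟨16, 1298114138653655390251540541358195, 9592315573684752324996⟩,
  ⟨16, 664613998202094136075917037057114405, 6509108960194120⟩,
  ⟨16, 664614001625620959822232027932936717, 16836518904162⟩,
  ⟨16, 332307038560765933768916206801125909, 33556460866⟩]

def clauses4 : List Clause := [
  ⟨16, 81764102216448230285144719639075, 35200166663830405312⟩,
  ⟨16, 83665636107524770976539624882723, 67205282736856465416⟩,
  ⟨16, 664634280302817259011374198736044581, 9903520315580078891875696642⟩,
  ⟨16, 664613997892911283643433341238133267, 15204152386642778116⟩,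
  ⟨16, 2601220424350944737418380164735589, 24391506920764085250⟩,
  ⟨16, 664613999130397995363971015613915749, 59398515937489495004162⟩,
  ⟨16, 664613998202112953772492576362874149, 12138632262287944⟩,
  ⟨16, 332309534247887494269631858226504229, 7494271500977474⟩,
  ⟨16, 332309534247883953611661576061878805, 6368371476034882⟩,
  ⟨16, 86201481211189476040499247727139, 25688547324240166984⟩,
  ⟨16, 1303146055281612940811748037894437, 12429935004562080328⟩,
  ⟨16, 664613998202094136940608157190979877, 6509108960194120⟩,
  ⟨16, 664614001683654047747744351349920277, 24008062828866⟩,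
  ⟨16, 664614001625772020042862704581429773, 247103842⟩,
  ⟨16, 664614001915781992794669719825170965, 12279370824455490⟩,
  ⟨16, 664614001915767832612750344682750485, 12279379414390082⟩,
  ⟨16, 332307038560773018435537616703095317, 50862257474⟩,
  ⟨16, 664614001683649399600583340802974245, 25663772460354⟩,
  ⟨16, 664614001915763179421549831392338469, 7494275795944770⟩,
  ⟨16, 81447866376048893426176314851875, 33666455610392⟩,
  ⟨16, 83665636107524770976539624882723, 67493795139888447680⟩,
  ⟨16, 664614078435931835870621136820126245, 25111869758474⟩,
  ⟨16, 664613997892911283643433341238133267, 14627691630010827140⟩,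
  ⟨16, 664613999130398012648839162021036581, 0⟩,
  ⟨16, 41548516692050466506190373694488677, 163591815312352594633736⟩,
  ⟨16, 664613999130402735051315648607293587, 1208925821339488051266848⟩,
  ⟨16, 664613999130398012631916028670034213, 10794837162122064715255440736264⟩,
  ⟨16, 166158570076724396648449453536059989, 12862280567178892290⟩,
  ⟨16, 166158570076724396648449453536059989, 13438741315724219394⟩,
  ⟨16, 664613999130416888279694975953805987, 193730362593270919954694144⟩,
  ⟨16, 166158570085186877383785862184059173, 13006395756328559688⟩,
  ⟨16, 20769197956705202303580341644836965, 42988301002593018888⟩]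

def clauses5 : List Clause := [
  ⟨16, 332317140151333062409643796540178957, 171564699862278720192834⟩,
  ⟨16, 332317140151333062411818373101404709, 163296523291985157559298⟩,
  ⟨16, 41548516692050466506191204769645093, 163296523291985157559298⟩,
  ⟨16, 91271462186452168763497866338917, 175108204106705044406274⟩,
  ⟨16, 1308215420644477063027992708515349, 44050824853859565551938⟩,
  ⟨16, 91271462186461401037120736346221, 194006895666740194410754⟩,
  ⟨16, 334659759669215365191889456219661, 81829757414667308728642⟩,
  ⟨16, 10385862605610033490605412860300051, 2417851639513484521111552⟩,
  ⟨16, 91270844430100320720457411609101, 12034576030754⟩,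
  ⟨16, 81139544428450371540673755119701, 9444955295786618355498⟩,
  ⟨16, 91270844425376837872636903047693, 45821712286172633865250⟩,
  ⟨16, 10394734941214317282586708374996645, 70983071226609793040384⟩,
  ⟨16, 659178931088698940774758390698085, 175403496127069789388808⟩,
  ⟨16, 332317140151333044017417641086960165, 45231416475676489260034⟩,
  ⟨16, 91270920587705742880730044711459, 62054847095383330684952⟩,
  ⟨16, 81209485622698452471458917532195, 48758538044671557656⟩,
  ⟨16, 332317140151333062410699121538122277, 171564699862278720192834⟩,
  ⟨16, 664613999130398086418047400496087589, 5704427701036255678772019200000⟩,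
  ⟨16, 664613999130398086417836294263554597, 9223372036854775808⟩,
  ⟨16, 20789469843898837172109618852136549, 99434167110047342992326664⟩,
  ⟨16, 91271462186452177656313818399267, 191939849270443160644616⟩,
  ⟨16, 166158570385000480643424733996565029, 47460236903955043338⟩,
  ⟨16, 166158570080351174114189417796084261, 30734821502709563722⟩,
  ⟨16, 166158570080351174114083907501564453, 27273803535280031050⟩,
  ⟨16, 91271462186452168906365658481187, 175403496127069788864584⟩,
  ⟨16, 332317140151333044561790255640904205, 41689641610225718943042⟩,
  ⟨16, 332309534247769444335434619841167909, 19258428592463326216514⟩,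
  ⟨16, 91271462186489057607342527365667, 173041160280780581121048⟩,
  ⟨16, 81447170110241245479910354469411, 47604490631567649816⟩,
  ⟨16, 664613999130549091554843121051289109, 20651360767845494391903504040258⟩,
  ⟨16, 50706178751671142350172062829067, 48846982891459231875460⟩,
  ⟨16, 45635576426611092260073200697459, 1813410854488022514374660⟩]

def clauses6 : List Clause := [
  ⟨16, 50706043351960831213635437084979, 52388753185209573378052⟩,
  ⟨16, 43100121777246151749664131531275, 7529455808086404⟩,
  ⟨16, 50706025218091963481023646286347, 15790417430695184630148⟩,
  ⟨16, 324521648508820097726832807772179, 11168927092521861060⟩,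
  ⟨16, 162264847559980453001052665937955, 11349071077348245464⟩,
  ⟨16, 162264847634948011337645732938259, 44430860258328084800⟩,
  ⟨16, 664613999130549128358795630903050787, 10165963602759477058031474180096⟩,
  ⟨16, 83086891250844114606550809259819557, 96006845882435465380162⟩,
  ⟨16, 1298232675879478240492623334752805, 26634569921500482⟩,
  ⟨16, 41548516692126061263369523929596197, 163591821258511481840648⟩,
  ⟨16, 83097032146236562271111625577644325, 979532151437566143983789064⟩,
  ⟨16, 83086891250844114606542511515156773, 88033957532597158421512⟩,
  ⟨16, 91270843518683589772893403218467, 46116860192176620690624⟩,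
  ⟨16, 332317141388970870330121780242417315, 80575378254700810076160⟩,
  ⟨16, 166153519899276248058301805450248291, 26133776148111195318288⟩,
  ⟨16, 41538377963166498191572048584655395, 24577632592587663376⟩,
  ⟨16, 664613997892835744217277210498712099, 24007424163719184⟩,
  ⟨16, 664613998202094062000744580984619533, 5073078280997433118044815626242⟩,
  ⟨16, 664613999130398012630825038322410085, 10143680681978192948818262097920⟩,
  ⟨16, 41548516692050466506199958124233237, 155028346721697076901186⟩,
  ⟨16, 166154767128550527454257045628256789, 8040180806978⟩,
  ⟨16, 20769193004945045162059240974598669, 42844045077020414978⟩,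
  ⟨16, 83086890942567993757494101292892685, 26344256380295714085890⟩,
  ⟨16, 10385861368956765282561412540416141, 21575527694513186⟩,
  ⟨16, 41543446708924165869423737602327077, 8251720417483660290⟩,
  ⟨16, 91270920587705742880730044711459, 62645142906293939896512⟩,
  ⟨16, 81209485622698452471458917532195, 49047049897947726016⟩,
  ⟨16, 664613997931148321993603470659241253, 17039872⟩,
  ⟨16, 83664940976286432116344713380365, 4116571536219458⟩,
  ⟨16, 10389665712155473572010806842245669, 22085659521883282442⟩,
  ⟨16, 91271462186489057607342527365667, 175403496443728600858632⟩,
  ⟨16, 81447170110241245479910354469411, 48758538044671623192⟩]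

def clauses7 : List Clause := [
  ⟨16, 664613999130397976034609444590469389, 10153584202587623896196807917602⟩,
  ⟨16, 664613997895026906142494810151338125, 1443109044258⟩,
  ⟨16, 10394734923080426529602765398229133, 45821712286190081848354⟩,
  ⟨16, 1308216038405552403085437014384933, 157685974905003935909448⟩,
  ⟨16, 20789469843823279344276094656201229, 340010386770170344711101442⟩,
  ⟨16, 327053864686127980561985544667277, 8057221472490530⟩,
  ⟨16, 324524124464161374729223743226125, 43998092481618411554⟩,
  ⟨16, 1308215424271254512640359145685541, 25161358916571237094722⟩,
  ⟨16, 83664940087300365268489670238755, 12983064172678336⟩,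
  ⟨16, 334659759669197422864185502482469, 44050824863205414568906⟩,
  ⟨16, 20769197415108833229002337600160269, 30863389908704258⟩,
  ⟨16, 41538377963166498191572049121526291, 24433376392137152516⟩,
  ⟨16, 664613997892835744217277211035582995, 23866411789064196⟩,
  ⟨16, 664613998511428251265034437870535181, 23815044725183873346⟩,
  ⟨16, 664613998511428546410687851172778069, 26228970277137285632⟩,
  ⟨16, 664613998511503513958339407616451173, 47460234704661255170⟩,
  ⟨16, 664613999130398014954646952778679829, 6271892985061248500034⟩,
  ⟨16, 83079286353069100936493909313864229, 12874841385866599426⟩,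
  ⟨16, 664613998202112951502682693413913125, 12560850096462858⟩,
  ⟨16, 83076909585574259568365644553404949, 576478138594137410⟩,
  ⟨16, 664613998047201663460496883101794827, 12507074820484⟩,
  ⟨16, 664613997892835744217277211035582995, 23302362290454916⟩,
  ⟨16, 664613999130398012630789579407901221, 0⟩,
  ⟨16, 50706028844833625542300417524851, 39421268547781511881092⟩,
  ⟨16, 86200550301710012285240176808109, 46883210998377873730⟩,
  ⟨16, 86200550302890603905957587599661, 47532362667711796226⟩,
  ⟨16, 86200550302890603905974798532717, 49660137568442779648⟩,
  ⟨16, 664613999130397994193035353488900365, 590295810358705651712⟩,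
  ⟨16, 86200550300824568561962584162829, 43132556928148837410⟩,
  ⟨16, 166158570385000406851944530603950181, 229737229317215788999688⟩,
  ⟨16, 664613997902204919319361508859741485, 37765120⟩,
  ⟨16, 86200550300824568565252663821869, 45152139886186430466⟩]

def clauses8 : List Clause := [
  ⟨16, 86200242033890163158804324697613, 16609275481457655842⟩,
  ⟨16, 20774258346025528400978314832912981, 40535950267917177858⟩,
  ⟨16, 86200550300824568565252663821869, 45152139886136098818⟩,
  ⟨16, 86200242033890163158804291674189, 16609275483617722402⟩,
  ⟨16, 83079285192500498609897471314248333, 21856985491412002⟩,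
  ⟨16, 664613999130398012631071122705695267, 0⟩,
  ⟨16, 664613999130398012631071122768609827, 147573952589680607232⟩,
  ⟨16, 20771723354312147798856656356426021, 41835379497952616520⟩,
  ⟨16, 166158570385000406851935735242834021, 229737229317215788999688⟩,
  ⟨16, 20774258346025528400978323689457173, 42267021374730010946⟩,
  ⟨16, 86200550338308352514234513900845, 61308812688862740482⟩,
  ⟨16, 86200550338308352514238539941165, 70541191924976451586⟩,
  ⟨16, 86200242025035732793947493253205, 31020799526338790186⟩,
  ⟨16, 86200550300824568569719195484685, 47748746556058115106⟩,
  ⟨16, 20774258346029955619556013856016037, 62354672203776196608⟩,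
  ⟨16, 166158570385000406851927110207980067, 236824241183733816754200⟩,
  ⟨16, 334660377430272213853012364378189, 158571850966106222343170⟩,
  ⟨16, 91271152701460794021705233220131, 118725607318075369357336⟩,
  ⟨16, 91271462186489071118046922293795, 194302187722566067847192⟩,
  ⟨16, 86200550338308352527402617815587, 57990922277975523352⟩,
  ⟨16, 166158570385000406851927084238914083, 232099566606055125581848⟩,
  ⟨16, 83079286585183042769939084199673971, 56728680523838265348⟩,
  ⟨16, 43100275339159513753430550200435, 28378817630312452⟩,
  ⟨16, 332312069548818775802943216076013677, 668838215647116845159814146⟩,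
  ⟨16, 83079286585182821408992746142777453, 42844046176532567042⟩,
  ⟨16, 45635731131005011679503822357811, 57882730127375925252⟩,
  ⟨16, 91270844425395275064196474602005, 22800176801019139743042⟩,
  ⟨16, 45635422987147289554177230373387, 2372352171823731858820⟩,
  ⟨16, 45635460294137643615004506998803, 14627691649338704836⟩,
  ⟨16, 166156034775523903320921479299793571, 88396803723297044855812⟩,
  ⟨16, 324521339061294194866941392341011, 21046164385104836⟩,
  ⟨16, 664613997893063026839820372357941539, 21743828992⟩]

def clauses9 : List Clause := [
  ⟨16, 86200250487516461093541919080739, 13078453350903491608⟩,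
  ⟨16, 162264538112159546351097294635171, 21786479308420120⟩,
  ⟨16, 166158570385000406851927213624803859, 232690150928264960049472⟩,
  ⟨16, 166153657934275225197578145087111717, 25161363420170884388162⟩,
  ⟨16, 166153539088404704012308415548269093, 86552128717804580899146⟩,
  ⟨16, 10384672946592324055055070119608597, 37778949877522371622506⟩,
  ⟨16, 10389664628993356936899796935394853, 57846666095786885122⟩,
  ⟨16, 83086891018730357258556320325846565, 250666079272277645623298⟩,
  ⟨16, 20774258346044122719022111758239269, 48614286859677368322⟩,
  ⟨16, 86200242024519217170390798320141, 12862280563420535810⟩,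
  ⟨16, 329589157268339262257757813751949, 13150510941182866466⟩,
  ⟨16, 86200550300603207634171006026275, 43276812853742427328⟩,
  ⟨16, 10394734960557125822980203287153253, 52610114129642052157448⟩,
  ⟨16, 10389664358231844517796928314982949, 9487586026820537949194⟩,
  ⟨16, 10394734960557125821291353426936357, 49953782980545318231050⟩,
  ⟨16, 91270843518683593995022315291171, 45526564381268158970952⟩,
  ⟨16, 41543445473135164534956589385269347, 22269252185328396304⟩,
  ⟨16, 20774258346044122719022111624610339, 47640557499445159952⟩,
  ⟨16, 664613998201980734428483592884666915, 28519831070320656⟩,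
  ⟨16, 86200550309974153632375345660461, 42844045077020414978⟩,
  ⟨16, 166158570385000406851927118464565805, 229441937156110871958530⟩,
  ⟨16, 329589465544644613650424816272909, 42267021374730027458⟩,
  ⟨16, 86200550301710012276463274856997, 42267021374797119818⟩,
  ⟨16, 332317140151030830972683879094699557, 1260008321942621247292866568⟩,
  ⟨16, 41538414521198981334820656751182357, 6368381122934082⟩,
  ⟨16, 86200550338308352527428253532685, 56692616483391411202⟩,
  ⟨16, 166158570385000406851935734705832461, 229441937156110871958530⟩,
  ⟨16, 86200550309974153630253363282469, 42844045078094156866⟩,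
  ⟨16, 5193564514121949804021630449484069, 43499430805064⟩,
  ⟨16, 10387129028092710093061068513362469, 8197958960391240⟩,
  ⟨16, 1303145126520219941911703663427621, 40103182491223753672⟩,
  ⟨16, 166158570385000406851927084238914083, 232690150928264959918272⟩]

def clauses10 : List Clause := [
  ⟨16, 166158570385000406869942470790136357, 229737229317215805776904⟩,
  ⟨16, 166158570385000406851928072280654373, 229737229317215805776904⟩,
  ⟨16, 332309534247580541006682323260802189, 1568359668662600074818404386⟩,
  ⟨16, 86200550302890603910270807982605, 40535950267917440034⟩,
  ⟨16, 166158570385000406851927488502710541, 231804274444950208675874⟩,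
  ⟨16, 41538394675774958536394932836368421, 4257309024845760⟩,
  ⟨16, 166153578702485933474400512379994661, 26341951663190702986306⟩,
  ⟨16, 166158570152886686397438274646983187, 172819692288462334990340⟩,
  ⟨16, 20774258346044122719022111624675859, 47496301297929295876⟩,
  ⟨16, 664613998201980734428483592884732435, 28378817630312452⟩,
  ⟨16, 664613999130398012630789544779760165, 0⟩,
  ⟨16, 664613999130397984965163839840863533, 1328165573307087716352⟩,
  ⟨16, 332317140151030794137742525626098275, 1291145761856251850211198976⟩,
  ⟨16, 332317140151030830954660699389904173, 1571685026323662178265595904⟩,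
  ⟨16, 664613999130398012630789546929293987, 75557863725914323419136⟩,
  ⟨16, 664613999130397994188531564292621605, 10183294769138283221206519775304⟩,
  ⟨16, 332317140151030812516915114874507877, 1250334554202458312323105800⟩,
  ⟨16, 166158570385000406851935751348687461, 232099566606055125287944⟩,
  ⟨16, 166158570385000406851944530325931621, 246273590339093558984712⟩,
  ⟨16, 20769504424160961291644359179029003, 27940419010948⟩,
  ⟨16, 43100275169154320370123422124555, 27814763870290308⟩,
  ⟨16, 83079285192500498573886240983090851, 58171242253381992452⟩,
  ⟨16, 166158570385000406851931336396065291, 228334591551967433064836⟩,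
  ⟨16, 664613997894876120186570445332693075, 12587012⟩,
  ⟨16, 45635731093816375627210187423845, 47388106741073844224⟩,
  ⟨16, 20769345892884552464246926328497237, 151115727451828908880672⟩,
  ⟨16, 83664958958467703073612229001507, 296498703822597144⟩,
  ⟨16, 81763502400955820732667770454307, 29530939206680⟩,
  ⟨16, 83665094367013072367467650662563, 24042677257384984⟩,
  ⟨16, 162264383350769493484183955226787, 29389209220120⟩,
  ⟨16, 166158570385000406851944530267162131, 246864174661305540542784⟩,
  ⟨16, 664613999130397994204311703753066147, 737869762951087390736⟩]

def clauses11 : List Clause := [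
  ⟨16, 166158570075817628499018315891476069, 180128168452966932553736⟩,
  ⟨16, 664613997894951387478064893715890275, 2345685485584⟩,
  ⟨16, 10389664628955651783008151624745573, 40680206193481202696⟩,
  ⟨16, 167330188752915034223217390650981, 57990922280141881352⟩,
  ⟨16, 86200550305251787138613898134051, 44142348407274898504⟩,
  ⟨16, 20769197342570997774986362679722517, 8070245645634⟩,
  ⟨16, 166156034793657772141381842381063469, 119464053894311301447744⟩,
  ⟨16, 41539642520088993717542266500809227, 8138965122436⟩,
  ⟨16, 20769207318626861233217496390565923, 21594055409616⟩,
  ⟨16, 664613998511654629703794609492199539, 42704292759663017984⟩,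
  ⟨16, 166158570075817665379268386127626341, 166249450251058973999624⟩,
  ⟨16, 329589194971639481267044450648163, 12015105527642402596880⟩,
  ⟨16, 166158570094858247055936108751750819, 213274700347903865847824⟩,
  ⟨16, 83079285192504925792463965361538723, 58026986330522976272⟩,
  ⟨16, 166158570385000406851935751479756451, 232173389646331375845392⟩,
  ⟨16, 664613998201980734428483593015658147, 29647938590670864⟩,
  ⟨16, 83665094362291570575726462116621, 21574960758821890⟩,
  ⟨16, 166158570385000406851927084244181773, 229441937156110871958530⟩,
  ⟨16, 664613999130397975813866989215024915, 5312662293228351127552⟩,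
  ⟨16, 332317140151030830954652075096540941, 1568057363420680540217540608⟩,
  ⟨16, 86200550319418886587136531760909, 50922377012970651650⟩,
  ⟨16, 86200550338308352527428385507085, 62462860093644996610⟩,
  ⟨16, 166158570385000406851927110006605581, 236528949022628891459586⟩,
  ⟨16, 166158570385000406851944530325866253, 245978298177987568205826⟩,
  ⟨16, 324528534550179086104475096055819, 3349537652724⟩,
  ⟨16, 20769197342495441063056087416046101, 8044475841858⟩,
  ⟨16, 20769197415030990239933837445972109, 25041472762914⟩,
  ⟨16, 83079285040175623941516283503706149, 38949135086709145544⟩,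
  ⟨16, 664613998511446882472045284427909643, 1008947336413446400⟩,
  ⟨16, 83076789428012112845389747975094795, 10592466340231215492⟩,
  ⟨16, 83079285192504925792463965361538835, 57882730128998596612⟩,
  ⟨16, 166158570385000406851935751479756563, 231878097485226450288644⟩]

def clauses12 : List Clause := [
  ⟨16, 664613998201980734428483593015658259, 29506925150535684⟩,
  ⟨16, 664613999130398012630789544778678885, 0⟩,
  ⟨16, 664613999140220534933172839693419109, 0⟩,
  ⟨16, 664613999169234754603923939752198693, 0⟩]

/-- Clauses that hold in every triangle-free graph on sixteen vertices which has no independent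
set of seven vertices and in which any two cliques miss an independent set of six vertices. -/
def clauseTable : List (List Clause) :=
  [clauses0, clauses1, clauses2, clauses3, clauses4, clauses5, clauses6, clauses7, clauses8,
    clauses9, clauses10, clauses11, clauses12]

def codes0 : List ℕ := [
  10645332906597474594001880685221277261905860568974442045291601695860963843357115756164475164061249286241959386571106295705,
  4893138325608239995790435194151919937586507041486564692098791387919884535125054796821184841682199176242127474806396138228799610421511642819880667928790494649139771259693279,
  8867468632996952469815414701661890172830263675920401939762257921957275397788,
  16445910605241251953451109063970604832023291309131467643146825177115,
  20935185377243887482856237673479240657606298460701681260063547218239124427654028634329232332155921497432204498149228550030348191076311926153893198686853487278977083901802242397143078865446951108560088405745224049622726523977996090254407502173100256755202378362655584417915852683610608608033,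
  97285039570441518789871224604162017049952795161111496507553344407833611144897991717640443168308745880496320095750181975610081704429867212330341397704288496447960085693885805301069406155209874786901993739538807301158,
  308597353016115428219365592302789103133643232299408214947381020644090541897862750043458241284999737307146491489408459056549866187196007478813514435794318755897275826075649965828299506523577392204338294185725716913845224050449123021952255126479676122550291292184318936951636447,
  57295212186463898395605908770882365980956867976537967497254,
  8339104452958436783274653921816057152519293820428487270669674015,
  98210679521418676769188817907824774427480359445574821446738429135989724,
  134223107312487014004448943251412911872057506969732425532159967379145235159200163176033953496,
  74985046099711315436752317087769940606928163879169730529937251286618931521058775560201421721368664668613436372977875638714631576,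
  391097705752154141824903153970490744855100929054134112747672444080673970827590702304,
  9589280123759920470582865714738793301038647630018653376925842953843307489199477472755583210560345846286224311132708773276816549292145778918403648983133514144546267532982167016417567637554484171862870504881403298910231455029865918876288133654410635264916474976666870079463412633465738999941408150347621080428473741870468907893053024543204166409802154458523,
  1206965838098823132261533235330454231209514958989118789803566298838547529896308988737663770884485970799617863605548277446850849678919023274641053591821706606424,
  1845336095062028226669875624625535451491141434967,
  245008992919708048640808877325433535325558205791703855960450553066819444726011982894594443864,
  5931480535930687233103679015676286972534492532229451706456087855976294424388285228315748985441834411440984485067783899850973272654203886527924078486574259123986709553032877205721451478708119098595383799623006752731850315776722360467678780382503250100714470364352360605591605068937572062414124848499143002689904612010383405932404232912614715579446076528901855111954872016846359185761935390646613896952505626084206734679945992147508777883342639596352920090468631345466010362582451650875236752627031474203512295071604130349393713287562718248202218285015395068276516029994855830274883669872244561348912855068987249225471411981304185502718805815486903478293674373074896726756673672154040801938653150859930481283874905840230707004305845461685893540001582921130203220401329543143235780273497606871929143079124287806759998692329000577732927492622509192366218071224985899304532730916329871553842649539370192270988601199838981357985604872090666595025667939152150790404489444354328029689914156411501521758043192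090843307181883304038137760522680653967017477536534896455646073024895110560159040785240262157047295084629475223962212079440732487074825579265769191320971361985493823514669982381319466669458275164079241086256343920035750345167096731097966560212304512366822568093447931161245862669706770278260576300921739549,
  13691226585595039678254681644615924158993836816135674629040024,
  223301155652258237280013477447765921737262000263612095336377351424865978754721276887895362330765144,
  172435933107372859423469678717235398091516891619091280115020008133546986114159751375255093521441,
  769203606367126304351088175841997495203308028618228058833239198359871998773032339936704634740322064948728332533739107031729812994301214033302306430281459018164751695627772337723845979715116464506314936322209507894949481403510307,
  1601118035865024721702178617874737758280186877972425903052749081471267901816928745546534489456318702785234339153076930624560336770035957942990559577849047874234500049583673031132171366437524820122260241596886470293071964938507101092333746125985383684502923415367134807379578475522320038614709015620442885625251718181719060773436859531568290187605163200325043472881505102364226781071536415523287106810430561600998308467670278432932692403292347046122128666306342454629328442392052408883198549973673384429574041481593607131255739037786814806456270994277425951758836151071367909045209203118146343204886035617646885487537417964729875014374807712647197294479417268555752833821742891052085721451404302885239101291162184333851603989036511177436193486905763480877797959494198095889218199172223670606989739650482907845753478270066300737034796424632361710025590587891729429425480339868913557220266623610699742183690149280712327550696583223856850282145175533165917020074642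2168177467274933456776989,
  1475657725884988591531716465057064645038683736160861560211076269704019659821278774265139970692701772023981188722646153319987288,
  229087342431546957929136162320399163231929447924185197846938,
  4558725904488573941067800737722573697438153508189344926216101347699509600136456342507445662363663398971543795752561985134341803569233381825650868349989178393913880805881565359811484819145769326700367910982203377333871855426774075154636883081673414766659782506993660469331107762591627146692721271946884594762457317192290521921866049221734537886678729158882036975270675849060130614749349233744991813979530876097878907826110127069697143679208635709660960876218137737079800113027606074164433281365842409674005622102368802755389955209340441483462814862000325143566622832570956791800775392146690542153725331001469254161380881302846566853384658602487414670664175798644303171360222336513541560280138082545964887791481635107534198056876724847589678802367766346499094274477705488240028712783220177352093067195873227355316049401020237487104048495701778557241168551630577750263370575648230876539857479616128559778246551515340976745165712973991943897288622442601781815432378537282449748197845487012705518153803687224502856219922325569531303164304200045008326811015113758346961549278216859401689791937118309292276698912339399546213301551868725669018939531851508322350113914285193382712200434236976735608005191713238007588567900070805150040182988767101743193421110396847892145057196319762527654988871166826317144550203683768026313494042684129258920891573123590041373]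

def codes1 : List ℕ := [
  724024815728519179802363281477909416619500367499860866006967120383274653,
  18224640266497606133359179589790149803203907899697859804957630918650520295533869470192124188494091653931560060518306960114663864825074806723544629452747101171740094429445334207472937151359439729336024123740332198885950950075656220412863733653953489101172749538890455568338747417760514680867867018778019339624204970668601341974733921871168958748931809404202341774113256201780452279681465031590204221779237927696182026110140182127421877178732439977716855845538801924311424863034429337988335655729623529257119347058854629360747769692026026703241508269536512350525575288966664033788611620014066091555202303451116471880133893574464564252001305329388049146322221469587048433688253640336987963553110333240249752058393451424785189060558751436655031670360162973575381117509701954886929957999462453953288283518322535765293505110018556225070322495662746223229087359169249144291940184349373142312136292562311298304824652355171179866762586581884055009657818403940208766655733576757803469065797279552955343508044847435260554094167284943716884398172347092335980094489898639112003778691481041139864224940311393295581173716052226191016645477580312151011396915559410145606316902505948233498009517623876648593600555304466663553309,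
  168534930341505025565914392611305846507594149006522817515870291025995994412294647511421292203457245034487384653686143023501520501960950239,
  96960663154142906484439344859719702560622211321514135255241325567149564368837683702292086337227739205845036427248049636352578917275514051864263959019223172498744838701728118457968663320505821514246450964729853188271597836773164171686989661694164607756559065258103442262172449310159721275157357933726932810144114593859953542894467676357727104176262325674699446449346011095945100981153472467221911255323717278814040527121606214245628909394287271325845883983874643216430304234569289803248940024022407847793749884433471684713051504985068525021213437051499061303258772542897781304627710973724466445888278833611291753175420095109696738422430590410205629475381775272083211140035903803174171539642156754035746995897910759272416201105387702042486615240271169300738599693408653483368561114026651354490945129072617916086438841579390738560220939487680634632355556082010898523228908908854289903320873768583696266596124823407314219374491582843926122552943335736526172953968373853945083421489147469243059330575477685920187091482498364961762484363415657259315839746779536241168871302134937915422880239133066910884792915681,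
  3179604792533495190672258517296150428945264834779899611,
  9752499135237295901217066437195000942305914361255157213540900159495561949034488998207059668158361661044982603823466956159682005711617891269895575771,
  1153807635666290763461120691536868951513686745736396769441451530997136293221226137,
  22275935644617413459509989814227233,
  58419623853188340614808655276745529085892830505140757326189140511212138891381897962288318625161220961830592261539719835118714848,
  5302709305133393066972397770131944953911806511837720900056738134363123468248218,
  93448680952492343712263880942661170213838670851260309938243483528531133386252798863179302434676372363867115729669874179865725998168917784391469739390777263740911951497326125784119895,
  18193723316946080255824783431899745964353205808658654812330518627006419144044054030429245720610388662815639,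
  354142682511630432028217862499945711307563375250240370418246971437861195996239752234429974251802516234655684490209498147280307471809491455968078406058090339161795085929925216154054583285709925626363078368708923586499473700512983612432020944933782932927141256119234395484423223463582775180662767961475683345311966886362211642898232853726926597337366683241987498522771185882405877102481655738464733631236585920805074273024283421460833460783733207005012820781311190941901455770387539642243391615494643507506489634962838852142955540495337770641996143763945450693312700067253126987878102581588719825679644459296445749968371761127693574930845892811761883543,
  79081318628954312494020000107311841723731973217750206819001166113942308508,
  11981904749912271916123825565433904815409820291867600289487137055734238232475515279809757722632959996971191999982377709954378783278750358359130552726700160247431726354139547788059795982419558675820907323281219320371541388137206918566308844596859692935881548766022268352751543710222195941001589258479665578087401399250034097490558716774540971765304398206387524054597129256395292805586824854290082267433143758678331917271539322635873751060660505660819356947863865246682,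
  30609208049452055908291655918492307945737180716681561480353010245978131624140883456443563668056116439024241266806958124666907250556531131666382866490713768619730088742272675546478527041512610150462077419666914755207176331560860656683423010568555764178608020424784380929231620673994824474937062593283417889,
  2879592238139015680156725914086726353921507998717817789771238177605635949110966711160630111644901887278880840577450246584293806558,
  9774261937471148090794363110834508154432229499981528503187464534809786407,
  15076643950312351962216834266675041922925760322161439996088348679760721932153874009893388826008410500334599546465300405700680811675,
  1154236790786196230322773189507173850722732163716957169638929750203529253421265467229719051183203481946731333731,
  1072695954171133213747847563088440707685698684914142876246396204160318703072171979360092791508335020906716580893760157820214480428918480920372026355948365883227367766829932474066545704151120191910869117597298135353494044256660221627006069342583546455961286900576773671974888908638584930774019634314475708558243948831703005932814445308911511261399196,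
  1222299437844464658694708805921484872275825299185014633769771432624197924830802363116277089398577813100860730079268,
  16123371889887246145009079004060021645326423487063934942001591639657194001463895981157006553823164457182618114477156711858365048376415396868946947986558915488267352879178317340470135564662116161609034630383294718517192659069745879745115585496446084813991469443933386892171929796359660327995416134671238765550645778090708623073157139552020555236827312458346319033743241117140714540263543244483829492965764592543440857336107698128694237264612132998203806769288572420212314639277954246981246476956]

def codes2 : List ℕ := [
  182367058201503390392848876067335386450324508729294341868319920238850641600203718547451431474834097858361779728911619518817499992,
  646459820221433379125634100576963662678713389532517513453039140278245932276220818735204937859093775108566396315451576112411268945384764496345615283918333186378649617931501799900122,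
  5024110031471936959137738254335849326843035675178424401263580442740897804361808796934339546383218741456061640469888580371458855021096091200626175226726040876460014384752342417894608475430240375856697234428589125524762123792326505440347452571034794652119396726658539945326149638475786232820379139781873371719995176119960500654196724673503118764999051328874763856164034818508196083431535401955672857730362881276106137168997320453771026436195960375489599012274556032465975488640443400990477913358895890557942587913534845317012138108993625010011360231999894187141083581686263086396110182023051333264252005772883100558255557747834376873570156055653226270366075115646531765961682520,
  97902474154647008397150255478266848,
  4007193526942650318688153680106110683561208138314000403678393123832619421990859487078504815833384340245395922415649334463132925479804958516235880483267365236155993292669951336802070051816683166166534633664760809435343256770830167840170297712426038686305634456862700269788786223418497355185770498804181121339918893427722698839609110993435191939457891251346432780539547490489593529529633276439501479769344202809336156474951319245334398801580113380593704825101907228171307722740111666423466558294864080509313113621957341890939868319337489231597759777789855498766209758195885404925688925533088698201956163604148338283455219800512894978563946909236151142134933289386077725616732428667759723641247551572808459084501548065243,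
  1333352469739172992621447497641629451934653614207205792692571196698906846,
  2128591453403705674315729415628486988601563542260912486237335266157630331356297053070509835691925321491288563853198896928557838436941285745626668872927908950609757646321891089013169255228185455701762213004760411164342262130576778932966628004958830593017214206069305383573982574706859710118221067849640404100069485589550640558916479884139649102978892637481458095772,
  1740065547429927638121621784480942651339730206936045044900325117299166332107958212024120368423509903976458240482826534245393599293503011613998721692863307941874569815,
  512030083387184246671007651633168477298459827497407855866816767397970375420582944226183875397647303794687596638870918657367423406032831037080646735949111108523097466282150568367351176692647595572619878045081992713214900081624844438482489430082177150739840876373878769842746869480706651480,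
  376388862733891717776966133769926751316630734414761023568169467048216045342777976459372083566472585578280735174878300779365057493152569497745984456040640623280048413076909208508376942419861384586260017863637167192217344073875110318347653513120363028154288209543929454997862990946780131826909006486669367247208759902890156507639008,
  12438413513483733017506819820843941770326169525984626897432900227314130537219622483489016168619937056049994040302913206710867163476625604288168292292117100937182540562891710596949470773795137736718562523,
  878946721910192187850419778397237183909990845853372104545425060216998932952110199278112530936477456352645818251167889265689284103630650148158234282750521735764588234133669513360882933002338830189279,
  40796349283908579062646472411736,
  1619244183937572965898249691831832098660311633576285807499187098200911182741235669229720958,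
  3903913819715990782914507812208392995532667838481281616978181319836046348141362074738395411273314909778260476878653131330963425397914510639932762967250904,
  96578608333530774797701898786279975466357687777683594822655843016141236674786010368305005729583901832994763388042114505799768814520307559813626896571472102225474539150671647074355966092596128904365311491345461704465340156207284764262859497089743671567178656433937077215546319956991442960582491671146367031478795302302034142,
  1805622743574242837917553509533550666214747896483832990803328770753409134332642016323616450162165612907940923623385925465031417432674237539289622257509530879917570905076635807107316959763216228148789688971405772855904457527937312871479378385566522972393432911260,
  16463538124873541284114241918362746019540293991078586512731776059742438113912504693890418926075705977042846810989420824200647969829890406594529620481787549207371242021521403027975759237698446577667848475830479877699216833926732757220008342332687008575304874103689364054399929726422554459198979538518778039619378960316012380089322110553,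
  21362045951966377485652531725419835982368,
  907921189849847523819401360181087784460009562242346744382708694806036745085717448980558567052992201514655504815345116597713097263438371994971209511215300739332310216555712857136520420932753828703895048427143421274633328368455399814807560049454861891231908917114047116140517481350903278724788405429450463222731311134597296000994201269729229836910371924722483952286981711599725144940114346735456062330753376215886096017839320591835789457815043295406616425644074114406377224854965492197306083936007299668030368350983568437328511302963655347845652372690034702630242310424205079308232497980772746625463526201197918724146779376221800388837643025718383383683868844506133436943820174333474120021844827630806636397759006033903605491238472127186987690448848854231729104128941613263465138882169230401531064175321761511502238587121124901710028691530169942735958907501340,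
  3871338419873531765697453111989440055521,
  126661334169284530015871029914133599881074817048408484730169083482663251354206674882058477958196125083042463937342989042621923310835619548881967627701548231786116599933108869580727331637222610475573844449171187709514208402777323438609659215369318175005,
  3028428382990877727232972327496249907376242049458016993025372122218448304757369557527396328058184374826451180895851538846713426359769669802434450604832423804682812726452860614761019382920679415439929155733043056323852764165448043304960025711087749629506207006205944931991,
  373174033242742992295211966778788339205984488205490521914279842382733113264666280138063608136828394915853592867092354551211420161880955949339123178274128511536041572244804850054980211302930978938111497899867242943029906100401306564929500302101275330744137399637368598675051246059410634548574993341517085463444646735303734445861092060849532252547975766868027892083363100616320168110182430862623007043008348990318860924789901674374042414502928146575288665473428904263489737836122]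

def codes3 : List ℕ := [
  2140663442367019644897784181380896181198684860652554575128884998024160005499157693241686390655871456696109878094051715026171086148332029673755783998499959013244014275804872450680408111649367479137135815135152363158577736785721488316399847912922915006067618653799650847616993600161024675907600661654224710659248876260547658748232676687330592345850681460696849606325690891212761853484395795841026466894712187848289221060810513541335365727322736231258789223685869469912253088597672897690160785457337365909897691928483919877572269116955875438296601449261968406345195844076221485243693377712564381368784798279210799573439179774437490793295548529736441123426709327424516779933129324009309391783236423852931032126749602542852015061430827557178283086193251280780380415095856985984492860361426357623981683185985411062210365364492844523766085653625076885171325564981709590843522491377964302513767443765546442390201488465671045821641954845460929075018470541570404135730498537448580409776858030247043839548893085480109343730161705814682779548928946150664056912193859576355332033695387550191281570819111416448559052086576431704970848125982972017003946641336252651941628727351584996540964306925542709652512153176066073067996755201684592416572005399073877839164629277178828893077224278804623513775581445720298957480720992970180662652510628121681398842131154067087123233996270382641150753292582999307402694336045533851759301731535681381089554885992877984962545425857181661903293972425929636846060031984927369907779997700112509975405083236749595033212443180502375262383161938046566092209946636111508165578846628271685419362678678659802620896263631587013457622785829051244728283580641462752701095144007946614736765086833145499843334845210701595310358983007724666638872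67529941312122342370415654144123856807482962897835016517286475348498193351489000647488645154799545615774428277123592907159242859007536431033073144267893609801085262894372474892393663777323627582363441707659043235991188128817928223748004190907514404547936713788899290073861776381230740492104696329091964968269492857577129581358109124222438552862783836907819428970521059442863210011542729503772634898974414089244460875370797742045034304236716394248736827594218496182636615445430358267993313247102731975984000672731881102310349120438183140558828950124309674312901095500856924944332050173121141085619281313546530841693342578783747234637486328921579694461170806073619953867313500064069885279473102024629722201096765846555550,
  374127093631117660472916870191293510153854010592604345941583713399255663718641535695548624082088059944717297992403188910613295786571249980958548892170120112178825587768802,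
  1684782764770687758784896134805475441809910044921910410886834967970035277113721998004591931682037272945343134930984749644925066711791336843493724856860087997724997170369914115605814323014075239128266652785603742267768589405633852024624556821296400483636184,
  78672773875272135732043892923109350938241546824117671993926421828751826628937201799211354145782230097279048031866709045542135793299347883906027495376384382034167933082982507713582801654307318773585425944932435599290204597187058339360810333082172750583354187116205570224744921387051269339919171535738243620966210579427306735500397950123079911727035056292699840702897637919237908098558962730881199072665269547071545188271643437904047783923786018508692037502448203510428386224899313276433217654189308570142882464138008615951250029330327916708915068897,
  765562841939651056124354599140933284202285585753,
  19781694681084570875800252653457467960730516530088185952619859484471577209068464435374531106,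
  10380557589883378627001258153021814862247218992093854229906195558608534709076613834272,
  79925729856643107291687530932141461511149696108501113633620447053260435676960186961577049808616618615427095370153387082688999148621370978842651771316135407348190313976007833523349259414336732255777890134040633135818467941221563022787776101496191584287853714194255718230807186625730275313007947708852982020229652390910559623942627339809575872381422657501054223937633082439305040060127849471286151895748678090158929377952767680804775407875467662775386348551419929889955985692925050845192872480321468588405793369226849793244,
  3356242559092353256753723054846119941767276517470633173349862372040519856460808944838632842884576,
  27126581097029227405124936986239775236625584978606653502444245030952269555144044510129809561,
  666763097831713629856372826501313573849552111509601798700172701940195403153672656953298988508289935856211700221148000294632174527606015064750838557742044631110230071155468796165100693687044653226112005259429708283031906217748353076998174261475175603190478866938741134701858196444795345563382231317551399958601584845320439286854623531944016099742493023416896696617618247972098281756508597269153934951483263985358504387851663283815534374513004195940245648496739629027517368868192159374013211549441316145602598974612898183326,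
  20418840202985177632166258136363266801756912316188689865683976151638675671295249044459923000845340925504107028028518189957979148809878820553812235503403301060702274735290366568255187116924239101169019236887915696270259047350889038198053509000141470761506222036489887458966067761171446108779066570728025288862252463951065,
  3992209524010890877199531669752187874733549157769170555179809131316311106859111424958441666128951146190113153979295926664164743762214786360110690323167028876894141444025576856572604691073654912681046303355441088750257459970297208409115481240604932397797128385025858045366970875807639292258401479624185125088,
  234344627791887964470527965018545642861175587245018671202870483882214382115846550422387707717732130527342710271832197842165011985362226657439209269215892821407380371104606741407615470146154815384034,
  221849128546292445234776123660774895434122535257,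
  121251900029236730454781808192951365188819209190239410000637405498063419617911337875948880664262949291645447809219640215698178363543660408705893031330203617030897227087775054270358291698263015936650127930324669822696221543146438011233390959927189370658081110821974178836378299512477178405229375595744]

def codes4 : List ℕ := [
  13277423383702085274824287098814035230346144594308217522006998327702159720432772445852324838248851104903729687502607468228004164810010724154470178766235938261062595524518487404766404803109891130074595016569155480217571739821994394,
  3977683155010277153146397765162243797605841893971103057778542731753416425522945014995546553361754609035849283519352262044731802113391260891933473,
  1214022307971208051149088429959469550308038114134095134598193191815209344796099536096755295850882661637534420674574113956371998108084426858336361482856545557707841812846248088316372774431727374475171424031517300637656427716413702899584318588778659098278379042028726972586974969882723507008930263027459796663562897929467469993599520138715354678403245137803597399,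
  17907152356677046765939617422603930575605412065542771737825974797593229145237316296865397171138939952147001089154846020745993614419452277448765747885048908657696517980794206787429575524755721073685422550369086209753188372971615120099970731099358137229982471672476568910028321526101367943844312767348042891982774092478253346862382300969090892604178683734492084471200678151930143837539024972841260203043943613832829938725845963415220875375521517971074253517741073347552964243378230458621502199435530004738963439585326716697021878223686861571770728527445018784676076309386487267868092925502890194546906470357747886440875770613931718983019905520541,
  1992457403680075561607531503781706040087857826133611835770261758774436641739017814468553783675615924063409916197355013641975912120555290289121117604717113593311290932740482537608523190615674632315590885820405556480641583598292051348728513744893675917058998557239558386617286868790564385425964184772413666304664733274606568587500855927778,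
  2595974450687350797619907035388284268149967532015454736351691083026920864950629907401965752093168825669685692954027955558863474002272860439387547,
  5270710524734473009149489186694546198245596456824065238323550018477406035354922406209710063246123134893987741785419218968689384547125037046202772727222132112039363704479282411042112233217882346855445823248531601640143198976975923882268672486903805137836087502131085031539145016341827692114001893563186513621056810422683088600039129978755733386188868246315500362826232298009439118792892622704321223705930463816524742378143440054381864668536544070791968173414070132323681501869357093530278355721659427641543531086256237742276738502760614758859074376768070204202978603409840871324157702995464886306964146249196948929461269897155718567698863893915084789415031258886872555617285675466177973783937398925987055130986740354460993619935370942535294138971171173096573704555645071275152837870653395298860652090670662684417277792840706072208932052206336324002137,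
  126624503955115687192248366263965379203326564924690013736791662264538644910990455629692715098604563970066396620570780481160273084166557952963172003333356201470798854172837103582166130882348372127849597154136635356653974593720081166449022402768759728908489485591221146830410085096601653159807661488241937434419693609499944101502978095410169558809984130172271385254328745648845891900492379572299878544084577300580553673562357611971312498552316899515683156054045484649254091481510468850776,
  6898156037457479450042708530638769123742193125410538300072258493708639202635036826528756103698822027556831839629735071784153081515286051183712736744994362787618434830318107598741548387508289067425244874072893564433545949535366695906218043674207932164460214085052475209930610762542600513239754567973473334012993432996928878066089494848510745711960956143644437590132544228190633304281997151373073163523867685928929445065280000959741786291695303797394677407401634419138786346782493821798768138676726826293014764798003821240772849751900967734668360040364769871124565579977075395874132291851874859957730536179967291446280293598588528317991729963381632542522354188507076834908544015000304793955780246917372512891263334163964351810700199434864772187257546359966202107206206406797366380490179368472989521724961852814834641773781169705695079006325586599192992851226168084887003908772681152959164447411210651921756080235256039467894451099604810271286620956591660033768965481743723847605472840502273661177899360328004486578713372836579719801226276430730448314148723436480020598520382156800426306557583935422572007395941763793245637868874412716876158851657636756046082393880474867473502779052742783355706493564524295965520874283769268078137023649287239349999548694959199579986452260902506937577160267391786575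9057004466660699510450403434950893235101090334922277661266769898086611283924479811545138839823395385257500861303309964485416909303050941085258381238535411387551045600119646139757897144296696236144922986793268114937436670059944331110957513453256033262394558586753178417925533504739222580957292021167313350766073010820244141811716540559007091685246140192288986274661107536768216335448724338626309629493468872615442275274449170655849939988661020995540969924768319769392720345402849927575915172918426049399239939042388267524797241592232636143874136590375550113784020739172356952213291908163651071729630239005889483803613062156098073686834380995771037704042088152592857883978897234157270527455812658273080479623389290710964932191669392580584194105301220883811555716184673547112063591599319442875363575593389008286765047815839752358791567869004974777611099289293790176127870203039236359964404465665593325565022150085348530427065935238455041139979626248109452620021113703305064211003293474858386447083725132797580301656352353248810638587680213332307896169871266051227349881906887840705924547142080152710671437302906587747990829150818116959980522825967308866622659629145,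
  6306487674834220735796701408079179599884844448120983837033742520017056576586159154773224562261821255302428898562213267927292326734793415831698548587963766625072099025771746953393870517111041550637378696397676875955073220680927012614869103302287807897543898477079727588168745673923038615466567397908753063648262113510319668987809284974473581044875840397711262893194637926298412154028238624021145802991334056556971735052699869153863952969377538242688064397519370417573830547825283573478508036389064134224250305743485738943838894191115953718833622759767]

def codes5 : List ℕ := [
  7859812235522588974565554622423125712678817720065711670448123927029435339149616873665741781745486742490632488927117776728559972190330256878592011165450024643821364198890401826132067915371518442228689229481643565359295298500116402170727105196648276464431404282510491677666514339043925137724330268480195629922821213812995014997241901481247864236006843708485544861024787102352235945288373628910989298555734656649836904670284187201701204855735303825718910395481,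
  528850056261615635186282765295465181339504021892289208798576626612895247526894129181641653070021783117290707671316804541467721682998881595456488151346503102608730642516557037431667176905566525097842489704257503512980780345901665113743727670116697,
  84740298216980249433198072472567467749316320391916309378907647728178074406366120456564335197906781644326374647066772830495066037644117064445449474304234800241387353832987879053962338149761782955514110999529026682624769630369983467203160915481515355663383993427839833,
  172716862197408794420310702732122192280135513503085611281168542987282112552911979293722711264456939456565460561372723877040800653178002913655589776033425540807276521612857407042719614671190126856307473384091336002269,
  1788511255511370214775542090103745333299202910801269383389620201544416887464595212031454337575457215706595244498562111139799710647200641799529151770943335667445558812209256770690464320866056586369746916055683233945190211429740774217147759500074802840554939675331110616027625623829421385925694699071479821407913506841117304236650868752370417282896190183036350577599673816254984916402890486247158883852152082145616953140437749682827931576762763251180226137015695171500526231141452156582020621891056611415734620057175569339394459,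
  3986001211572284973223474432134216509940924586705747549453455718961952159127002567698505542417813755591061747136994410673881329556767806219282864369440816401220364883829813373092494415538698792141492700207785228652613967449614214680141896847312974713661055801563820952618482610636688003919986114857109578983091590511203468182836411157603319585720555664939019856072987134684697985394650992689882007081585036882548912991744784938631615406106823056466038818857223315969315207834163632395919737591293535590191379699500844271591923577247009425799032962685165990403521596042184484973577065166944650167152903325578071789040773558116763926052864140640020871090938012393135670444566714529393228805006997562237112406660546032295280734262426782140337588317095833326318050724143349732784351273257843202205593736393036457142552831186291594559926515547992407473933284289206748573066503593935654594911082012280486564551676916628015824485555037446998373284218811361541682997594537900440728647248521430738609227389265440668308426551263408290220278392778073958291773279047247352686886007630719303913528861433116660098037164127910218778092639010634971661343562379798386456838214360830905760624725734433354055706686115128674912198003545005333480949883863839641205569495524675098965349806126611263029646207292302970332733106363437786275914687796155884193583698326556632461952011501553515995561394810575623120781036068120829009736699021392410330960415339850019148176787662741891033007203127181582272479898142674389475379542898287351199868039629127929012627353414417494032227932141244598940086354489689890077,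
  17314093756670157869928023513972423788649243240856503440187317267185958268313726498896422902978489246979664490015128829604588649937303239887534557932889,
  420542247315605489374980049189826808982881373285894716389608575886555835878224786762761712394592315124964718490102623286497652748065510098460876975808226050322139599133426802013415536079763217504985207267442674188299385514711123189630402697817272461630258717743361293331903621247562642104978908363980073217974630554337123768073248112359202355246783963881096301401852543436787667097553895476501406792145447467379087438338075358413875080527033679832532421834503362328406256444749086103804408215695408738,
  11494768599345976378116076505328090353292129454240273356844034296561855452831959923382853600840132880282,
  13103353974587745596298647892545335582891783227698281778248366101803616287271484863519305580444047158328455354811915442975343901526406248874642109033128035210315022971680,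
  66757892659995687616689132019866215591630549428408361762627010716775325535592978224590874431440541679333047536390549285476918878632247405495271697782502547178885862028907838833454755389903712152211782262754499311912134995818214141792736241918075681587208358241002055511219590722729865483796365875091985879721892172254647737073104277055636769,
  50217691583253393112745711712949045458157895736498554698360724525092516042664581345013551200604465654451676945001380537255715774880625311895656424570736121777862437173234183853395653590149272,
  8921028848833989751518910969543127038904277118184305684500504878570165309479381840078753327604670016490355084853839642528824131788120269537649978979537627227626861066616854951051780958797262233100103325003857241797860703020185654587170035542575134057746758076155625316212193123566908503952345720470591619297490346045238732613579246789495235790831968826655051915705458417282303707635535215007265,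
  10379805128927988267898968446582247506935027854342541513145792084489903973513628046720339647856293493562675824405773202971519261396711493880014600047995040854619444235394464581073501938840586992803260557290808085991304835905780328097116591617932235883860616235956019170773731479589418850,
  15916123276447219710221950803413853364249725988269049829317670548539644305758139735856023917330321335741540962,
  7587940856554379933328594458816009884414137114418800437897115174155113305994372059629341978044353867892034464187167039534803671827595302260737037781938145705036647491773722649044762003227365390250883436592462366253723469077210804659317497427205721205364941163653747191222325950452964819626761963361969523179403401059482947001916193904183158287027195617455408046441267194680478563078332879121123309679838105503938053456131150540117027322818304983228324241306196110688744159027507864140293775660795498588719702919861076910003352120112689319182670910805146604636959771122619115270534872220665679959194698137874081918830601172200087664187783368222608904574005300089460481919570402837334615400899458371473208771837361773725]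

def codes6 : List ℕ := [
  320656665674718300649892108943909551559162534224637518550387356741986413768461515875494561605802629429719218872805340988999069338989937816,
  25269261145207943164290631106021427885809345509223348486110272777359048281502360731549250631320612468077592026343210541253421614201467286500621578173889282208178962828568816524478171869,
  27412259830003151962930760148326410643631421569983335752736865274100742565602310109848408601178136234868352183224578791770311569697893517749781573354724407745149552345156488616455310947233833369170207856348124765583263610318897706786908500026538856321057334224258205563590672712374790167045329078283622249468832766906592634464153472518457589257292636126373153565641181,
  25157675264135212303664650140763146914401020608822584684870983078635783546819618993907061101803708946003603138570577470889294471174118938676011691660756885702782713694374181176803097164400535231018487829757242330,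
  2617940342753553075231912704029921063589916857320340920528198333741832386095719836845289340736501532432183511154558963215961053396249045869470542898211603109034860982487863809781289530405326429096120870510971219736352,
  48118095581283447081911667331293594142552889796443079763276546732776957702222779106578810414996467752480577845267659550812473991840955412792276438658454159018432242413232191449252706,
  12010528733050341026983649354294623897464415439280988828011009552537199925652224603774022920447789866132834788568807413617658102369690435529182694029455294837891195680,
  60963201987176518146925039052351038519302981511748892857373653659964404369220721390352251248923333089511666283403307375920532301121455759708559040778798296965101326042,
  7834711099675137342835869219814873441474132276457375190952459644821462846215005191449113573133089,
  1117399182283600480766592859540436573357221431430457664031597382120070917245344061621255079143074287128464028000752176981172466801710431044731213939926836568225449362434883256284019663348100752169221033102846195714306878019536536251329172894289171942851816719033079496298368291679535127952345549768123415163520023708350283696811854783056120607864026610424227960603912032095162229980695418164720133436095262670326068615899944497861654889170412312579683456078926724720300320721332325899894568614517975851371702407506626451423538281622536997562438691862337409878980644494760928543111630901632137050397528538701433562236514902082863614405900550127667942605559128427517700874530539024976365632661718407781545081245923517251026185930108756440006755751913494564266537423608618742963079075346829138487833501489026040243943483460926864235947563707694750249472213581437700085070161918491079710225245369166278741397572312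4387871315307621898332133304331101994490836269341438422319000986100009663126552585582302976624086322401291723880991684109748905129350678073673926784757843151087501082733819238481806780289627061506486249632349461119629292532379929519494409051985426454295900820199548343624167593703310748660977861461241499926033317106808031300430896611216755923632127753449841117913163775434923346684269562574228750047367825631955505765890432152186639383298753829775084395491022420163210459749788797884460118790735531548966041926267720554057054693634866757210399261563194701700942221193425405949417779779321557434041575526478787306166161646324155865135609243,
  490457798866840794271954609793903303960542183009040556290565305462958149447507826965229511545015578040864345690572025537284046837710043488210587,
  1037634368082977700601545793364384130066671228688803491062645970944755985084231302005384044048410074953261293778723050367988924672713542699507944481732531793284110160750148668421030651069259922934154156924790486556567819351448630630275687511234759608385836166256540238412770215755694070658782466949339084877006205258626535438998348574236953719223510962872371264307587366594302503535610889522401526121463128548529898726500321478182260137533153879391017415773753588150874539376057661401343894807560362689242468359686100200135530201535338597383412885496741985245246052725248271001593638816276870727227672316617783365452861529287182387763236961335346787549459463703103150030433350185330965384120556643566824055656293364027368145237588478799532739751270969973908610496855999656333314469252341152033823443141134064863065,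
  3590951818076058946215884165967604805079343884430707985928069311181936328008468144889510011970103675000874703493951558110038336149570914742921025352979684514265350690123830698490088209841405564391498604452571018509821175608522734219063798926881329108675765913547916221733550286788968178065853805031774738382902640543871637429315721823649419769257508834495574137751055328779751368198114569900136702025036161918654438435687072704929871718909236091703710150470003774138716923775013856008888814663874933518330642571671962347463372998782119230353505197314864503923123799054522981895822357798460476465817093314717,
  30914763701031420525350595294896531734983173409474298723720053791257875487064457705020029633870689944000498400139095553172029586168265344869032413628102484704284328611039241506598686960069012510178677957917132397514197730330524292534768137318340473796264213986298494253420693436855807564580105702862765155090910252980307128291489499118816314757485966270760873382198819367452936734823763686690296263155062997584744926556328948000084355596514,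
  3180318417098178995365050573577655637462599501788923731737262469098472659689580655215405386813728333873846771069287304244441,
  193843997883717293200488008165471943762391192728632580530430977537689474449969153589812254984391913997987640176884381450167300305656420593439568921670197003195639979707991043880397969182563591017215545139527305125411579681104380186385621032257079040067065941218587791227877847998820996710218297071386207862299436157336205562884375002142189731597063823498825039933316723711237844353744363188397952453870189400875292477975614477619342461394029410053882738217225120361002729456484378735247943091771767420713430047501465891390179553345078388574392021056839155830058342349233040971175473216789756847442637666942611273376176512433963187329361014883851866313532884873075532419884400183256019223453970226708165547866148073072528669775636329014066688156]

def codes7 : List ℕ := [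
  6137512458065703397161000474998393645803466018110792581774267267809988515101567685608889493703738193021182514894989476983804571,
  69326441679364477947047830949322264907033955489598976637319796477152993152869591192664332019146591293195888573687928302548227360430687242539239752945091020237707334427706633697368385409586225488573862963912797293750345363509284865719972380175820836121573936231955775491917493177079383172820420659692573797517440463726589589745901218243332482884966238381699850940185882400,
  20051858670106987543200566969963260382802936365358104709069763100983315619057376693465055538378523259359617802322776430392658618426371561205982662848624417500213965127871229965165188009849188189733671287069475228445886134649609283830920694507815967908790320729965169551785473096080125544815343597175603063056146903716055012124679976082816567346829477626927799195180649465488553448988568759042824748938755638989087621983792476019450037966202780846487636920775517997919493280496394982214119964253423471558899767735689140611134994615763145138226603830381756528813769498967,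
  10381751981539535764300177685936906363789345607664816812950073961550431066745666695483964721667391206654414898399,
  144049976170694181280811758584136619771220135530335732786739366255545745142181581290493966456060780880366563559566404869355849655015855654732868741120923095948261081420178773685586859736151,
  11689048820878687300372036569631626612853510486255598434203207237480703359449674205153873993342526198960607426945396623275912023218031054183269564161751238381361201114932301460237271032152,
  42158000924265690382816923767762668317271144666029707498760074958212185290075013672508801383935016114340566573609592278151107608341148544186143160382209592000485452547527867040448156,
  3782932792248153737555255964956066291807533897611278334241394353708603141091391423172138894415142020151664040955843528743921475279514175270079220805612127835286193152822161954957631049753133906866923623683546577298720539197784845059616343073100928884702649326953390483779650401397705901326213665890414138739495598180900286756814558786252775931872653519703821859379172878997081848951667516791422606629940585897982207297167681431093874345674189028703867843474109250369158327326020361355558134277043641513893926584242692658834129281041861865428956812366517779358661283207768986674210501711026228723081285056653050634440023,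
  1895189151267976522813674072087174955245435325291555954142193282413272649556794493952205449882739498841935596447838176,
  215970375633944932045925681482644743483057488080539478827732647878836176241594687978002919428382548421171140461446232545785821012659750945,
  521692280612161967089502308639677128249252506157195058464452634967669572547791040857919226811023523176263796966184095018035735213995968656139045707209032453513048,
  72639569247114692425599453302246347541438662384251074227642894068313973033683734843744576800235241917282089841364056,
  2846529613773219850146392191316638398957127515543923030488424543242753561079308690415057454790817269016270240545855204823757059161,
  2641034531899466859688415759334585826203078277530323107082673893080660835968812642252873613724,
  84453718135788902448414026944481243654968972028464640277248170671519304560934604226205119147289575859080748800928136082997822508327922692721021884727520,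
  451704260022121190739720958568281998306946068263349452635642723315046595312248848625100034122994232221755527972277972919423629339113324810904420138589867066632536266562539627371186033617055308188562415404234894804304718519164801229684625833574613227284388702895438230720438958124598223817342266050300041064431289460778397,
  154255143229426828906465033693777090528705987715223161022494009817553581785549624277189213494775451907767474180730868528437558379566546435464009383845279241558243102575470987078697496905725819428797809625530287757948483147233325444822982738540380608257087060540490765508399266475793121819941031058029619882296846307441226187126390534462352931998772135134156258021338585170853881926586930473274565507079315208492217583737874229715640244600572893317604293916126329085228804488345754648948322473764910098870724063203465897476973717991412202222850844433136257376963853472293717120478211571850793983273793424056813253626011481,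
  105339090052037327868076193630682149755749078686806907520653163835782813550818512848843489172252406568497694596318631580,
  5528422370310423726034000958173916875201870584674512042188420841062853113101747705491592030021001124622728066054301772522317557176676206338358569374053246389452026994259784307363181820424504665988171054587698823609579378428905271015184562972186977138507834563524530007430710881021586683321312299450848688378365062590788995478240447728989418931063141494328482601559651814351544214007852816664531751466382108094727697711719904655681541648687412874910859741042274766208234515083306552359761818880356537227949792500534673875210157227655284243437106314332932419733714970838359193686875900103730451936811966849248643193533616627807655177642687861838992024320163941317333825732986836673434630849555624649647043405703108433838641665481469878625122605816590658502191783287279768508665346141008836376663391424502325383723553788266892569774140815944594761905052,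
  21989351268366106840797802626709857531360254331925559225146831639577036712623942881727083010570131989953266395646147981499146679297367552055167067580566383662224766,
  4429741641440783459481406351464046635004234057694255285074824667705362077077559700328375064924358673392536118864375712502222484743313876619200258060857099778862928424630765190686454944194302108895917875613198756597740399685503522953783244274347087589716047750836199470723540543815502539144774938229350136735651270004619778405240344691301853097177461213948614281345970841898143505293223147383097332870051937857776689549919918636584924828437185784442511969782200273348691802007154372096817214470343250866624159374734247551041641904753560382538638550320280575553192037838839260608940798884141634993309934555871766377105053306702329944161,
  829054793674674241312029886086587976097263580479938110808444845237657000277297778185356417460732463816704555462609442786631877810035572969845430345180555096]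

def codes8 : List ℕ := [
  1209269293134219079817263444635000673161859060903034781054706274772422585385746904843370996351969031235828984850880409766983169749708422784866246641349089580290667161567604347402289486779369860342223433971743272791523649713043439771235954630239031503411086166324470204035273547070046568812010899162244569096528472701224557923966056149719803112416126227446440102206945994572678222317384900243305274059143046594608116884110471877535841635684195810988905683467986103153723743855679451399308938772245742456850188670670626226391308958242172089614829538023743959700622346079079038094994299431202162272661223376836753742687182126314350283647029403625344570073974763254726328691386844515890958029995868805148637667329189432755250941081853928023788322,
  2629367425498033308762873119090902863506044437943360237271487684423493178661524625465852694126357672824861475402988396226766036859594594266763200484238606295905966523916701189704446838996604697143121907375387446683053211276291059869571849158075496039332358366088221557431547951057969989446812566751275417932249516907147962276197784810491438046802600006500238355686007837361316688693275595403641877522959110929954295506434100078896771819148280591190784973603572576362207018774114846010040375886372082231788580433517593635618905364215105898957611094386450040170125262714048792869099204203022164999852680478285752540843249086730204788650887206567132605539430063921276743667381197439122125270890515472515601692439629913766443884225607592638034123864399760657782728585463383638091519100714814380537029474929894283322749414403382002662363092981754306347038907941399761381120039768337336529879319329992025351524510070076956141453614035189409742806291089335637106828193572697752957325666879596577852337448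251170047790036713420663407962595062457378817717660,
  70161482155034595845931009572145697874296705572309625225854917802239602927141136678361005073590475049981097936168628903564968306247185595287662917521518461349257727331732716390832438196027657577313037480902164255932902667525848448862544202446174187042509010291182566632866566646073110561897839010790374367061971317398678981959190612635047644906853324026287836828,
  14244636795826037021409324800783125421012381913266914958306561047389069416227596790231740118773374320881177908540089425455647982469762012823263567000773658888384853243633798635308768,
  2235078631668181620260307055633926882991954367420882420877884393949509313218405379923285894090390121322165057745719729184213469683369651777603161139484409707571382028868721851534625345758721032397332970069391697461954586342794948619987563997741656270649901814221321832535077359099291573666819036776637168398363763883532018420122935238105700538556970556858445398623459844296782176807801247010273451852981563130032643109128165080565202497211948783226453726166029898423482287227485103529483059694476955213445762212870820334697645261288524273553790138274551429261941811779249645504166527708677115016803401204783858581232921709704792,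
  6797217470134144548827740607687778084645304527008380913570505500890322427122109114471581,
  277781214576059449882475206336127412819779727852720849006804221346049631904711436387669666750131812192652671730204685933137700554081444035100,
  1615483453440569712235949927007530571438019360103239238690840476848336761287011387913141037591135019410645673608311323439793013295683223,
  6243151727556674843485082396049414203327936242154855899406152800176124826196507966870514829870959597377543473624590555387118261318132507349618739389706717869540326615442097812546420871340149337548826075072537712702835552476990478157930724801496674702897577057531451366390855836144331002831476819516538177592625870543148292705188233634538517334033602098795887524681485669047463202530232469616788016317365000057289778640620870919080019054661949199898223185020931514369361594451939647578623500084787873159935259349120604441405134621,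
  216765639270960466502995053597727014938928247730969550845645163443485435869374508499629307386701416640728844335240626942961555579783067341377586160362359073756620107806996039265531521796734803487517274322508516526299429591991960170828352273236915199901847789609150307623354064604645484134166287631249673195122775873269516604518440749152788920521303267995297058114091303873060673804933439830663275852313901691691432968626679620995545689298117236094935074243475617635385121778643865647290194623304157271348433798720005636493826266358833326660633996509816188055277648451239551045664829601961790087213563491918707857543321432553543694361988988531727132999267479238730569768549302109124010640214499409992609833019742130763024602526109580833737578045502632952171724605469325703201918213901251546201980827135962672074087002,
  825073940980805836001247301038876312981284761072274417890872006727338528941152964900356158603658332202519430272923523407038778120130587515706721630370266092361769255888535708088352572086051961079172823553424631267185470660095466765330952284428421953863512584166566222785011989197199604651151229487109444008064886321732922316832730932464430623480867389971057887025364276257,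
  1535303150409226983557062781382746266527150856347786287964281869635507169947826771404484124659895695905283175851222941419427387029278233879190872,
  22288963789646670047621023615963216337265646143716856394991635362287482644290296659701585027703417986840314379259372102555598852931975598236,
  1608294962765064608515117875123756605250923743156023928414812723924512942480851923207136,
  2805542614519216081506585731891716773141551014164173641878010902105272277737379630353433478807666302882118113791133,
  9284480920899704068122456575533819825717609433625846568832998750662777263914059949534226569019968229533782794590765936853022669774958483309841294082254571534793643472062002643325714710380644584891499796094382548803085914,
  32587612076948149408172815145923273872373548261098985996719416274119484677573843557677716558667812353475884371690859044555027351556655021377920673274950645428712917984698326927610505227755788846441084573669500400858135786161595840706966606322370248406800238650588511205078524951312733407643184828549516209465589296049215957122540446061752714263566036199931070250607162083656627656174447768644496528549471051328111170896892420869594722975984549034014289756098376679356229019562754418767812068137178966822091421942372906148152394411946532095185491614216715862217505370191011964710198943966928963476197210545527124594618037242527983198433792747058200456182500060873186547886692374814286640278522255567963315833827772287223595386019675662362986845686156612670899197830926610902444665963400176509402307554]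

def codes9 : List ℕ := [
  327784870635845148065332711292830704415893741974058194763636793881160587289240820147702978517538881759191846020909243563192031094863158964205560224811388441631979952484079256699564632,
  369747952721148116752074283661713258736140541848212005251215808345426506325430681413701942449105844986828516741061818048702869837954801226133227897390504493056629511333098946971359661409873493149990042882257272816434761990915568426746029045301908134313460279422976519324304488534692459103117255036047009366619673185126036612875361836682193332386255771161926172516636737787670337737170718659497409049665972123727535638450036382859031672390476145313811871502460862548039790002640373371200575825693476756017355874477240108094789189956735343268692182489165635156210008434945595487031048471409539171118856661448359372034007,
  153428438508228903191455054133068902921381806592334590219160282681768670351257127280517598026278842703423854309660238714832306605274746332228289811829350034061067246762759281558692331367791033374291507892763390296714286810851844843295851337626,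
  2683594604496105079203691185272725911667357006526497490534136079210004538034566189176891905297337621046550230079957904038444130299079647232364917291282677293936180255599194751478145771611540646404274625165504747302000209191439015359353443258929485774356473646665733290793847215090561085577392394576581141875240650298203023699882903370290777573757799255027006322412059016193032318591037333871508917541860618771915488,
  187067256619481933318446852499743807406861438910365,
  480472444933818147588161957900519461905748442457008993404716475088071944778837726855975076286791845438468250902030586689744710717453445567045025085404242979112265458459992864090576883281558670696990294633697271742649459549222858460700,
  2081655495780097809357633564540640984274299131038734732414758639536706941222894571873183921801738100815299685468041950267509634115475435484272167957583284708437178250245103620581375154628870560766635979425900904404767541261494187243933980,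
  221577461952670122099580149786188455586999743163431715784775292807341680946364344180984658650708737503283062879225173464,
  217652510579522917633435831212580540481993443206442129461231805027340035422955231897119462059155764364788520865939821932463580330081995745607991176741309860519845579228211670178743852114109593902408047331879887001,
  751811630376429213650868254268306253479428397477386454035905397788493918689899054859474298746119505837932313255418577758835815543234195861523319206449085410247957396461055226594543745515673379504615592084858970795402195165010546710116245195705832346753402105181266673359397241023113595530452482429729150298131614818153986127889799454602598396539808953985965696323483238308218905166930529355729230485074218045979503479271369020025504054122693805352362165726906171602392811666861182595466151537897844741980546003522014364331959316472104752863742214659255499752295974573428793177068247985074540214377877376029604114777783136841958105,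
  30795996221220773456896925819624957015261177606260312473029491398127839969467302142327433173853270619023746770766874988855668713159117287119511384678889125367951192,
  21242475330396507698212888661325015263303472318556926071057521623937188779236375157998797994554311434484225180,
  21598436882605539480890639003813269463087756234023170658743820612575102647266112668708981263961458128252203253427951917593185598156526185605052805099459013445400032,
  1757114311168632820741148248427450234558342270496311378771982593661795368942779221317872553139886061487566814153909206913519925712125417400427823837846890230814960436758705844235465210292329185645664565195953864361188126159028465938803016015394664537928778352705291788558376821045842614165340488716588879169730561998926627200506661507210581857280689097507442893860157506140887529876519595224659813850538722974624719479909603814804789781857729556873480341948702115460563529429278006022829608709791074261708386547459840498947932627231299881981952310612973627290087305870349434159809682163500887639398690255293195926584093707765798045106338810588411099058626400650595589395727038267817500212815639901318207195922270212495446332319924422839460149675912172506839874991120496149563776271763309437660155826230056846639666996039644689988155842270078706184370414470062348415302599801994023563164235655852832830522353528068680439999370770264536145905973645749251261441741176599078906257771477304941910915339719481037414471506062144469304231921851143029381628652358096611416228168380102322161276884285272531131942669808890330013562559486796541253192198376734630620995741791819063322461501291618173802482462195471440566840603794872319050199884210583556907505211762593672148466563180146106239307713344830750082675562563325611810891088983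21839766237168848652498647193537158087742443809798549098714482031594777858790246572260614249153887463576059081217400904538,
  81584106596148371703963170510422197636071008524918074428143355826758416480845568804364291506152871958086139737779911100039580294303602085877612342249377828054480609380974294503876726091243242978950149442552968620848204866963186520199490467073860553221375240937276553692958950154662122831364412882528296519065053,
  561740982870810699551482120275016371179077474612391771408352033829022244363649051017763027270657444705613414653836202935177603362968490625523746380702537496699637406830590892259,
  71244910701521502163311482979020767564224929815463847462555544148387968873224323996233177221248854629662874674163330906662949923656662069969646139283708711514796019324373023389670406374932393625135866760485297333008709123721581420143361826999676146814217564995537184876032800477364976043521415273040325607503463365587798423080638249151371587303053402812587645923729250897885022093617490938750594768469790126200031088458194421417416734146838004932526600753238680435890907554448776930808328571864513936782149352951085186565774308101531481379347508020549892305757052244383241376679879520161259615224103591224208580867707352396175165304658866749289753997380502185885150,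
  16018275246584443602323641678287450676851662047457]

def codes10 : List ℕ := [
  1415465143383351610963430458508949092980275090206377209631255237598168262886806200703841990323975556542496,
  365145156791550964029507197605535322779789771695469434234143880987710173574279767684591027865181768094954287484904465693793110759321239198949549394094788870023479622775414271474208091987142415177042982433016339218492112220190281620124144282077078148182985753900937349920961371146763115119514723357206360,
  2017950159283964107468795799387947826430329915252676790381308349814957367503802962474342728139706836434208821467765401890801833626873978521369822130995606499205628490682931772706450674616019763175162035339351801637854412526522951320,
  798231252780839558397337791804776052932219261323784795145510174766585464011459044912058455019579848978355095729851589768788624618884061666477328632794070163067276768877843100588283418774745191991808374111951146090299323353066669417882587413806173515428643706234126122396486328709708389911203057089419822535766750014554206957006492531452951305897109915569521629254504794675960846129047,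
  16286316025202635381191505255814908571334730165345668514263428969246105911887464733490726063235719456622872154533638170553017483647295226688987402040519268307220414289274080604868808510740598871917121244507588868661632621725785574745407402200339707614420414829864501192000821377211665155368599,
  65303858732610294891301884831773278384909307896215445304766643671328288764356008506840740808283730116178211063384865775326845271466899996139286926081123312589933610950700985637542904408888256137882598554174287226969996905586727520661820992218297079305447900,
  924950451767656105987843306155532333761583203227602905313131376893456733655141287996018228319149791309124848537760590348131121812393689758154543599227409051983325107219332126299919711221753281848816463364341295754527506190700290106987165039083634603659854981028399283980732433040185633734371701729154904025062247626155849829732578060558268921310332896143879123004294526913045732421616395106206582775155537549361217668117668861886931348439468647748196167529050938566715090071427795177017644246196885204758209142481977733983173266563003125095751713213022179037332470803255181801222296190549306509431806501056288685358412838029955628488827460720249371525190850776902442016269564117049635115898142978547379405611247232000668058506982979786129720624038009922015555670892617745805084287381581522486022326818357773518464746591748963493412293093730236095966612536020728365343053346000787848987247223926726432654437115986880605166823255,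
  1458864788207422154845770249556963166162946815161015038953607230213778517670820505951880489546264296478250086172763098311835160995886519844138849137666684142630642522837408170896091122794587916025765558978516438604668728744329473866984857386623498883158031222358694207617940774788331911931768445952865176813693378892029752015355950275567905882303001705546594722052257656095474731320057237596537730755181685434211055479964081496076312628696217188524889427604480915793153079745058044714276495322719980526468516053033821328648655083290695133808001903026084114767372268228905427195353357574914297645732329497987520346455485835781752838626684396475859030536961088047034310175742310719735547506196523456757516391021307888786103499179191950901356445680577727311457363395986471164492102499895199707577742680236720568080853847,
  3018134696065942733552257989487547011004098671337222410535546135296065251898169452098676774968260715909099824648957917631148277107888248655356204190253352507472210707766600868608446190465710557313800725153825266210876186291514536970399826642399539684390515862741586341129430802919849543591888753333668798008164696515893238268433875949267005547671208870293669989747193369892620121323184279788405707191952098741273878208272662428120244303161851015755518008915955176682264876911365273621384506604201092955285654954424221063116882751865450272764474146209873922591621179465919209342969543888885415804699486784148568092076437095061534525306766416980201664812958410349968568134599524866412720371624577446452512394450176763579764397918623549499858439394658699095944466962345818317461946573839902308975964050015455343865489809986577934224476837017669756083905253077197477943356367328307204834450686534755230235595803773626465528137255382408528742427155554401024565778799584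681147429094771693242139343440464449419234287928558452329964250535432614868848316772986528471290648034868368866106673992286179404387386705486355826351199197688119904765379520452904971808959168638339046657946259735314151295610124561920069574086936330559131607824344280293639528714676930605911845454503921101305640932089782765671661037288839247418667351071809284018465351076134366132168681570004418056682099382320692234617179870220148161804206871040214330069850160536980840023218790540531749542371243203122913,
  49280317771323154136167511863017595579427460983529231358977748036378009642137329691759093961407228073544274311246892590475714207449,
  57589094385352800559263198445544037295931780427209364234319137501296366613475672911093840580348260994443416177933337225373330525667772599829044582548068285325449654522581393789473310276240659485875883120889473279418350443517840134211452714435912511498063225234745380754954665566255347723710123871718602720426211532710475964173289200255109144030648197795145192241011457597699628243983935911616541389054599752003667512242221100389095082199294556222660096511994210656699846212746464958738670778158609009420244772841666905453260328101674821731394343434594689964819710199619271140951146654268316850198877024366390686564643165834414005756063758486574317464260311695244078565713218098355884494041820610458468545936249623854117864531175272697596447583878131891876701379400115448861289999365896271880946424443003543869008113333887316024509999191009308629607454752326478665569550293833456873360626412504468018378346257754357012009039418126556254364943227236128520589254684045884637412680439710435530966853928006037698253286543545405490483875734300,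
  4228797470068258737424714266967133235865438797168814701335889951290516303816806670598556509496541902763569616282429188239771547422027035702307265311361239522241545980924277602838861115968047407433371396917111015390017588500657686857528987348254718174271960310096698172763048286049452843367250849170572163740713163817421296533619529250]

def codes11 : List ℕ := [
  7212632616758530318469160823264103774194468272839381627810137924224650945642526353059663960415527162157816723164378762198825210930479186970985825445266350476803756353215214522664949508362787079077687044993878044440538853850351213107921324683081161901287591868506047473663049695063053177856068017437691021512372293953581494324010166948649602533191677875659060059397057541401403455186629729445007436242654903697022588391923546373680358595539402597335544432548697136094732491695350005882968467179113078524488690336615014791744468898685275553768318363191733059718460828474507289494952854233643036014553330322914808176151504749988757707908969769679938387403537903012115684021567157637543078408361556624303493740683530232495571685188070153311577173120572941757706807412980997958909821518428944212091316278423534712974122293064953523686964147115486436500897598725931927102123048683840055013048686533294392305333927251527542756666459469691488483077864562734877,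
  95204100882551779358876254589292680374872433391241113489308843356602217954633574795212681430804759396490371513157014636703975053804611666171439668210485990257432583615365470051404401660968555391656435477449148744461113155113190496178970890243878531751463510766840156876332137512198516332046254649620162979583068450500877656781122486113234465,
  1233220124598691897633355417309725705433712801672730509659572459840278048717296186657729710116551197875138052305381223974181162114817563384319646915961381222661608244776429105355499005519091288214009913584383237800955316845886452040154484148062938442876025600381808785668695875676087732309524584904638456215766947558842575944891394330182200661022098221148725351906324034527,
  27913552110544989840713337067656853050956298517752021195589016118975245685582415138705011658792588404774162574008999796889134074240311738983747450919931687289766519563785318636819257648741126007775585091084166971386547370380207399356177419917617556376133435358820903009038111472573416146545908852480228919818876563030423293784,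
  138454107440023284573602474874722340072052798553030040071711756737590922428650506254964304371249689290072796373681561124059168495462198459122438199673315964255542171656641297266914020800162012,
  3554920958552832707068517257401573448997923202514004215757032223208587775130593308616074689260868837524311302022843380986826000438019666376131150331293551376556713861087163826314734206184917522567344628171730154351714680350477056542967765615818523521476287155615330183411094524341279817725699309315353113258451753387980923069301081842216693841800122435324233227783525860678390832709538075726449918480470670821758089443800662628213497268057169862684216699757579323809900450018515452447835444317717887121828366488752132904552485066566117067891006846347340186451800217517194363693562924763278054413003493298914054190385008954258059929369523428332888915464342483293272173837880290194768299837518281097839604086373384736498540458591806231239524660823586535222804805522747491707360302236756641690318610846515923175745332702084892410154182866997146498592804936789252542596803785270789952800647331688581891929,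
  853616817975938994586052484561629924743810691987358860214382897758967746460859447985599428739385731278664473873757997468246522224117657711781194363874973,
  55636611471516150305892305219992120810348840435507332953,
  4851391725877504440431183386930385706363184567993279226478856729063501708042853509231831989674277972101555694806912551372939765189154039540380951307104452342624081092129204304387650399435138604076881387321551950316589752908269550380083538410550008093883097021385206265480044279877660688996839022471166247401422651913008955550698326095574789839822262301,
  177308884265183759100210759372149663195722880834408735649214916832510888487243135986883166962434511970873617468337451362,
  3843989021161682423738553500988858583354330730474647640769343899348582626532887965906729468123052117359703177748177173658772869294610786470330851153818982390789463953338453557613831934454326840072233214531398027422040155408742220745785978304979070967634226624129589751568202729441720471698517305770181832929468070155364159872394194825412226813367395602151929063627670345519535871372378,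
  1451706013664186381013071980529537459661123112129587427772126374591179440638162096004924083627469576734738662626881405018707193602286890161558580550139494681429632294701754018765932740854718731536092453940325676832591641500648795096307808463649372333956231138847478598032971638838907314793310008361567775604795594447361269614785353530518175711404432094152533744947205480971434119020953368258041310212561085616583568139595764235042201483808006311163865902669993106606468738060109855837888786047882739442588286229644269757826575040162190746881875967511217594944832519166589716658272756253044279485463871230981013706760588105141911248158668230087318259487565976841099061302369078550422556928618670065595725849586785725086933501632021327097537914181150017824513752681681337467718502743267601972968642030184124384,
  7017490088905554952280839812068185,
  3777886928320266231485583965824035251818374819695104903940840882475283335082801424144018112387647242449177663735022333147553261927086412306577113167258881462219205117890542034237669774911450942635338652489442828142869116633610167982765491767348431888195727194109814935899288597327992238978758645001620312,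
  176349543742314574359882691089685639249340061702840864954282234086129354218572702889922743241458524326020164180250360734217517019530698450574560,
  2616946312979624098614418031988919751427615611600148743480028213091536060455319775610271471104620623047348112349978747516756353295301584778433750641513958330727247730180816540,
  37696224486279125407401656702078916404087631808377793248431345200955267561626401752122823664649887280726725590921852573801403215054726112119776645622704620769260594395085638510714218997211240129944157220901969478025133691762865250192281102396963843851987571313357650822021201019431612471769890478936981102393382262223346835746266136493253992132614900791545689319846488,
  9250504343522810438279914759794337157996204058600458180814885377030881294469427680073282807058417519568560664610418377879879477956287298220876096276740734394144760999280946720650996876249310563220511192909764597590039249677734461736130786722525641440365739879981611989007122125590631097855722647676690330029600540422641724179263363879493623146435345791086891328899975450547007352519413006750517651649905178543973947109234781325206626521234360187223244899977982151749673573327933041892356990105450924382991208920400860733829050266151779892378399987853573353336420377103629168950610216515731076348869027760950041072479169909121241959490285145029036788290977069419121683341120037258487112091560053769602118893662112082528898336075581534682605525440550334566715638858073661103350743215306761065240880707967924307139345145760696469595990652446219938846763968802153149756688372969114948332011615881415362600150103099727094793256806286981479559701453075223488922648976253505413263719962813512462929080963436138587446845457896265228038444098962066822046155879070787099734233991916142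32700804880702120243134079530494735655767959095132825247109479542086963089317525922129507959270785171078045565815606144360845724225353511302814321839060571106]

def codes12 : List ℕ := [
  239714178592679168345531907654868015281447012590065027119805497220056182486249225066603801058289676915536172747942749001300020634,
  9535435981672856943237811595056357010465775900008935465446676230634430427040104268046254379327733765437800003604057050420641841270812625391589404,
  252452157753865482278394714286241746806599627108156061093075062732525891173986540309050116479141127705312660934297633165791048513313,
  90911485232360246154825485798054619014367140995953621009655971548066952091372395682709297771759532240541970349088291258482982210518175161728282142872635698166618363626250127473603709774249207843054930651056135170853234542272789901403747955081299113144074549879818814439858421787704979134501303869896661341241908140771675813695754026968288,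
  22274707004572302760214163858255677517844126743514002613557333572015618001759205179450984484856821135630729413508349238332729171385310905095802981560987088365670434755881351844999089289518247527155664684069198835768262194688707070562991249354752625591440134667812737259203175613859088879125211176559809880186384225267817438357429743316496236087416955002515678434800729357605706908222238719190068948336582024201940737289901293071723403253353577002733090589308493721339576504015151327389726987378922831878877504872263210491184477521511997644126645871489432316136060504506957035154030904230320411741949046611385024679251735357987562590356759853761359472527264622765753109953242058235837287577107161270697338556444467566527486915223508434664266738487251450691984513044891248032854524501694287918763083240780489985470858521909502346462461525192404118424226802226543559988987950662388004695484062177989450359419881554910826994334641470252257898885559367196248941596957951476189584804156196488127241415638995267009960398439871756751063468379730117154875988157022709750770254690831729910758797868288919662571351055522584468274268757098719781691217550387993544550366943201222359983551636189521816050102120373957058319537990497506868754385466515716133900342951530980555156039946628378851019106263246917798639490529061595176268496039572028133835115243270124340881580191259971516251743998683331159404607935508649271586172632273181407758611404867002195426,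
  4815368759387504333394237432781793811851165777930934870930888701128351383721806093904455574770816816914105757474195861838131820562753260321961414468119364384097142940488011853318666055693857323413829990716268582107289990802067386387502711899540132860689805712434057378336656236452070404013139916301001861433783949191322471966646794287955225057706563667065364963746319229978888919177537238164392949378516547246108508476345985936850791099831780745342280094877399532970030865028160235741257123560006653009544817739140257355869236871065299889869775962062821891696899267663325881730492995840784899411634671803413114313662461321193504799265369321585626,
  31868423262428814947780793474318844644110524824208064165453321590704396712204548918937694218380550883236335123693683892627113875841484891050532169787615,
  65962165937664371976380464515556155309863852496008790810127110695188543080624759454419776551209824370520,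
  36068914108423759684955036153101175471505576964304224302390696494854501976327791441897816044570575845903694447017281308433898286246980197753835836241479764771335207316213131529833221915173561914351734103807977949888284481760907479059805788416081846989880844510454461156044866336677609647228809169543288918133133468508300171583745584204436250604469019436017061458631038320688253984540421597,
  38119399348727314194929841632960535400461395566182521961928249380275715964788616801824276547915066047782633590592924053780818506190570520004768792489750512662040285703325782958567539204439,
  3458937576058114622436159499159010498356995226459517346121227798804466074594256826679431519321152403499691731968297640085155431998867448679042812545015705738853755837438649372771471097656605304459460785980564959151893476841807442816073134846979724090057635467802315370215477161796386833064523033011823370593505006248311942541075606590561751769642561868318686384112844137434416378723854945789262733609232312977053708018353563674330327229449894550227808559043925899864,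
  9761177109073358504649845210624857,
  5898999672771483196378604729078924802556816486757451128104540856215840715454780771884202694053040483985192368328400114442443562408575819413955960748685263957762350689,
  1216754585451009208939143717992609624091887700358263980775151892773399959765460234411348531973523771192280752979381896552299840230853855860408166761470949223740342074179071451281722304276003487498491788761527963861032397762379605345667937779121054,
  2285772976162004829919422722283214705560432218689433088192142723484993605329860305058797272312808096124674524523604374729138724049144461323628374496,
  2647863470881419584291523761395706201473197570974861104857784695775990198192497075506845342535496615306064023908450074028615293249689599722586269069894281471024014240656046948411299097294803111949729120782277248817287815285309138851464952857278893907850950195937,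
  1867956010955777981047930330141231348161578350117445011864956274037533484887063222414688998915432677225623706774726902744237994067816035360649006735396425893767786879062295756603243628455840706121380565340753827805692128378229435427491455114313692920714913434534812418085871666236863357358832818684598697867828503141916567805322685839551617495813370021718410673895344581295279472215897624376219577300236273532909352668457129655558849226757836170765953247103856963737450739380339947063439224078379186836009516329111807441325779148326793029346521761831007044160234282781546005175593803015105606161765521047403820348223670745354429791599327506258590281987664954783697466438516541068192098247369603497601816702386191573827614156565108923872679540865864508419340473355033739677807568084037719250294775317265443550898039851236987472141242450625193118529220050584482509580386724794609056621717064484361195004308806346154829469536511913179981890041638973930852702976628400490046397596324714461318717983773288602826975624668144665712707789679978038494604396902270015901117733062070992386087799792182872145164633516762784055264640386529746221643601079637468799451863422966647387469253985584334925022351453152681118079488708664236734118019758878157614772893010873184813451530797784392797325299962001240613550629278246192762606703513253317107377162117092308429687245903738609216554221365850965650098658674364851524341677897862414700153488684528271007523268824744836839130334493345460235954404967761581487572416490634032455500973126529869828260601274814466117454226682026010497261999458179096926581375990064884283227058721527571760304980434768823724810218769477274947420964339213277023397554778996538390536604588366984716653734185740347952614528267414773942213572389721640155589058847418305439923607842557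988291936449324079585341055758490318402075895889864221222876313033774683148539615977141408881755495949032979454499344520227597568340406803206938185969975800057266405860286573990645075120398515181286583745896827367491332274330157813782985070541815875261088831270701410508937821865246997375859064650699629285619505718951313283108064731149069070988850610621770656252141300691208244952890986941936186824821231498615588923215368959979033823747842919541208923294698041061982307389973121763316550460977441825631931335015193708529874079058632173874377162800292115725904159819722113964712221313746180778052164023197984302885322891896591265778320707558251968430421309667203026792731741271343688561844544645868315751338228976939287268014464804320883454489431973028815100048715481351668089293748178110428373667475194012456364004579653647017378351706593]

def codes13 : List ℕ := [
  118699202553570320165971417214570881779316428425703453665,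
  4636186102707238572998196411254763966574204249858839236862287013219897585779915927382054228657835340951935762427125798376213443246723281857050077744627976343378771957486900917806811416060756946096970883946579661915375909110776496231861790,
  11028028268754272432179679315115204889982570463170981250277181020642600643539553568767332072018318988811494048988444757161911064916869648253430808511386479462849764542958966359766558,
  5750803672281713801659867879290953342559795322536879646111030955308005094444775484786164525655404865350551781802979681177412843955602223430915530047737987106,
  5145424461873004141867985116939323359350344091354508953414646354090003820219667271755158744505629082306605204269670894148568983,
  54259176055858431076141608894955466580399992085799100840055481272784036652068649173895229172485056525123860990147448533488803881163770800561564150882130710167006032197988951,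
  126964212998687880519447342706620826523662245176203708088458183767189381566989514345399399709724762437991205873496530931237086146419944704149946940240623536979088706855201384021491564106384285759700038845410450484096645789124886955256617875933452849060546586972017872236390824653605268632156815354140847216034734340108428407582084762,
  18130720462545445460859060893460452380135148647611824602701371025277057426059904365746511949370712295415099713157652078179065920919991207822628386213288860667265268870560450436695091236967228686781292379207349082106146540374034978500742544888704055607774254315493364550834364229070828574312555911320329322654,
  469692976691493725542513450711651966940335613948192523495855211107535465845117120847743859328008801717443602847287010625025117539882960445888653901597297642052026162602645134290962273866246705182018271549786566283231486149907793533848562787785246415022715654842731152456556710448674188832983103718137550765136869549309184998411182072228338835704837950950954668161414299,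
  59614904558275668309762179526820,
  213538616854756472110336835074891061454771545874265492628038087526433900875326477359212150124752063109108663096490895406019707707555602328603999278894913303023462596551437440631305389492778281157052248878688049850402769175034206378015706687218021097252170611425563970214394402174,
  6329589622623155157712127037633475762249554490129373753998833901977465857221558482280918081736172351204014755635025192287708768727268009912044369886423095537238261222744887928122575459852298518382446162520912411466682420074760828618187901596125707253884422846386922737015570685407314400,
  578427028627283665759770484943907659417896258143316097092217774395131932637930825111601597263193510356917548930444700390793854365687140838335366370789967838092799926037827647578721126440275961364806644830853665024266301670604718111208111233557321746788579630005323595766639186148009238127186281333737046112907818506767892241394127317304845578124902739272519524784451474276541621115963160018690005978053162575937411746405877648523734663184765502038179524801839062131020875289574937294446044272461815503861310054155584055679534004962455007,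
  355781984800529916715271427456823799204112353482946566908596557781260588903096868483668198011889184582180134555826513618384254286173437192137349441472059916741756257174025844010559952094502209437992426250469084377256975198921279839440442804097056920919,
  955445843688405509974623259613473968955879606917581252277771580149834543407009756122009336792083320652235241175275630474570525595490334158505491525614799129537012782057022273668066742748364511143855263199498374731380697667023558231,
  3642477537705456473907893173407887900591804602154540770464868690896228765364204593489216595532430517553893500596923275682798694553227965651893248931926716521310645786529188996270750186965262828177898951298642329,
  386525951844482698765356166225645799260328102745136720331250517773326725325269987263302596370588164672803886667205804481669337853299047737671996140506342143389639446703137433139467114607194098357633677974320069636832609136651203192235690029537899809276518555079444994639895674169646813712791661311398013331575717548898108652958036476897555702696512776099591580006529251123810345580489677785716142189269359481282632097241146136027254863470094821773860356150747384802001905313856650116574163002190787902497422598674637832248630555568098435441060908459503747338035754233696579238179991782631507664766890530217809070687126678890344265707733343647066678629657195989007120925117951234827059282103246569700543577722252944171565616138292510976774459198433339508396134856698749727934966189936475951137711620717029474030090490159744251471824354584602846634178821173735837643440704778762762407830535029600295485792304237877073179732602090220887,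
  4861835913576731915757371176063318265750284180273001971024820478724784073203904520489427475686152491651850202525105225414936291344241675498148624937657412492963208129329897451604447290337027995414646724224402534943934346910714370878232285118987617049964829926451182631511510794196809400138697530942110942569911434057724104446145774742654028993160396528481481540556222422779620063371138417642571770037510198377499786096987125449349376551260850632868029608317695744941943800967512005105353555467048691693222599000197893647492034775060750396216865614605904453638927085665031015456342126981436015979018022020539589523688667159545835799850909345505576894249136512065566318217533438663888898583505302499598048396593414634941159315693565127709279796557985837468980674647607943528447347744563178110260076199322689251703317394197613675773265398497859948394960463190583346232011527799558962686065461568508354471740172919501000455807156136016616493646705515607192,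
  3919491431093181178129732361978738873581336294650207294710110983185483166274409336915573565103473812302497074139139808547161216102908901482119766261268319700145380575522,
  35367705925904283850612637140541203111679592157785983585266997420179599544450198537072627130913001358007329998123742847480182543909914085425607062877949710660167437468454077083268515782837619511690002749517613096858315920371580755430740337385093577477924226228807317908427411639200875466479412840599318171]

def codes14 : List ℕ := [
  76854580715124431144761887910253453238173598026967992820773231533175258021717153619496057843301844154973377592572608005736090124797961729055759215137426352518196962664153225276206853940545771878970329118571866230573499227755420995464191090145760437718477670375967338363932625133277935016061849164906178929822788962560154053641984527543065606646853343,
  11206997491717680305688259956036226220906584350396455486348735549816676237216554543302969575241862260913610073061655347590465924415255511885030213099486646136098214615586918694979725828162199961160799353500265363483369286807877354786665641054188172136161733733077620476406687596781741428766305754923527659602628287260069061610213190175293844105454147323041692378248015535409471847954892827338952282032883520937610336494299914517523653830566575075428048684471158241807097589909861311595998550956259129938649343605593722386943114912418774738027093789880710911210160755722932067100726987717298182435457562635133692116781841448042736233838770148590395467530246416470317620836445832054128379955886312027124142167100502005368046217152385491847711850039601888321577531684097899303988823,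
  4940950397486461767592152638216411584600817148612405764810355546345478521215714067699542878350654390538852413427474877573600585456287307335738709145975637552781173441498080664859819542352329908072800296259046210104312335703055520363487904041602079152646117808520719749037929038060536769195687079576815825946004096177063222724864032102753813311927775,
  549144570408205360572803078137349318149291822720056178718162571772925107686466304903338840612555181868299077373643396276756262642158227147039,
  9117152874981086157325155111690559013707117235229496201197161772766428755986308995610245692469290907734961773657300578513577061445648661569070691548373983082751529398659200930551251612332897937272785997706016840847367326052861262295263039816092845084432002049467147517263443706944849803931690238883543778132186384644501676964402170968518040162966407420943677720544835424382205127560535,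
  5263080498052602261061896849590274426854226795918044966157486332218406368926189267833261594371919329519313902235078358736013891433135189785144400047287183381335537917750697815635121944623846617,
  106675177881071469229801460907395419969605491261470015546315535321275624626370740628137292261850015857669410748818319316893718410459750191807027170806220923463587894749295637855517103578,
  4159727984892683146605087812925525993851670946141885782904823712436956458652486564633440132498848643453175053875075076245813668923313800257840002187321068258780160176922394568291740728641327507662195765110130808208934105053769693788725575573959176003466781960137128954334213283947929327820395772937616494127068111943975101026413823311102322012018164573575639569432118982545659775652473298935089216664137223304427749133778346600700858723559619190611171112583006217562095416216876749503970662167015197396106508018249815,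
  1747136990226194776523961635806664213051038402571112737185212679341279768759461051486520909205274436759,
  34780056055012330111308713877788613278086953585086625742797333189875943869218277009172323664371449902922858176303764366085097821590768116867839993593573456444673032297050017730544725495463593543106977908574298421586176278239774389605931523733772439050702103954856085575118102494071112424924314876694988836333505518849728884931914357977480159691593699051936308844738840408594519885092140648919530925464130311315132939350581432099637881173509551590349977503759181482451674312615717245363956829788392538011857448223114146228710610524925903972036674744413946086889274515646308030760253719161040729351131137917191203402327,
  1436905509625044560951222066479489165926557297039814181895575171484736245901243400432442928327687600076095023120135183869839264554059971197966997467939586284723329840576453016566946131647900244979727055396686579131782763040892189833360203829339120746717185969708315661362981664863967,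
  4493755056524246395717796126686501349109206683715365577045257603201400446804722131075595934287958547027179938792505406082387842126846751473663164053421729973379627170011664645726920633667808886192594977799109088768413781513191779490989376165110479686057247981237157561055,
  132618950312139337369882792293547448627152523398175108028848495308862374856124595551483329167568270287795650313138246031421009621739704406292763938138351083463155861202274404685883228648254462823171966446559574847757659061452033745718579391164315,
  273022159292228616850875145770546093982299104639767689918744218843251114636942094467798263870316055594219347187445866519037279619201112312379626846688157053344819897452692885502230931796886773027494343338512978695810203760700288717669798299549480023761700068325360627348172341426317996890245047815334645876344434077495428077339000139814131104189207933057822139770142319406605562467037767343708817894838600459844499952500987400034093779291615788433814831088380070464642859788324041138613402681080079126575177679618738252077284514949178084736838275107667237175241768876518644458764590493030112937734912331244695383,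
  19526243488027408978950566163382160259349643842769158042284059943430683837249626889134782160458267881837559852372994711375773008185579865035297572321753,
  285610410506759362295177066837005745431547586977616236966531613436175878876770352888848956858868246217196315219576763088099307213180382807620734886731071520229873958448231743450133696980865017435462913610145248803357516558497635057785495462900552861734628588849029435376518963787035662724619784873224325699268703145477193554308695,
  288812628043004756213270559387202371443291244051373500970952217985513502357036326502663787080722781857573089753889196776727424704384063365408948898583429624168593265577775215190424928356750241047075914847063824155584483845032455083318703772819092962787364989423074999696328787856133777705756372896862519545181507306696079519966352808176798807583713686533765152983802367511797564655336578490664844868398317571718719066564747128638560726339105533724240515392334306383853148913244282029342081775957295379348382994067204648365226038301435656779719895024820851667207849225187674131817224096271848759754925131383572046814387632524177647038803356583325260347458574660157263444784442689497259274967595754817951273717405347856693707845979120464385325945038460968133599380797384023635586904051267992]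

def codes15 : List ℕ := [
  73785390360513070351000728534016523535797380240989601584396870118301686612799065823765664449553066376980141827122295455775981743167051930111399138016710375554544717832003639785092020968560550321422703002,
  5018510597891680264208175621741494304639060424636227152948266500445116630471046198444581880827567437267893864780952727589955222806998730355608946228058232499430960917026393565975127698652322197657,
  854700269714372535659428764525727061101300281024775631447,
  54524226073643313759673288924963874394143,
  12630397887149719852601367518118063991692717179622018296199205568790734901257608112551070974893723893298938298416273305366069448727121058920659790637526427069886797851974194842219801479325536252961,
  2169293406227164759893787427119214241806402188135353473114109973854571735060891634803666700774933828828721250541133400517402677185713582876740980854237067843300304271626592977529287320,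
  1003824277141582815951646700720000740074885961391374483488322646246572709809935228359366516472515067272500596505744235001404217169485853002884864439128538730724664013060458143040837942503980234099062199064669471895299644297755333068612181757029875182429443704066617103480938021053347920321436516697586720465148464188891755858700746841,
  30229255948414895638295761128059636863870927119307614857170451045845264150220389475464821645095364249567429497137297874073758152293295494954313450723530988902374750533975456761726999112798689432442025848756669535456089649126750413820468792331773935338829673404867493628165440542481791008459250156308115648411455450617478634311839078394933793638945,
  189566262237625600862358116421260853106028085527640611611928562034547174550634708365431857596362304616728116933594449896902334575736509550913809971817236593054559237601504467841533055796887610854480636901090395366073966349317184106991768285916,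
  11713687314293900510914150575308338845416493057858667408496152938463773928670264816013365339978739210414313474191714690502420469758932732470163827349373156376969588782542575860456109632041662726922122112586669196224416596748259968105014142813358693247842886174,
  121018421777190706885195448304358497999698330411326127701398099409544826743457278719631246116866269953011626294339537432291660337463694966818550149152718607802531543034709101531,
  4564029302884092469359336750554818306505542193398840786191150233797468220863291011359660190240411807986079384520467329544539922568420445373513982890780828669883853664534969271171899401924512771067433672618469899249866750030688150322528542656723064844904947941632620154992600535190768900409126954793745236209494704377972528640253967131945182236293865530648790915644452136263074029489066794692408728620514945374249532239799075759294305996248928441140188048074704646958935,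
  333561178431327361074986150456885286523627002051806022643253509828939933346752873561059649135142199778396304899553691083053628652800894859663216572065821193226807666165504193913020832736,
  6932241608935512846102419969290136580557211237403833206921601936018416884453066277194853123202221821138663753674401621132170844603449370690394901723689910495538477924769462038862860454048909926114915590165332587800458734852385181964749363375549979773573474344375521188300010123947562792244368770015403105799100762,
  19823741473620281819116903087705497103536591103430702428228068879192069762113183387354182177578930386647012548561099295351170345234788831,
  125314015062374103800918938708911202782132824242018593080469184382853907991696678382419660856019853810745480378643431752720270707983455853586228675925724538732111113450177483015466202215865992988714982231509153237872538057816179837462111356151623748392849845911934126418433747636468038450788443738492576572240364858714017860036808476074606953086979599555824482,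
  207646740066142283113278051116767272,
  472916696996343349085424476534019669880312462226886792798068710324118189731128382176942777705609323170401,
  816386170273786516297738294728719851252284868327966299901137897145481329002296372423826616227792846049192014201506349561385293617500495624649795822352624515623813017191871166490307177653740282737379961972818891878265009494357666986555385743561176675969054751361494013362075516709349694807240871072731895748353258209397600941588499559167398603450789211457414869367865700431164991171325992481734552902426302996139220871306323887003132864505662449301578032025895816698115294368397912834784,
  7427079609225090452159874427731555889233559464613700391565989607067458916940529736378494920618748271610795634089243683649683076804023270528803680947891761959105749944380847385423516529229751821345750150660112256209163879486424907488590632410990824952077573838019960453109680603486125531109971883054052712976785962791718472402515779618527729888,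
  7960035000395791487761331874869306928346621957080255287184451093404474473277452495953379602488807550141603493653206082224710614523805052989532437583839233637321600070230242785315,
  10454017884314714692015688969307603421510871524263549405340587078027800192480375873762838990374575108437328211884440212243606991152364904091838219789200439997309090103093637947131682433578050857897510481513699596361517954064434100168839775179228773373415917914058995596798763435483617826739744999164671036812044685235022367633689679953333797892577050537677796108777462168417356986863603435060124865544988553206019077278,
  427008552993815147258074828796577968439067160261823669952055611674380422092027919442745893510925794409310265772727032800062881974788642838721909889965506745166013199096924665926182824941442152041400674573970463382494837901628637320960014522392005794751467153081418797783009542833687851475466073730799074089896292911290765353086001877619571801342754112022404382424820530419212319507541624977315252795208384466540218687733310028144606481877519006190749290241519884992589223472601620232373457895665802328277653950573484299245023039761498457968502051935332975066912709834053114284464412472550033369085189201854916996930129742718501102556162825087203497821223496793385065465025826920006128415292518725001229926236771156374292338582719411274559239349245907957090808760055596839089874425278233915068855202667572713802902670071934159922679191510765378347909919542849014847095053925084839520196607149291239101719246674194127359762329445413242692175150468368547473004973005427800]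

def codes16 : List ℕ := [
  8885734659295540500537396644463518085583531292078156141846119829967641372545252033734739955910697017724241101204470554549215565105085151438071387404082041806849346568967397305720289887364209916800390201230256988576244129697084585845487742255284815856861073629790666374300593969727822897121598579097048278826510256386540850079765301950271879551036630415999606604035964351589306401980223524595746171099945634848717359437895776527548173131530481444379200422189269866771063834940232361324858505506301433112409101191171234414748786758932216749102072886003030208346938045070322561081692895190322139239169546147746417065139562072978771748913824580228659781525968532890233185539741047344533297110082944108784664472186010458680505420223635563301545446421124111707800390326819494511293962706683388865056024522084615000373256958607085756068417330849646764308742006508735663094016380190950262055134,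
  291555581647089919074036667997509776527033204577057646426433893626703800070085779682083506635573096391857318587840856887276871846449943916505487963942382165042980093061290341519015253945568578795535731530954344128371576166114109252732405586795108680904809953781885425448723308127695925843320922266110199897971936659226416571841591605102549147859124770266697566911132383,
  3193422296155983121901198551830714782301919816881340912961705720698759804162020641442662326530038244808053239919632610946956862830046900262366152332875452590885573551140912974998619134683267849257844044828324496491242998882040355615872780317464408849735913275525886687,
  1122108500773615456891369587310317227322995353,
  1357138344570478173054331061672642187503764719948932400812801409199482300608612200497729186483086000153683401712118383857439941666649407571826193862575339761471058240917597318946769963678303703446510479245133992669147068703077651066942550546867132962118234310615194,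
  164383736741944742272086251129480621074261157353278699600169600711832268247812070095026082549771887617436023480616507614380448430455153881030946856200718425993432645120417551487867272410422394996876370194908,
  30347538904611543192014986184855118201057177816110371228936744542321426974812711309049044741042811380725305806626228174918746206532140388744353986894741632038328982437048036040618884715153370519691004666290275508966730234267436828725312459197449945327302606323305262292475001970058131187725061587703161309981225295272439637333036054545595666242684154347069012275524960995603277473303821632964964979552371718146063187626529246647864706462119919966831592335073783593425034752607492423002803033396281222988119453652520995247753971070550378771992464396011452447149967965755641575990943498950858032368476110251650781892418323136100833418080599351279256625997100253894080881612595161006608260273212857204075281721602419258005784460753867355679346973265375808476084772827150031213720741711984160,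
  3832485898509090065815883590034746747462658338634447260998064234232039564326547867935518251144538879514807773483978387827518552,
  1189228311803547413106006567011224463901856070743254620755697588055226337449457213892615273466409728611373655327730600216949433214709623455552797555731615043267782930420728167316917936912864122552642615775951413687820833089787785212865766836799749819804754077371303612884817751451264991380755753728819945750876737844455840284083027813710472962519526532706610338057478447802666633665298389663472282608153904895403700497392434173486020479827649544932797718497957098795838639037911660518537214744331222025890970916217462046010160571890899841593244609925757240738788384802429173824239952415030049044310271262242787287,
  1210221298418847518329178792189188261879080943152510131922817519587859609267274143877138819777807071526427301025331541590086164867949601701486844673575573781320207542042074,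
  16857417275698575095118986846582930214744096385819724257,
  222459218152714992188198438450366612825333482674435506401072439699452325067188454716078844095682840821044444425606293868342998340695,
  1687771449333194738773390041553552126821769653357498318462211691122142037183511661816903707039365629009880121314163593709545527541324811236836826748271585555543207691755295491778414616405384595843006820955634432381451781411159322059706427799453888068107954027784422335804985530715883453915672858859948624625222717055738097826944312067544671275102317806311488853942718524294417844997188602841919571041465457090938646417517182137424321126744180827556578309632544,
  846820506939570983350421322399898691029914540128837083487674497582816040888246011395458416063553525959273531165038668586208241840606252639603529567540109344509358184004226303718464385995112064819485640791276252910208216071022334949144042314288951851368296512146148609999272934576669499887387449215574592848932297276813638073276817466398949179162843593132899543101099045817287273177024375752268608032330472017279575544224725184408731565826949764571883226676289537999072328383430159095256005012296138997817188056603385855845321921815062723017815261033318474657882317523720419167159164802934428876662121574882910708475118426035553123238000511749241455603982651809542230977876195101,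
  2214038767113907842420788046316378034995436644342036780678973281008570971252654534388007379147956131896405109583124312041718413647649055656408550123996509287985078944821773451644641837071088045068273726497512066896596805986164906480271080923835589394594333987600329899073190974414550263127175820724891274847462488476319549587148125769338429458128301440298651,
  7470178643857332037860272002939559838495336459277961643180702391364583216495674868609021330080917047471890412605784286942251383670306,
  489294954749479833719469910969353957516363246514720090564241340958014522419772841880882592095108422594214244919737242418334261358118290804666569331587147996380010025828203524774566381836668373876842939549166582021284776373467826273544363709337133907880376849165400070409185852293203868,
  1070489127834814858295081127,
  422290407321225839043402264551240004780338151460191683523760946459853949629545364475527725630445753941198956315389124557863899397542919164563374603167486026377973188680525045421180260948354241404034450443548201737960387451871106724265675545059443838021887336833773294484487681867670792218404680686531281718959147219506884306887356457261350230077552552586824194462654258817986736653106001655976472263085652791038286889517407096621494410325740514882517070878566113091097641644252889162415894315934005521654734015756149699506494615876523558306364715256100371595622036961374079193635306843635794379229958768799087436480014635147687796667613466471243260326397027948558944034814226652966852554054117946131321687449701221783081938910269214091615893797736683549521039693193278836755084279762318759063651206620]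

def codes17 : List ℕ := [
  8972344223401141500529277763601096358548695119579274026989956775618637669905181867640734481951708487129978043583411310472531280214141112231123741528655115933527985800128687183021119646784394854323040099977265395953866001722697417461610515401750751,
  2935649482212067092709520646480147044319248953280938955257387514050536613388870485411769802773274343038065603235605982386648936641328394699922770348711902022853531,
  7459471888903049344702336615604480961801065972738343905596288720369894567008635085783093144234448755422247810309097785899057213596753652652073278315632079560138571493928819095905,
  58919595647649119972389296224429906998478640237459546364541191044808361649229678562741500851913576285630796761960791652949330972778138373793112832674626016455026926696742099947355551303024511926190798850034670797687202937010694025007556014161551959081803463753878615131057360043126369329098587333285831642517744600450418206221213356525221468088192895265909370094941776453559785543802452024708572859834625090092828569412983487642845569132915043980344657062554868306406746,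
  11571276430800643472282395219109416901037372599538746394556835486571286223111492571021833429203311623174703000857937993478759857156566708461014186457619297666271532304454815506502567623191386375939670024305738498463511491460983510342613213295442083392135764736070254777460808372976689345388885537029451358954703289914718002191566662216950152838680187552561824390383688076950922553438743746048177377528748805905169564673811541266040816280,
  9765307502335849204659169565196282505720446796719669264415488817820475265187414781704308204589878434679271902186468077905295085048102009321374869267560818133251990533237988520643811393722792055175223452562252082206530114534839100048504451270514334307506047428660371949648755744015367446406261000475250701093579101916855122057003327320,
  2950947709470145562478145930614821,
  2390111881477331897465962132086026284689005178717316735022737524657609117145580159087605210700410277770978052213663487230536734697807113416270704689314796967168319564529660959206417425913545397843493094473875670976474375822049,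
  119772986899273331748752329893213516180162570703454466912887744389017788167463888814471296450301307298980382827367235765483453624007901596834868481277396776278392751975814608978578357617524500717839942656804776444886087686459475564353756225539088749173576256653471832198094958030874998634849484659899992690578292866733145316043215411865267270512950205954679736059275392026773264114333827736295961836858568128318626839644121363586463901795831910363556890643110042021159418873724952686970741255211961732436166706760571788913416999389835847636035077001574431424220362300792557005004724233728054185150315886695990735369601885953339080821904818288989792364746633075135341816424690292813073089500436590248754110314976821688480050453330398965457849141700923614899186697593803232170985820560663512081088811697949803255833083124123505641639652736525615586194115063187796569907585496550172071529404116847788967555801913121729299045082966574652152604806859142406710399474532716812442291334747249795156614947391610799716242162901473094216768724023382602437821618190865483663231247633205087615798923749215841335880374011669666369627373511197419485918819117008971952263429884896099016960720945771239467668386133759692796825721517534522788404207481091738058108740494662814106911384065449845004641548510528289914963510940386551954835948190024913064639739461024357482287498430551818121107948026228346759573196122584534247944534320761231769653409374307915200339229799792161475619454240353923366199749596399464777258170866960579618119334349548873878041096093038321007157022339048474180943642861295531222552153835991460088726545913684468431787559943085945421002457468517770799145221677384252620025629031700651454236292236764579055925623537760927328039647,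
  433319561653325303170085576690006146433824,
  45873857824222641336205743157768584365364463211479171488439662691278146597161471432175534351014056248180653569273745718432136646485324139304335312652489414366129475357231120281401770348393755428199735543838851317171763224758468789393388926556625927502051715157430756728510147955288794159670141136935260385595080725193841116294448439624459052212064955737243527387608144175093252310886279254889241630264733584125333622327208333116768358198771278228824,
  77037702708384864362452508644419375064306689735365930661801732375187888495693626914119658166244371328734735688665714943938437329701167521891807702304911402288090896652196616202015692491799685043411561219934026464,
  2183285739575217636692879708105565512665545748554733814324975695214938829187993685697705581454990435563560714727540390590080298626031196376608602397719818244555484072302478596139454076320460729661111705059577144578561005745614746001188107156360873237352802998174693499205958242145044831495910609125320537180336433134147158958628962339774986489433567721110055529732107869496272920155938615686651157096476469780876333044055045636069387944185275881823902077991291383383852760400995215273358420943410480311158455118696368726973224392793910479478085169210679948354981567502601000670741351265839217039615914114660858782256261366383974711412405048093466817500378041163806372547551359835905594780308294613451662228520097894483038151285253620106643514710904733910472970175779060168860442011562084991489230917275120292539578717708198694083027581274925253379363616932899873450652083229473662198990487406505288595298687412197145719561664103478106484576890169062768086335780019807381338581852957105546145191307554362617835953581915703181495241611135041072995798623332995030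4873891123270738442541493226095688327706730719594813901123753647264595721199079104496676176320339926319298804665959352697841817950685926258579348853183336698226464715039685170345437782550742243813303685758155400545065196804810930539549548864201247855299105947807199505743367016392877190171765546320035908266202783009598118883984358253065373613379473854840690299703603397975205530934444448655732720911294976709154,
  21082872585571282040318700916930911649441438]

def codes18 : List ℕ := [
  26039570890857289841193240805081681558417183499019210209,
  179027920651814076064381497450898333418002680260337113484602453728310945809715456426842834810583045373329963574029897122065229216682136698808212502236125159323519111474871447953268699058760898363274800046554548433895934188490986644709213147508514805252211910301075479382462874233238948164768282666301180597500969434764237075583779749417711040443888704717400657418939113636837871372896514277328328694622347526271415539362372426246536874543333244089042317491920577267876840830,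
  543765357547298798651500075379079423932880066721184092278189161018109052381168422466947590175786878436432332976735241926328980424388617924201295953148994715743113412976580380187467486481545436,
  65365060044533478331302599841785130556257184064339093892718453039912630109975288865274794639264123830854172047100900824845075556864862965878995550018218672013538919478776499916129635486884362717389456719777170730471910302899438837053094426094954147075429586133776706479445905500842071495351442510457974393167578534376411976134293174875364926173506872608714651258104467342637344,
  3931593654713283323328675695396782650512983584939551785166745738773990914249896936120979952900999523123126769632416176019236034452542673639852586403300343006287989214113327207909757537728839677227721663594590992708108703173233146304436267601226085307204082374197321468822393983676413576104493801645684618135793698624258244678518005091121627290854836816654850056964889250514823505418369226541473908970717712723525151271103541483338664628874975214257192965032593046200573629585195549645680558354337331949629710333294702959154690593670308311694499848792947467082842432554421789531241412117546262486330880172155587912900493426338295551596230149655294084957512167216242262210546935172963236789435362604334653758207064415103737278774718442858735305762720946956436938742599643390309983345431077370157831770665625670031550551319790396567,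
  52012374451942506305807054303774465611699658922355174324784628397643213078335546145051373542064413774439117623291074069091115983928893598529834520971896231358736381923125439538167001830799161000885982956622830960205004691346704796203322412629420182954660406050876514627426075200109303131703346739217178412997039314683526782840696932185245272921320135965597307604234675327291229425661640860053276261257720418483052276339470140519576248702906230501523928395624692417530764603122042953227210001924954639399093148039539956282342514896321015422501575106608287981949242892273814221958332024052401904330071194762243538665494327140311276154520331374097787183816240009433290936500940870881074293247742948550445872935189308376,
  1812539241035358507859816866299137914972576913377160601242031523402356941838418408002264683064183672462604884570232489488068887487683434195899785432920954192187692308632325049476427536778203997277134829870714655862554228420245349552219677095632922955159,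
  19783060764771691945131208869187262110799535193298687265942922399253303081816413666241244065887534724601396209069643936345245768056093857649356920697616355161522789918248837184081465593442,
  2529674066576249193104906496079202466480647363670321264806185247,
  147010718407996075528906383410028895741094165379624404560175126706865708369874611387388227930141,
  1551180971512883908005992197460710074591841655113615669284035406244015657458671252075489272359627239685383335124028381172438278904024413450031383892184829708290313059334604406287840741789114845295704,
  1279010577531745173594095647324223084023414942990207160276132946484353388879416201361641951793127176469093371765938204320635635615633610980997021201850183317201523838151495621296757018800546770658,
  149584265438495294453370912004687845941680495318581269076057120790621585545309193450471168303961821895570553982601970281775096278596279429137486692142938417883481512811742743612872468365798217037628489429172870941819131694760791197566547501539600028189044204610547214387850992739738616225079370025218640889112775631032658249036722212553211320856252321902228959,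
  1124146573147864683515152507863161654146665478699311122541055362745752,
  194406963877352198036735505741293588047783332935237878938089887862773633100515303125655490605848389781978478642217793431788906936251506456830151712471463915721615481698502252460505,
  1183317485656704101920454022054411852690645476835722292051048074438742213910627086516051122898331480691089240378011907846386911302647308460914510734657328782328057102645568643434841256476559863903812191922814976501796404808949185625542290843,
  56498266334712652653691756698398403940289797166080941408220060076062594727474315474476718271617956860539047971899164133052835369125628076620278699058154118944390837066161691033054464719789677880908797921925461660,
  2416464852419098996185113365676018039277277862544977914860463377951526259607725643532405912652318600834981115288412007635392640711426241856356317985193698869596283861649342321138896417851398506381624284971930,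
  215182352745922637587710420152353057508321193910394984469848194250177775949208046962279518562494969180836706416044760541249246614007678483661142897985225582764546217992972163785135332002683813845477381699156603969309473041233339738690502839660444835463515476847475168839115131456429395287242917455963456793912583116885493638614425532315,
  18750918994128400873144091424596914345750498849154205756271424811232411,
  87585578437919752567240134943566325800,
  22834298486055318977905273042679704839297495145429439806922324642592479017694,
  2796515288294442844942168225172264829467873589179391342340446986748396861093174879194878167263972010027557908204542237908490394687099029759952033262981025098821598926339742804585734416804546550263440450691369780140088180495217553250669036450828327395435355168841689635207194835481899968895478182727461075642224184682905,
  94348389114998131444593939313538774978730290379728179321123803987466297366643027217236635592862338834305440092910367706144792285493990747011668285778890238493002943896166009310462019846443032208763231373483274108458517230285720978607120263444113262369155710496138879244038359107814867985244299325670259050309007215529447694657163040087096463143979222809068560586914569325240873952669056627712160371341591924271110776932048557048752195266177901172250590638240707872]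

def codes19 : List ℕ := [
  76794558939482098259169330734205004281581029919403984558428949696899982256121761061591745011360255278053996761651218625666466724804161564990020626434226122909717100300426560752608604628835581819051134886970735318586177350155852417828743440466813412011906099862942315784209987431777038764649489440938170044963815383174816929557475601051028017074882502451939426900483692629818678087482092953952926027234201552620199287933596896,
  1023559239320790926419046887512080225663213176914013960747752354976604628969306,
  1068035424663369503499294442537308490671832709871117831815198358532416622793417481397672352364922258476811020914185180426097676706120651200161404680000295074465868107351555904038440737026199741498718817,
  213918556170598780279225299628978229582908861910185610599408503823753176143368483028952134767722524587448789934596909685396554820794111935285992973829838751376566391685719101963169518621137316775350573705285850456404962125295822422178744289958077754229321414783189215427910984364923832048901785739171956883982040924428970164635091847500012461271382688186781492747740532750368,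
  1303485694484035926207735797123735136825242242782977678198403887020102957398755426498217639152749497328680310066539140707655069383628387488541618794616218997870707294334612313761875428825149854609557630353888350912486947420584457948527251383645841636082492937514833722354693981466343521589253968077481637548474601188940025010793143814236170272426545961551059095617627467281490387219476270527231616497139455981759598773034369369337974172659100546881760532739752300794292208099267730532597686621728604271945307959124176444712065948557482055048399362369174923837373319016220080731801126533397414071706439363807057559612582849167090470580548326340893753743483227248950396359075521116049413799373560279174355822753881201055058045226343847555581097134777678873326280516889556383557516886856122792704844572159267373945053699911427801448883487,
  67746895207290241382601737099393057301203423675908340239970308669887457431919264623938172673756515211382333635742700818458324675445167303274144836860813063300512624288010681998520347629177596878570620398949558184865928753661962043315236540156098072501515568424332047804928306842792173030110332275148498514696813799970295978785566382841377939931840422666622286792836853725903722458154169642715411643265187542628550120905914943426942214593370339829823517362617089479545135830911214590155533442661276342472571232924853398494152450641386959658877924858164325967116708615155431393,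
  12673979148734997331527557157958211690476606197881345008038003978909082488052939589822035305864030453005379145512615451993649886195136090425257400318730612587485313235186447729015302072844216027873494775821680321051161712669746290501273933403283998512767524065684425051683760798857776103048518567342929260426164803753083626456276854582223253452528911128169767210996253707842916200390416914924286849895408805485419494972135763040563406289486814357610404428941990465694398408824678780097419239386920002886840511522286512875006404738346216298547842719374840545581279290438657835190886541709008871543476274116399212835706795920667495552138117945780506797811260182492221052743835698869095489254306078578621090814485474786536489254295497324239154947594687877892330380306030560249095937114722671862912224226906803181674615204484441312677433336887038628176867166071282687986044685483252227359971072058573493665809394585550247819067330728656194101694379515278137834520736325933459902654976304798,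
  415899350844101880154983889643680897832730806699101852195645075999246409033717581469924362439783365922819815301124515289691201536382761569650588,
  78769216950225639035074439320040716395521022403654785228499188331755352643870029904818937080309955471104927804354580265416312048708491468119,
  18509989777384028471011763702578143209549318989449395991430457846188913788063264330709486585530113188358848098115385981068324,
  27318729539926562153821214811397696106698345460747293350349416396390215104148875418774990840275578207186051817375840369287108320424168563662351170111082084979794365260978928056894260777678927619319439720132158631919840599470460930047045390326092384277969451236229024062046419655003662117295707866852874669011781615641955537874536103143211173771631604105853689270405463624512344924420762072665679759656082311846180966888041037333759537552773119752455275019113505075655418417565932772756444534807387743778913555005021518514958091232471665045260336392494592299253494383054187527517383807647298067065408512880647694520101926904111635773324471865584588878848515183855109216139836769567731113081531330160194772351339754952909774109973864550392002974806765725968976881482995045218874289534462058002062845318513955805338956957,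
  4951757181823676338165841865920584318284396263032304817532234533490294969475296049952722806558768755587862584787041958537234130865278527541869351604483662388707490355597165740544557040205116943629149842447773479213483482477780218844752312266549285527265,
  36882631600956548807327453178365575884105998292482399483625902583229783,
  7036807148061580208490078178802002655402099232,
  300937506904826684911863882864106404849594563197323256801,
  1196190416528153216758231235247873756918212515412456012288450377155548176171450719498401593586447944668596307396577039556811432244640955349255078121047020309605939318979887873199332830959798676483934376656131978638233163643708434599467787976657308314,
  966392570955616953292269216053695328291377593032744794507821758498,
  1134132378349378456840973529836944669083447501735444985890598229818002093331729600957949540737587598761883430029645876164315612866267316889376513238727581629145,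
  1695927271453696527924123529880455600477396825948384937258557387110906653,
  1861440852129633269063129573764722076569642837098864511307664776119828011218841892453958584133991429418536000881258269571514861824830086609325798231880151936319643273144284218064893135233175005242507538910327865817539395400161618681959873103246946876256492340073524293777788196407360976842987384026765077700225221536728612194995490051805822083577766866944828350910547552077904272962053874985974474828475060334506202729938414868885040014767484135498899974126839395956337474985545519539878472230968649887072799754218711951826161304694201352380012605984]

def codes20 : List ℕ := [
  7847625759034254586609468634353395314545323116400350928563560832872510597447646075349192605705305774113086404796940522049801001103408185468629231031611362086214992470349215993967244523493132932456226980540625285825173340969282827163828314032077498561959266744675049080441326351615787804793956778466597451061013199624189838619078776956920540501127163317390938924382709933045334983969827565824054836236294082293775088413202735990798524462944553730393384116599737539352918639371602035065563024286171174487415897129429357975783711,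
  22905835821274280450687565568540714326839874533880836240452339703191,
  60849606659425985664314269998544297113470960914967328502806354862845434376525717614011174483046106,
  20392067958153867461953171911485724339838823888282546691434706090824063391071978994391273744301344219396200936946339326127196287133923242649049426903668091254548325379425042959599452662369127145353729108119757456317377258855325194609900414620872360564926981873161489540864518873296439304302231616359492083318196899161534456966286025881475563436403720507216779775470983937425581406107,
  9999636337756436585997619564481631476491933554029150915774712273896638139802904557999640793835768826058629278890698061717900801281749872865439153476152493198442703022314173744258467049425104252721897131530482126814962263365834533978461526532264599849740854102322908421289837433359085727237354693090307475732418032159453623354832640754674555381502925273351081540945424605398476135110367704431299482,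
  409993269753861929407883000983979018588753113437500177471298717120148295510052251599781521852617125873422497336090291998558469161139984463721718650741508718630106548059809881204924839629723908966074872469811893251077519470441183056394088847627001175137237514004819975627648263519632512017972556369736852595837404769104396048125097411844809130930539653028323336256609071201904635225432256236852394324262674121723833845675997958169895181897883284299448354154331283847067,
  1543957600892131835533348740449918400245882654139337030181087934165738981426644123887881511300819079618038086350163168932825763101309374935679867162083225142743558876669519566965347186285564112812570060959486065166246284548316322539380763547540119705244651180350047669129241450312181465280030993801119275189112355755362,
  52930020794024049405094834212767508554770844963090568221461828669808817225419283145421015416846825819070671951050571291695586485053545572740733685633472202890984664235634322883821544451677647617346270902357151837008710564111002521668759593182297609422318793081296808630244371662501941592493039048622085235797039353579085380124116404988718864106391705545682016750019281024622948012023554924909509506057186432326374541157505442756529595772387609978207729404417600341019773811506245733246921849284131681,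
  29819958301431985040932292185396262192273633866157519684271570002907980757734165183582948848283332105127471130862969461139331249389671271352619919510794378892443233875367852042800844622650243189556103443978692810588304922129375036034948660478015529809820428906495552848031173588007293829498897331321250170940007258170827037232382537987018714013283492754313385862259530960395499456767979603077320148722042082803459782173548703393296623145615025231216997063007920256413,
  1830956973101865631790178488462361308,
  8785323092245436105544134320405552996569058712,
  330537383455512715506039135855640697580672693977669732,
  320079476108772933286848653622075699115533269427960765739574685203876369729444032801634969474693962725151225142409902161568937112617868565081611156765369812165000626365073743921510232427315197570517721924085955345967444444024641343002855211069554505334784145654619237923093058788993832007204407537888751707254932270232354298704460077860802969057785006057971136473700252978032391507903299652875708761616872111861862243809642668109901724739944618740693434006019797517118042348888232897893660794535346155243394806274849266989726952259117830127553178495816480537793126394157653079886175223050284930958624297959329168317072629484309434639470296310652634575291844758664162049914165035062721212267602371742154728668917315516874315352335322551579206332822792161896780158,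
  57883838716949455362924443812599798333688437015687198784270011046730444290667655416544005884065183648770121561832177094689809595953216845224086632641025034124673190578980968190719545724188,
  19929377999749092595916620949300793089601356186294013393547609822127647628997891529650598490536392800072615320202351231743632307289532405355267850758112524667352221802794917089034927925865508567]

theorem check_codes0 :
    check ⟨16, 2, true⟩ clauseTable [63, 151, 246, 330] codes0 1 = true := by
  decide +kernel

theorem check_codes1 :
    check ⟨16, 2, true⟩ clauseTable [63, 151, 246, 330] codes1 27 = true := by
  decide +kernel

theorem check_codes2 :
    check ⟨16, 2, true⟩ clauseTable [63, 151, 246, 330] codes2 50 = true := by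
  decide +kernel

theorem check_codes3 :
    check ⟨16, 2, true⟩ clauseTable [63, 151, 246, 330] codes3 74 = true := by
  decide +kernel

theorem check_codes4 :
    check ⟨16, 2, true⟩ clauseTable [63, 151, 246, 330] codes4 90 = true := by
  decide +kernel

theorem check_codes5 :
    check ⟨16, 2, true⟩ clauseTable [63, 151, 246, 330] codes5 100 = true := by
  decide +kernel

theorem check_codes6 :
    check ⟨16, 2, true⟩ clauseTable [63, 151, 246, 330] codes6 116 = true := by
  decide +kernel

theorem check_codes7 :
    check ⟨16, 2, true⟩ clauseTable [63, 151, 246, 330] codes7 132 = true := by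
  decide +kernel

theorem check_codes8 :
    check ⟨16, 2, true⟩ clauseTable [63, 151, 246, 330] codes8 154 = true := by
  decide +kernel

theorem check_codes9 :
    check ⟨16, 2, true⟩ clauseTable [63, 151, 246, 330] codes9 171 = true := by
  decide +kernel

theorem check_codes10 :
    check ⟨16, 2, true⟩ clauseTable [63, 151, 246, 330] codes10 189 = true := by
  decide +kernel

theorem check_codes11 :
    check ⟨16, 2, true⟩ clauseTable [63, 151, 246, 330] codes11 201 = true := by
  decide +kernel

theorem check_codes12 :
    check ⟨16, 2, true⟩ clauseTable [63, 151, 246, 330] codes12 219 = true := by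
  decide +kernel

theorem check_codes13 :
    check ⟨16, 2, true⟩ clauseTable [63, 151, 246, 330] codes13 236 = true := by
  decide +kernel

theorem check_codes14 :
    check ⟨16, 2, true⟩ clauseTable [63, 151, 246, 330] codes14 256 = true := by
  decide +kernel

theorem check_codes15 :
    check ⟨16, 2, true⟩ clauseTable [63, 151, 246, 330] codes15 273 = true := by
  decide +kernel

theorem check_codes16 :
    check ⟨16, 2, true⟩ clauseTable [63, 151, 246, 330] codes16 296 = true := by
  decide +kernel

theorem check_codes17 :
    check ⟨16, 2, true⟩ clauseTable [63, 151, 246, 330] codes17 315 = true := by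
  decide +kernel

theorem check_codes18 :
    check ⟨16, 2, true⟩ clauseTable [63, 151, 246, 330] codes18 329 = true := by
  decide +kernel

theorem check_codes19 :
    check ⟨16, 2, true⟩ clauseTable [63, 151, 246, 330] codes19 353 = true := by
  decide +kernel

theorem check_codes20 :
    check ⟨16, 2, true⟩ clauseTable [63, 151, 246, 330] codes20 373 = true := by
  decide +kernel

section

variable {V : Type*} [Fintype V] [DecidableEq V] {H : SimpleGraph V}

theorem clauseTable_valid (hP : Params.Holds ⟨16, 2, true⟩ H) (hcard : Fintype.card V = 16)
    (h0 : (Clause.mk 7 0 2097151).Valid H) :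
    ∀ i < 388, ∀ l, entry clauseTable i = some l → l.Valid H := by
  have hb : 64 + binom 16 6 ≤ 16384 := by decide
  have h : ∀ i < 1, ∀ l, entry clauseTable i = some l → l.Valid H := by
    intro i hi l hl
    obtain rfl : i = 0 := by omega
    obtain rfl : Clause.mk 7 0 2097151 = l := Option.some.inj hl
    exact h0
  replace h := valid_of_check hP hcard hb _ _ _ _ check_codes0 h
  replace h := valid_of_check hP hcard hb _ _ _ _ check_codes1 h
  replace h := valid_of_check hP hcard hb _ _ _ _ check_codes2 h
  replace h := valid_of_check hP hcard hb _ _ _ _ check_codes3 h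
  replace h := valid_of_check hP hcard hb _ _ _ _ check_codes4 h
  replace h := valid_of_check hP hcard hb _ _ _ _ check_codes5 h
  replace h := valid_of_check hP hcard hb _ _ _ _ check_codes6 h
  replace h := valid_of_check hP hcard hb _ _ _ _ check_codes7 h
  replace h := valid_of_check hP hcard hb _ _ _ _ check_codes8 h
  replace h := valid_of_check hP hcard hb _ _ _ _ check_codes9 h
  replace h := valid_of_check hP hcard hb _ _ _ _ check_codes10 h
  replace h := valid_of_check hP hcard hb _ _ _ _ check_codes11 h
  replace h := valid_of_check hP hcard hb _ _ _ _ check_codes12 h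
  replace h := valid_of_check hP hcard hb _ _ _ _ check_codes13 h
  replace h := valid_of_check hP hcard hb _ _ _ _ check_codes14 h
  replace h := valid_of_check hP hcard hb _ _ _ _ check_codes15 h
  replace h := valid_of_check hP hcard hb _ _ _ _ check_codes16 h
  replace h := valid_of_check hP hcard hb _ _ _ _ check_codes17 h
  replace h := valid_of_check hP hcard hb _ _ _ _ check_codes18 h
  replace h := valid_of_check hP hcard hb _ _ _ _ check_codes19 h
  replace h := valid_of_check hP hcard hb _ _ _ _ check_codes20 h
  exact h

theorem valid_of_check_single {P : Params} (hP : P.Holds H) (hcard : Fintype.card V = P.n)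
    (hb : 64 + binom P.n 6 ≤ 16384) {c d : Clause} {code : ℕ}
    (h : check P [[c, d]] [] [code] 1 = true) (hc : c.Valid H) : d.Valid H := by
  refine valid_of_check hP hcard hb _ _ _ _ h (fun i hi l hl => ?_) 1 (by simp) d rfl
  obtain rfl : i = 0 := by omega
  obtain rfl : c = l := Option.some.inj hl
  exact hc

end

theorem check_triangle_cycle : check ⟨16, 2, false⟩
    [[⟨7, 0, 2097151⟩, ⟨16, 996941279248441782774227538556240421, 0⟩]] []
    [139633585842019938496127941617280501678685646389142838570282262499962882740533493519318454335780665331441183603080189313270849052862823320390588451580701278353400212330729069976310068940366462448715427919389573271408028721518993281004412153146803147332930997838754604236802635571062023299321809233376791665458737244783209758424915013985899998606859539976890910417761923090856113288477695]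
    1 = true := by
  decide +kernel

theorem check_cycle17 : check ⟨17, 3, false⟩
    [[⟨8, 0, 268435455⟩, ⟨17, 43558136828157448391964900238080158482981, 0⟩]] []
    [3673560701670288475687466140666525839867840689090922677514103908108823]
    1 = true := by
  decide +kernel

theorem check_cycle15_matching : check ⟨17, 3, false⟩
    [[⟨8, 0, 268435455⟩, ⟨17, 43556142986166246898234115288039536214565, 0⟩]] []
    [1903200169901745236850775961828631188730731789560292356512975855564216498040354947859956932840390186048667544999091891393916033402933070050192370646986330227651795879604193693550285627316065751991457424370412680942032664373485561331128088845517735059505047841]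
    1 = true := by
  decide +kernel

theorem check_cycle13_matching : check ⟨17, 3, false⟩
    [[⟨8, 0, 268435455⟩, ⟨17, 43556142986162533078190046123509677048357, 0⟩]] []
    [40928478793310715649270969432523992204680198629542160283226837191230358236404958831731732561263231374083031906247270823162661423215928733761908207630755933396524829854798375745958927734654567998346419259168106011133734023447664169126416467222389973591969634160285539912059319924916002225553816385780265717460774152422546138554265906921955589060862996236696602634627764067154024998749795645332999890822635830832305459291195105677502110535251647137020607070570061783563581086757448955293298500085174911799958884221087124329873767300437931971314408318842555822254874100692872713799442339596273175294104651503046718450098775681206720812996414811354633098106648782176236310087548588617416811808331388768011040927086624808335757213743191506669616323791720875999886788250183196639785697624205533010606333051641486725491593723788020703040378644461514335720933399424907862377969270429010850906548976360855898247450497754708699]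
    1 = true := by
  decide +kernel

end IndepCert

namespace Stabbing

open Finset

variable {V : Type*} {H : SimpleGraph V}

/-- Some `r` cliques meet every independent subset of `W` with more than `N` elements. -/
def Stab (H : SimpleGraph V) (W : Finset V) (N r : ℕ) : Prop :=
  ∃ L : List (Finset V), L.length = r ∧ (∀ C ∈ L, H.IsClique (C : Set V)) ∧
    ∀ I ⊆ W, H.IsIndepSet (I : Set V) → (∀ C ∈ L, Disjoint C I) → I.card ≤ N

/-- The independent subsets of `W` have at most `N` elements. -/
def IndepLE (H : SimpleGraph V) (W : Finset V) (N : ℕ) : Prop :=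
  ∀ I ⊆ W, H.IsIndepSet (I : Set V) → I.card ≤ N

theorem stab_zero_iff {W : Finset V} {N : ℕ} : Stab H W N 0 ↔ IndepLE H W N := by
  constructor
  · rintro ⟨L, hL, -, h⟩ I hI hi
    obtain rfl := List.length_eq_zero_iff.1 hL
    exact h I hI hi (by simp)
  · exact fun h => ⟨[], rfl, by simp, fun I hI hi _ => h I hI hi⟩

theorem Stab.mono {W W' : Finset V} {N N' r r' : ℕ} (h : Stab H W N r) (hW : W' ⊆ W)
    (hN : N ≤ N') (hr : r ≤ r') : Stab H W' N' r' := by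
  obtain ⟨L, hL, hc, h⟩ := h
  refine ⟨L ++ List.replicate (r' - r) ∅, by simp; omega, ?_, fun I hI hi hd =>
    (h I (hI.trans hW) hi fun C hC => hd C (by simp [hC])).trans hN⟩
  intro C hC
  rcases List.mem_append.1 hC with hC | hC
  · exact hc C hC
  · rw [List.eq_of_mem_replicate hC]
    simp

theorem Stab.union [DecidableEq V] {W W' : Finset V} {N N' r r' : ℕ} (h : Stab H W N r)
    (h' : Stab H W' N' r') : Stab H (W ∪ W') (N + N') (r + r') := by
  obtain ⟨L, hL, hc, h⟩ := h
  obtain ⟨L', hL', hc', h'⟩ := h'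
  refine ⟨L ++ L', by simp [hL, hL'], fun C hC => (List.mem_append.1 hC).elim (hc C) (hc' C),
    fun I hI hi hd => ?_⟩
  have h1 := h (I ∩ W) inter_subset_right (hi.mono (by simp)) fun C hC =>
    (hd C (by simp [hC])).mono_right inter_subset_left
  have h2 := h' (I ∩ W') inter_subset_right (hi.mono (by simp)) fun C hC =>
    (hd C (by simp [hC])).mono_right inter_subset_left
  calc I.card = ((I ∩ W) ∪ (I ∩ W')).card := by
        rw [← inter_union_distrib_left, inter_eq_left.2 hI]
    _ ≤ _ := (card_union_le _ _).trans (by omega)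

theorem stab_clique {C : Finset V} (hC : H.IsClique (C : Set V)) : Stab H C 0 1 := by
  refine ⟨[C], rfl, by simpa, fun I hI _ hd => ?_⟩
  have : Disjoint C I := hd C (by simp)
  rw [Nat.le_zero, card_eq_zero]
  exact Finset.disjoint_self_iff_empty I |>.1 (this.mono_left hI)

theorem indepLE_clique {C : Finset V} (hC : H.IsClique (C : Set V)) : IndepLE H C 1 := by
  refine fun I hI hi => card_le_one.2 fun a ha b hb => ?_
  by_contra hab
  exact hi ha hb hab (hC (hI ha) (hI hb) hab)

theorem Stab.of_sdiff [DecidableEq V] {W C : Finset V} {N r : ℕ} (hC : H.IsClique (C : Set V))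
    (h : Stab H (W \ C) N r) : Stab H W N (r + 1) := by
  have := h.union (stab_clique hC)
  exact this.mono (by intro x; simp; tauto) le_rfl le_rfl

theorem unstabbed_of_not_stab [Fintype V] {N r : ℕ} (h : ¬ Stab H univ N r) :
    IndepCert.Unstabbed H (N + 1) r := by
  intro L hL hc
  by_contra! hI
  refine h ⟨L, hL, hc, fun I _ hi hd => ?_⟩
  by_contra! hcard
  obtain ⟨J, hJI, hJ⟩ := exists_subset_card_eq (Nat.succ_le_of_lt hcard)
  obtain ⟨C, hC, hCJ⟩ := hI J ⟨hi.mono (by simpa using hJI), hJ⟩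
  exact hCJ ((hd C hC).mono_right hJI)

theorem IndepLE.mono {W W' : Finset V} {N N' : ℕ} (h : IndepLE H W N) (hW : W' ⊆ W)
    (hN : N ≤ N') : IndepLE H W' N' := fun I hI hi => (h I (hI.trans hW) hi).trans hN

theorem isClique_pair [DecidableEq V] {a b : V} (h : H.Adj a b) :
    H.IsClique (({a, b} : Finset V) : Set V) := by
  intro x hx y hy hxy
  simp only [coe_insert, coe_singleton, Set.mem_insert_iff, Set.mem_singleton_iff] at hx hy
  rcases hx with rfl | rfl <;> rcases hy with rfl | rfl
  exacts [absurd rfl hxy, h, h.symm, absurd rfl hxy]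

section Neighbors

open Classical in
/-- The vertices of `W` with a neighbor in `A`. -/
def nbr (H : SimpleGraph V) (W A : Finset V) : Finset V := W.filter fun v => ∃ a ∈ A, H.Adj a v

theorem mem_nbr {W A : Finset V} {v : V} : v ∈ nbr H W A ↔ v ∈ W ∧ ∃ a ∈ A, H.Adj a v := by
  simp [nbr]

theorem nbr_mono {W A B : Finset V} (h : A ⊆ B) : nbr H W A ⊆ nbr H W B := fun v hv => by
  obtain ⟨hv, a, ha, hav⟩ := mem_nbr.1 hv
  exact mem_nbr.2 ⟨hv, a, h ha, hav⟩

/-- `W` is nonempty, has independent sets with `a` elements, and every nonempty independent set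
has more neighbors than elements. -/
def Expanding (H : SimpleGraph V) (W : Finset V) : Prop :=
  ∀ A ⊆ W, A.Nonempty → H.IsIndepSet (A : Set V) → A.card + 1 ≤ (nbr H W A).card

variable [DecidableEq V]

/-- If a nonempty independent set has too few neighbors, then one edge or vertex meets every
maximum independent set. -/
theorem exists_clique_or_expanding {W : Finset V} {a : ℕ} (ha : IndepLE H W (a + 1)) :
    (∃ Q ⊆ W, Q.Nonempty ∧ H.IsClique (Q : Set V) ∧ IndepLE H (W \ Q) a) ∨ Expanding H W := by
  by_cases hE : Expanding H W
  · exact Or.inr hE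
  left
  have hex : ∃ n, ∃ A ⊆ W, A.Nonempty ∧ H.IsIndepSet (A : Set V) ∧ (nbr H W A).card ≤ A.card ∧
      A.card = n := by
    unfold Expanding at hE
    push Not at hE
    obtain ⟨A, h1, h2, h3, h4⟩ := hE
    exact ⟨_, A, h1, h2, h3, by omega, rfl⟩
  classical
  obtain ⟨A, hAW, hA, hAi, hAn, hAc⟩ := Nat.find_spec hex
  have hmin : ∀ B ⊂ A, B.Nonempty → B.card + 1 ≤ (nbr H W B).card := by
    intro B hB hBn
    by_contra! h
    exact Nat.find_min hex (m := B.card) (hAc ▸ card_lt_card hB)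
      ⟨B, hB.subset.trans hAW, hBn, hAi.mono (by simpa using hB.subset), by omega, rfl⟩
  have hdis : Disjoint A (nbr H W A) := by
    rw [disjoint_left]
    intro v hv hvn
    obtain ⟨-, b, hb, hbv⟩ := mem_nbr.1 hvn
    exact hAi hb hv hbv.ne hbv
  have key : ∀ I ⊆ W, H.IsIndepSet (I : Set V) → I.card = a + 1 → A ⊆ I ∨ nbr H W A ⊆ I := by
    intro I hI hi hcard
    have hJ : H.IsIndepSet (((I \ nbr H W A) ∪ A : Finset V) : Set V) := by
      intro x hx y hy hxy hadj
      simp only [coe_union, coe_sdiff, Set.mem_union, Set.mem_sdiff, mem_coe] at hx hy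
      rcases hx with ⟨hx, hx'⟩ | hx <;> rcases hy with ⟨hy, hy'⟩ | hy
      · exact hi hx hy hxy hadj
      · exact hx' (mem_nbr.2 ⟨hI hx, y, hy, hadj.symm⟩)
      · exact hy' (mem_nbr.2 ⟨hI hy, x, hx, hadj⟩)
      · exact hAi hx hy hxy hadj
    have h1 := ha _ (union_subset (sdiff_subset.trans hI) hAW) hJ
    have h2 : ((I \ nbr H W A) ∪ A).card = (I \ nbr H W A).card + (A \ I).card := by
      rw [← card_union_of_disjoint]
      · congr 1
        ext x
        have : x ∈ A → x ∉ nbr H W A := fun h => disjoint_left.1 hdis h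
        simp
        tauto
      · exact disjoint_left.2 fun x hx hx' => (mem_sdiff.1 hx').2 (mem_sdiff.1 hx).1
    have h3 := card_sdiff_add_card_inter I (nbr H W A)
    have h4 := card_sdiff_add_card_inter A I
    have h5 : nbr H W (A ∩ I) ⊆ nbr H W A \ I := by
      intro v hv
      refine mem_sdiff.2 ⟨nbr_mono inter_subset_left hv, fun hvI => ?_⟩
      obtain ⟨-, b, hb, hbv⟩ := mem_nbr.1 hv
      exact hi (mem_inter.1 hb).2 hvI hbv.ne hbv
    have h6 := card_le_card h5
    have h7 := card_sdiff_add_card_inter (nbr H W A) I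
    rw [inter_comm] at h7
    by_cases hne : (A ∩ I).Nonempty
    · left
      by_contra hns
      have := hmin (A ∩ I) ⟨inter_subset_left, fun h => hns (h.trans inter_subset_right)⟩ hne
      omega
    · right
      rw [not_nonempty_iff_eq_empty] at hne
      rw [hne, card_empty] at h4
      have h8 : (nbr H W A \ I).card = 0 := by omega
      rw [card_eq_zero, sdiff_eq_empty_iff_subset] at h8
      exact h8
  have reduce : ∀ Q ⊆ W, Q.Nonempty → H.IsClique (Q : Set V) →
      (∀ I ⊆ W, A ⊆ I ∨ nbr H W A ⊆ I → ¬ Disjoint Q I) → 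
      ∃ Q ⊆ W, Q.Nonempty ∧ H.IsClique (Q : Set V) ∧ IndepLE H (W \ Q) a := by
    refine fun Q hQ hQn hQc h => ⟨Q, hQ, hQn, hQc, fun I hI hi => ?_⟩
    have hIW := hI.trans sdiff_subset
    have := ha I hIW hi
    by_contra! hlt
    exact h I hIW (key I hIW hi (by omega))
      (disjoint_left.2 fun x hx hxI => (mem_sdiff.1 (hI hxI)).2 hx)
  obtain ⟨v, hv⟩ := hA
  by_cases hN : (nbr H W A).Nonempty
  · obtain ⟨u, hu⟩ := hN
    obtain ⟨huW, b, hb, hbu⟩ := mem_nbr.1 hu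
    refine reduce {b, u} ?_ ⟨b, by simp⟩ (isClique_pair hbu) ?_
    · intro x hx
      rcases mem_insert.1 hx with rfl | hx
      · exact hAW hb
      · rwa [mem_singleton.1 hx]
    · rintro I - (h | h) hd
      · exact disjoint_left.1 hd (mem_insert_self b _) (h hb)
      · exact disjoint_left.1 hd (mem_insert_of_mem (mem_singleton_self u)) (h hu)
  · rw [not_nonempty_iff_eq_empty] at hN
    refine ⟨{v}, by simpa using hAW hv, ⟨v, by simp⟩, by simp, fun I hI hi => ?_⟩
    have hIW := hI.trans sdiff_subset
    have hvI : v ∉ I := fun h => by simpa using (mem_sdiff.1 (hI h)).2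
    have hJ : H.IsIndepSet ((insert v I : Finset V) : Set V) := by
      have hnone : ∀ x ∈ I, ¬ H.Adj v x := fun x hx hadj => by
        have : x ∈ nbr H W A := mem_nbr.2 ⟨hIW hx, v, hv, hadj⟩
        simp [hN] at this
      intro x hx y hy hxy hadj
      rw [coe_insert, Set.mem_insert_iff, mem_coe] at hx hy
      rcases hx with rfl | hx <;> rcases hy with rfl | hy
      exacts [hxy rfl, hnone _ hy hadj, hnone _ hx hadj.symm, hi hx hy hxy hadj]
    have := ha (insert v I) (insert_subset (hAW hv) hIW) hJ
    rw [card_insert_of_notMem hvI] at this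
    omega

end Neighbors

end Stabbing

namespace Stabbing

open Finset

variable {V : Type*} {H : SimpleGraph V}

/-- Independent subsets of `W` have at least as many neighbors in `W` as elements. -/
def HallCond (H : SimpleGraph V) (W : Finset V) : Prop :=
  ∀ A ⊆ W, H.IsIndepSet (A : Set V) → A.card ≤ (nbr H W A).card

theorem Expanding.hallCond {W : Finset V} (h : Expanding H W) : HallCond H W := by
  intro A hA hi
  rcases A.eq_empty_or_nonempty with rfl | hne
  · simp
  · have := h A hA hne hi
    omega

theorem Expanding.hallCond_erase [DecidableEq V] {W : Finset V} (h : Expanding H W) (w : V) :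
    HallCond H (W.erase w) := by
  intro A hA hi
  rcases A.eq_empty_or_nonempty with rfl | hne
  · simp
  · have h1 := h A (hA.trans (erase_subset _ _)) hne hi
    have h2 : nbr H W A ⊆ insert w (nbr H (W.erase w) A) := by
      intro v hv
      obtain ⟨hv, ha⟩ := mem_nbr.1 hv
      rw [mem_insert]
      by_cases hvw : v = w
      · exact Or.inl hvw
      · exact Or.inr (mem_nbr.2 ⟨mem_erase.2 ⟨hvw, hv⟩, ha⟩)
    have h3 := (card_le_card h2).trans (card_insert_le _ _)
    omega

/-- A closed walk `c` of length `L` without repetitions. -/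
structure Cyc (H : SimpleGraph V) (L : ℕ) (c : ℕ → V) : Prop where
  adj : ∀ i, H.Adj (c i) (c (i + 1))
  eq_iff : ∀ i j, c i = c j ↔ i ≡ j [MOD L]

theorem Cyc.rotate {L : ℕ} {c : ℕ → V} (h : Cyc H L c) (a : ℕ) : Cyc H L fun i => c (a + i) :=
  ⟨fun i => h.adj (a + i), fun _ _ => (h.eq_iff _ _).trans
    ⟨Nat.ModEq.add_left_cancel' a, Nat.ModEq.add_left a⟩⟩

theorem Cyc.injOn {L : ℕ} {c : ℕ → V} (h : Cyc H L c) : Set.InjOn c (Set.Iio L) :=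
  fun _ hi _ hj hij => ((h.eq_iff _ _).1 hij).eq_of_lt_of_lt hi hj

theorem Cyc.last {L : ℕ} {c : ℕ → V} (h : Cyc H (L + 1) c) : H.Adj (c L) (c 0) := by
  have h1 := h.adj L
  rwa [(h.eq_iff (L + 1) 0).2 (by simp [Nat.ModEq])] at h1

/-- `M` is a perfect matching on `P`. -/
def Matching (H : SimpleGraph V) (P : Finset V) (M : V → V) : Prop :=
  ∀ x ∈ P, M x ∈ P ∧ M (M x) = x ∧ H.Adj x (M x)

variable [DecidableEq V]

theorem Matching.insert {P : Finset V} {M : V → V} (h : Matching H P M) {a b : V} (ha : a ∉ P)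
    (hb : b ∉ P) (hab : H.Adj a b) :
    Matching H (insert a (insert b P)) (Function.update (Function.update M a b) b a) := by
  have hne := hab.ne
  intro x hx
  rw [mem_insert, mem_insert] at hx
  rcases hx with rfl | rfl | hx
  · simp [Function.update_of_ne hne, hab]
  · simp [Function.update_of_ne hne, hab.symm]
  · have hxa : x ≠ a := fun h => ha (h ▸ hx)
    have hxb : x ≠ b := fun h => hb (h ▸ hx)
    obtain ⟨h1, h2, h3⟩ := h x hx
    have hya : M x ≠ a := fun h => ha (h ▸ h1)
    have hyb : M x ≠ b := fun h => hb (h ▸ h1)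
    rw [Function.update_of_ne hxb, Function.update_of_ne hxa, Function.update_of_ne hyb,
      Function.update_of_ne hya]
    exact ⟨mem_insert_of_mem (mem_insert_of_mem h1), h2, h3⟩

theorem Matching.erase {P : Finset V} {M : V → V} (h : Matching H P M) {x : V} (hx : x ∈ P) :
    Matching H ((P.erase x).erase (M x)) M := by
  intro y hy
  obtain ⟨hy1, hy2, hy⟩ := by simpa using hy
  obtain ⟨h1, h2, h3⟩ := h y hy
  refine ⟨?_, h2, h3⟩
  simp only [mem_erase]
  refine ⟨fun h' => hy2 ?_, fun h' => hy1 ?_, h1⟩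
  · rw [← h2, h', (h x hx).2.1]
  · rw [← h', h2]

/-- `U` is the disjoint union of cycles of lengths `2 k + 1`, where `k` runs through `ks`. -/
inductive OddCycles (H : SimpleGraph V) : Finset V → List ℕ → Prop
  | nil : OddCycles H ∅ []
  | cons {U : Finset V} {ks : List ℕ} {k : ℕ} {c : ℕ → V} (hU : OddCycles H U ks)
      (hc : Cyc H (2 * k + 1) c) (hk : 1 ≤ k) (hd : Disjoint ((range (2 * k + 1)).image c) U) :
      OddCycles H ((range (2 * k + 1)).image c ∪ U) (k :: ks)

theorem exists_matching_path (m : ℕ) (c : ℕ → V) (hadj : ∀ i, H.Adj (c i) (c (i + 1)))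
    (hinj : Set.InjOn c (Set.Iio (2 * m))) {P : Finset V} {M : V → V} (hM : Matching H P M)
    (hd : Disjoint ((range (2 * m)).image c) P) :
    ∃ M, Matching H ((range (2 * m)).image c ∪ P) M := by
  induction m with
  | zero => exact ⟨M, by simpa⟩
  | succ m ih =>
    obtain ⟨M', hM'⟩ := ih (hinj.mono fun x hx => by simp at *; omega)
      (hd.mono_left (image_subset_image fun x hx => by simp at *; omega))
    have hn : ∀ i, 2 * m ≤ i → i < 2 * m + 2 → c i ∉ (range (2 * m)).image c ∪ P := by
      intro i hi hi' hmem
      rcases mem_union.1 hmem with hmem | hmem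
      · obtain ⟨j, hj, hji⟩ := mem_image.1 hmem
        have hj := mem_range.1 hj
        have := hinj (show j < 2 * (m + 1) by omega) (show i < 2 * (m + 1) by omega) hji
        omega
      · exact disjoint_left.1 hd (mem_image_of_mem c (mem_range.2 (show i < 2 * (m + 1) by omega)))
          hmem
    refine ⟨Function.update (Function.update M' (c (2 * m + 1)) (c (2 * m))) (c (2 * m))
      (c (2 * m + 1)), ?_⟩
    · rw [show 2 * (m + 1) = 2 * m + 1 + 1 by ring, range_add_one, range_add_one, image_insert,
        image_insert, insert_union, insert_union]
      exact hM'.insert (hn _ (by omega) (by omega)) (hn _ (by omega) (by omega)) (hadj _).symm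

theorem exists_factor_aux (σ : V → V) (n : ℕ) (W : Finset V) (hn : W.card = n)
    (hmaps : ∀ x ∈ W, σ x ∈ W) (hinj : Set.InjOn σ W) (hadj : ∀ x ∈ W, H.Adj x (σ x)) :
    ∃ P U M ks, W = P ∪ U ∧ Disjoint P U ∧ Matching H P M ∧ OddCycles H U ks := by
  induction n using Nat.strong_induction_on generalizing W with
  | _ n ih =>
  rcases W.eq_empty_or_nonempty with rfl | ⟨x, hx⟩
  · exact ⟨∅, ∅, id, [], by simp, by simp, by simp [Matching], .nil⟩
  have hit : ∀ i, σ^[i] x ∈ W := fun i => by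
    induction i with
    | zero => exact hx
    | succ i ih => rw [Function.iterate_succ_apply']; exact hmaps _ ih
  have hback : ∀ i j, σ^[i] x = σ^[i + j] x → σ^[j] x = x := by
    intro i j
    induction i with
    | zero => simpa using fun h => h.symm
    | succ i ih =>
      rw [show i + 1 + j = i + j + 1 by ring, Function.iterate_succ_apply',
        Function.iterate_succ_apply']
      exact fun h => ih (hinj (hit _) (hit _) h)
  have hper : x ∈ Function.periodicPts σ := by
    obtain ⟨i, j, hij, h⟩ := Finite.exists_ne_map_eq_of_infinite
      fun i : ℕ => (⟨σ^[i] x, hit i⟩ : W)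
    rw [Subtype.mk.injEq] at h
    rcases lt_or_gt_of_ne hij with hij | hij
    · obtain ⟨k, rfl⟩ := Nat.exists_eq_add_of_lt hij
      exact ⟨k + 1, by omega, hback i (k + 1) h⟩
    · obtain ⟨k, rfl⟩ := Nat.exists_eq_add_of_lt hij
      exact ⟨k + 1, by omega, hback j (k + 1) h.symm⟩
  have hLpos := Function.minimalPeriod_pos_of_mem_periodicPts hper
  obtain ⟨L, hL⟩ : ∃ L, L = Function.minimalPeriod σ x := ⟨_, rfl⟩
  rw [← hL] at hLpos
  have hper' : Function.IsPeriodicPt σ L x := hL ▸ Function.isPeriodicPt_minimalPeriod σ x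
  have hcyc : Cyc H L fun i => σ^[i] x := by
    refine ⟨fun i => ?_, fun i j => ?_⟩
    · simp only [Function.iterate_succ_apply']
      exact hadj _ (hit i)
    · have hmod : ∀ i, σ^[i] x = σ^[i % L] x := fun i => (hper'.iterate_mod_apply i).symm
      rw [hmod i, hmod j]
      constructor
      · intro h
        refine Function.iterate_injOn_Iio_minimalPeriod (f := σ) (x := x) ?_ ?_ h
        · rw [← hL]; exact Nat.mod_lt _ hLpos
        · rw [← hL]; exact Nat.mod_lt _ hLpos
      · exact fun h => by rw [show i % L = j % L from h]
  have hL2 : 2 ≤ L := by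
    by_contra! h
    obtain rfl : L = 1 := by omega
    exact (hadj x hx).ne ((hcyc.eq_iff 0 1).2 (Nat.modEq_one))
  set O := (range L).image fun i => σ^[i] x with hO
  have hmemO : ∀ i, σ^[i] x ∈ O := fun i => by
    rw [hO, mem_image]
    exact ⟨i % L, mem_range.2 (Nat.mod_lt _ hLpos), hper'.iterate_mod_apply i⟩
  have hOW : O ⊆ W := by
    intro y hy
    obtain ⟨i, -, rfl⟩ := mem_image.1 hy
    exact hit i
  obtain ⟨P, U, M, ks, hPU, hd, hM, hU⟩ := ih (W \ O).card (by
      rw [← hn]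
      exact card_lt_card ⟨sdiff_subset, fun h => (mem_sdiff.1 (h hx)).2 (hmemO 0)⟩) (W \ O) rfl
    (fun y hy => by
      obtain ⟨hy, hyO⟩ := mem_sdiff.1 hy
      refine mem_sdiff.2 ⟨hmaps y hy, fun h => hyO ?_⟩
      obtain ⟨i, -, hi⟩ := mem_image.1 h
      have h1 : σ (σ^[i + (L - 1)] x) = σ y := by
        rw [← hi, ← Function.iterate_succ_apply' σ]
        exact (hcyc.eq_iff _ _).2 (by
          rw [show (i + (L - 1)).succ = i + L by omega]
          simp)
      rw [← hinj (hit _) hy h1]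
      exact hmemO _)
    (hinj.mono (by simp)) (fun y hy => hadj y (mem_sdiff.1 hy).1)
  have hWO : W = O ∪ (P ∪ U) := by rw [← hPU, union_sdiff_of_subset hOW]
  have hOPU : Disjoint O (P ∪ U) := hPU ▸ disjoint_sdiff
  rw [disjoint_union_right] at hOPU
  rcases Nat.even_or_odd' L with ⟨m, hm | hm⟩
  · obtain ⟨M', hM'⟩ := exists_matching_path m (fun i => σ^[i] x) hcyc.adj (hm ▸ hcyc.injOn) hM
      (by rw [← hm]; exact hOPU.1)
    rw [← hm] at hM'
    exact ⟨O ∪ P, U, M', ks, by rw [hWO, union_assoc], disjoint_union_left.2 ⟨hOPU.2, hd⟩, hM', hU⟩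
  · have h1 := hU.cons (hm ▸ hcyc) (by omega) (by rw [← hm]; exact hOPU.2)
    rw [← hm] at h1
    exact ⟨P, O ∪ U, M, _, by rw [hWO, union_left_comm], disjoint_union_right.2
      ⟨hOPU.1.symm, hd⟩, hM, h1⟩

/-- Under Hall's condition, there is a spanning subgraph made of edges and odd cycles. -/
theorem HallCond.exists_factor {W : Finset V} (h : HallCond H W) :
    ∃ P U M ks, W = P ∪ U ∧ Disjoint P U ∧ Matching H P M ∧ OddCycles H U ks := by
  classical
  have hall : ∀ A ⊆ W, A.card ≤ (nbr H W A).card := by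
    intro A hA
    set B := A \ nbr H W A with hB
    have h1 := h B (sdiff_subset.trans hA) (by
      intro x hx y hy hxy hadj
      rw [mem_coe, hB, mem_sdiff] at hx hy
      exact hy.2 (mem_nbr.2 ⟨hA hy.1, x, hx.1, hadj⟩))
    have h2 : nbr H W B ⊆ nbr H W A \ A := by
      intro v hv
      refine mem_sdiff.2 ⟨nbr_mono sdiff_subset hv, fun hvA => ?_⟩
      obtain ⟨-, b, hb, hbv⟩ := mem_nbr.1 hv
      rw [hB, mem_sdiff] at hb
      exact hb.2 (mem_nbr.2 ⟨hA hb.1, v, hvA, hbv.symm⟩)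
    have h3 := card_le_card h2
    have h4 := card_sdiff_add_card_inter A (nbr H W A)
    have h5 := card_sdiff_add_card_inter (nbr H W A) A
    rw [inter_comm] at h5
    rw [← hB] at h4
    omega
  obtain ⟨f, hf, hf'⟩ := (Finset.all_card_le_biUnion_card_iff_exists_injective
    (fun x : W => nbr H W {x.1})).1 (by
      intro s
      refine le_trans ?_ ((hall (s.map (Function.Embedding.subtype _)) ?_).trans
        (card_le_card ?_))
      · rw [card_map]
      · intro v hv
        obtain ⟨x, -, rfl⟩ := mem_map.1 hv
        exact x.2
      · intro v hv
        obtain ⟨hv, a, ha, hav⟩ := mem_nbr.1 hv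
        obtain ⟨x, hx, rfl⟩ := mem_map.1 ha
        exact mem_biUnion.2 ⟨x, hx, mem_nbr.2 ⟨hv, _, mem_singleton_self _, hav⟩⟩)
  refine exists_factor_aux (fun v => if hv : v ∈ W then f ⟨v, hv⟩ else v) _ W rfl ?_ ?_ ?_
  · intro x hx
    simp only [hx, dif_pos]
    exact (mem_nbr.1 (hf' ⟨x, hx⟩)).1
  · intro x hx y hy hxy
    simp only [mem_coe.1 hx, mem_coe.1 hy, dif_pos] at hxy
    simpa using hf hxy
  · intro x hx
    simp only [hx, dif_pos]
    obtain ⟨-, a, ha, hax⟩ := mem_nbr.1 (hf' ⟨x, hx⟩)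
    rwa [mem_singleton.1 ha] at hax

end Stabbing

namespace Stabbing

open Finset

variable {V : Type*} {H : SimpleGraph V}

/-- For `j ≤ c`, some `j` cliques meet the independent subsets of `W` with more than `N - j`
elements. -/
def Good (H : SimpleGraph V) (W : Finset V) (N c : ℕ) : Prop :=
  c ≤ N ∧ ∀ j ≤ c, Stab H W (N - j) j

theorem Good.indepLE {W : Finset V} {N c : ℕ} (h : Good H W N c) : IndepLE H W N :=
  stab_zero_iff.1 (h.2 0 (Nat.zero_le _))

theorem good_empty : Good H ∅ 0 0 :=
  ⟨le_rfl, fun j hj => by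
    obtain rfl := Nat.le_zero.1 hj
    exact stab_zero_iff.2 fun I hI _ => by simp [subset_empty.1 hI]⟩

theorem good_clique {C : Finset V} (hC : H.IsClique (C : Set V)) : Good H C 1 1 := by
  refine ⟨le_rfl, fun j hj => ?_⟩
  rcases Nat.le_one_iff_eq_zero_or_eq_one.1 hj with rfl | rfl
  · exact stab_zero_iff.2 (indepLE_clique hC)
  · exact stab_clique hC

variable [DecidableEq V]

theorem IndepLE.union {W W' : Finset V} {N N' : ℕ} (h : IndepLE H W N) (h' : IndepLE H W' N') :
    IndepLE H (W ∪ W') (N + N') :=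
  stab_zero_iff.1 ((stab_zero_iff.2 h).union (stab_zero_iff.2 h'))

theorem Good.union {W W' : Finset V} {N N' c c' : ℕ} (h : Good H W N c) (h' : Good H W' N' c') :
    Good H (W ∪ W') (N + N') (c + c') := by
  obtain ⟨h1, h2⟩ := h
  obtain ⟨h1', h2'⟩ := h'
  refine ⟨by omega, fun j hj => ?_⟩
  exact ((h2 (min j c) (min_le_right _ _)).union (h2' (j - min j c) (by omega))).mono
    Subset.rfl (by omega) (by omega)

theorem Matching.good {P : Finset V} {M : V → V} (h : Matching H P M) :
    ∃ m, P.card = 2 * m ∧ Good H P m m := by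
  induction hn : P.card using Nat.strong_induction_on generalizing P with
  | _ n ih =>
  rcases P.eq_empty_or_nonempty with rfl | ⟨x, hx⟩
  · exact ⟨0, by simpa using hn.symm, good_empty⟩
  obtain ⟨h1, h2, h3⟩ := h x hx
  have h4 : M x ∈ P.erase x := mem_erase.2 ⟨h3.ne', h1⟩
  have hc1 := card_erase_add_one hx
  have hc2 := card_erase_add_one h4
  obtain ⟨m, hm, hg⟩ := ih _ (by omega) (h.erase hx) rfl
  refine ⟨m + 1, by omega, ?_⟩
  have := hg.union (good_clique (isClique_pair h3))
  rwa [show (P.erase x).erase (M x) ∪ {x, M x} = P by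
    ext y
    simp only [mem_union, mem_erase, mem_insert, mem_singleton]
    constructor
    · rintro (h | rfl | rfl)
      exacts [h.2.2, hx, h1]
    · tauto] at this

theorem good_path (m : ℕ) (c : ℕ → V) (hadj : ∀ i, H.Adj (c i) (c (i + 1))) :
    Good H ((range (2 * m)).image c) m m := by
  induction m with
  | zero => exact good_empty
  | succ m ih =>
    have := ih.union (good_clique (isClique_pair (hadj (2 * m))))
    rwa [show (range (2 * (m + 1))).image c = (range (2 * m)).image c ∪ {c (2 * m), c (2 * m + 1)}
      by
        rw [show 2 * (m + 1) = 2 * m + 1 + 1 by ring, range_add_one, range_add_one, image_insert,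
          image_insert]
        ext y
        simp only [mem_insert, mem_union, mem_singleton]
        tauto]

theorem Cyc.good {k : ℕ} {c : ℕ → V} (h : Cyc H (2 * k + 1) c) :
    Good H ((range (2 * k + 1)).image c) (k + 1) (k + 1) := by
  have := (good_path k c h.adj).union (good_clique (C := {c (2 * k)}) (H := H) (by simp))
  rwa [show (range (2 * k + 1)).image c = (range (2 * k)).image c ∪ {c (2 * k)} by
    rw [range_add_one, image_insert, union_comm]
    rfl]

theorem Cyc.mem {k : ℕ} {c : ℕ → V} (h : Cyc H (k + 1) c) (i : ℕ) :
    c i ∈ (range (k + 1)).image c :=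
  mem_image.2 ⟨i % (k + 1), mem_range.2 (Nat.mod_lt _ (Nat.succ_pos _)),
    (h.eq_iff _ _).2 (Nat.mod_modEq _ _)⟩

theorem Cyc.indepLE {k : ℕ} {c : ℕ → V} (h : Cyc H (2 * k + 1) c) :
    IndepLE H ((range (2 * k + 1)).image c) k := by
  intro I hI hi
  obtain ⟨a, ha⟩ : ∃ a, c a ∉ I := by
    by_contra! hall
    exact hi (hall 0) (hall 1) (h.adj 0).ne (h.adj 0)
  refine (good_path k (fun i => c (a + 1 + i)) (h.rotate (a + 1)).adj).indepLE I ?_ hi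
  intro v hv
  obtain ⟨i, -, rfl⟩ := mem_image.1 (hI hv)
  have h1 : c i = c (a + 1 + (i + (2 * k + 1) * (a + 1) - (a + 1)) % (2 * k + 1)) := by
    refine (h.eq_iff _ _).2 ?_
    have h2 : i + (2 * k + 1) * (a + 1) = a + 1 + (i + (2 * k + 1) * (a + 1) - (a + 1)) := by
      have : a + 1 ≤ (2 * k + 1) * (a + 1) := Nat.le_mul_of_pos_left _ (by omega)
      omega
    have h3 : i ≡ i + (2 * k + 1) * (a + 1) [MOD 2 * k + 1] := by simp [Nat.ModEq]
    rw [h2] at h3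
    exact h3.trans ((Nat.mod_modEq _ _).symm.add_left _)
  rw [mem_image]
  refine ⟨_, mem_range.2 ?_, h1.symm⟩
  have h4 := Nat.mod_lt (i + (2 * k + 1) * (a + 1) - (a + 1)) (show 2 * k + 1 > 0 by omega)
  by_contra h5
  have h6 : (i + (2 * k + 1) * (a + 1) - (a + 1)) % (2 * k + 1) = 2 * k := by omega
  rw [h6, show a + 1 + 2 * k = a + (2 * k + 1) by ring,
    (h.eq_iff (a + (2 * k + 1)) a).2 (by simp)] at h1
  exact ha (h1 ▸ hv)

theorem OddCycles.card_eq {U : Finset V} {ks : List ℕ} (h : OddCycles H U ks) :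
    U.card = 2 * ks.sum + ks.length := by
  induction h with
  | nil => rfl
  | cons hU hc hk hd ih =>
    rw [card_union_of_disjoint hd, ih, card_image_of_injOn (by simpa using hc.injOn), card_range,
      List.sum_cons, List.length_cons]
    ring

theorem OddCycles.pos {U : Finset V} {ks : List ℕ} (h : OddCycles H U ks) : ∀ k ∈ ks, 1 ≤ k := by
  induction h with
  | nil => simp
  | cons hU hc hk hd ih => simpa [hk] using ih

theorem OddCycles.indepLE {U : Finset V} {ks : List ℕ} (h : OddCycles H U ks) :
    IndepLE H U ks.sum := by
  induction h with
  | nil => exact good_empty.indepLE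
  | cons hU hc hk hd ih => exact hc.indepLE.union ih

theorem Cyc.good_union {k l : ℕ} {c d : ℕ → V} (hc : Cyc H (2 * k + 1) c)
    (hd : Cyc H (2 * l + 1) d) :
    Good H ((range (2 * k + 1)).image c ∪ (range (2 * l + 1)).image d) (k + l + 1) (k + 1) :=
  ⟨by omega, fun j hj => ((hc.good.2 j hj).union (stab_zero_iff.2 hd.indepLE)).mono
    Subset.rfl (by omega) le_rfl⟩

theorem OddCycles.good : ∀ {ks : List ℕ} {U : Finset V}, OddCycles H U ks → Even ks.length →
    ∃ N c, U.card = 2 * N ∧ N ≤ 2 * c ∧ Good H U N c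
  | [], U, h, _ => by
    cases h
    exact ⟨0, 0, rfl, le_rfl, good_empty⟩
  | [k], U, h, he => by simp at he
  | k :: l :: ks, _, .cons (c := c) (.cons (U := U) (c := d) hU hd hl hdd) hc hk hcd, he => by
    obtain ⟨N, n, h1, h2, h3⟩ := hU.good (by simpa [Nat.even_add_one] using he)
    have hcard := (OddCycles.cons (.cons hU hd hl hdd) hc hk hcd).card_eq
    have hcard' := hU.card_eq
    simp only [List.sum_cons, List.length_cons] at hcard
    rw [← union_assoc] at hcard ⊢
    rcases le_total l k with hkl | hkl
    · exact ⟨k + l + 1 + N, k + 1 + n, by omega, by omega, (hc.good_union hd).union h3⟩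
    · rw [union_comm (image c _)] at hcard ⊢
      exact ⟨l + k + 1 + N, l + 1 + n, by omega, by omega, (hd.good_union hc).union h3⟩

theorem HallCond.good {W : Finset V} {N : ℕ} (h : HallCond H W) (hN : W.card = 2 * N) :
    ∃ c, N ≤ 2 * c ∧ Good H W N c := by
  obtain ⟨P, U, M, ks, rfl, hd, hM, hU⟩ := h.exists_factor
  obtain ⟨m, hm, hP⟩ := hM.good
  rw [card_union_of_disjoint hd] at hN
  have hc := hU.card_eq
  obtain ⟨N', c, h1, h2, h3⟩ := hU.good (by rw [Nat.even_iff]; omega)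
  obtain rfl : N = m + N' := by omega
  exact ⟨m + c, by omega, hP.union h3⟩

theorem HallCond.stab {W : Finset V} {N j : ℕ} (h : HallCond H W) (hN : W.card = 2 * N)
    (hj : 2 * j ≤ N + 1) : Stab H W (N - j) j := by
  obtain ⟨c, h1, h2⟩ := h.good hN
  exact h2.2 j (by omega)

theorem Expanding.stab_odd {W : Finset V} {N j : ℕ} (h : Expanding H W) (hN : W.card = 2 * N + 1)
    (hj : 2 * j ≤ N + 1) : Stab H W (N - j) (j + 1) := by
  obtain ⟨w, hw⟩ := card_pos.1 (show 0 < W.card by omega)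
  have h1 := (h.hallCond_erase w).stab (N := N) (j := j) (by
    have := card_erase_add_one hw
    omega) hj
  rw [← sdiff_singleton_eq_erase] at h1
  exact h1.of_sdiff (by simp)

end Stabbing

namespace Stabbing

open Finset

/-- A result about graphs with `n` vertices extends to smaller vertex sets, by adding vertices
adjacent to everything. -/
theorem stab_of_card_le {n a N r : ℕ} (ha : 1 ≤ a)
    (h : ∀ (V : Type) [Fintype V] [DecidableEq V] (H : SimpleGraph V), Fintype.card V = n →
      IndepLE H univ a → Stab H univ N r)
    {V : Type} [DecidableEq V] (H : SimpleGraph V) (W : Finset V) (hn : W.card ≤ n)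
    (hW : IndepLE H W a) : Stab H W N r := by
  let H' : SimpleGraph (W ⊕ Fin (n - W.card)) :=
    { Adj := fun x y => x ≠ y ∧ ∀ a b : W, x = Sum.inl a → y = Sum.inl b → H.Adj a b
      symm := ⟨fun x y hxy => ⟨hxy.1.symm, fun a b ha hb => (hxy.2 b a hb ha).symm⟩⟩
      loopless := ⟨fun x hx => hx.1 rfl⟩ }
  have hadj : ∀ a b : W, H'.Adj (Sum.inl a) (Sum.inl b) ↔ H.Adj a b := fun a b => by
    constructor
    · exact fun h => h.2 a b rfl rfl
    · refine fun h => ⟨fun hab => h.ne (congrArg _ (Sum.inl.inj hab)), fun c d hc hd => ?_⟩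
      rwa [← Sum.inl.inj hc, ← Sum.inl.inj hd]
  obtain ⟨L, hL, hc, hs⟩ := h _ H' (by simp; omega) (by
    intro I _ hi
    by_cases hr : ∃ y, Sum.inr y ∈ I
    · obtain ⟨y, hy⟩ := hr
      refine le_trans (card_le_one.2 fun x hx z hz => ?_) ha
      have : ∀ w ∈ I, w = Sum.inr y := fun w hw => by
        by_contra hne
        exact hi hw hy hne ⟨hne, fun _ _ _ h => by cases h⟩
      rw [this x hx, this z hz]
    · have hI : I.card = (I.toLeft.map (Function.Embedding.subtype _)).card := by
        rw [card_map, ← card_toLeft_add_card_toRight (u := I)]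
        have : I.toRight = ∅ := by
          ext y
          simpa using fun h => hr ⟨y, h⟩
        simp [this]
      rw [hI]
      refine hW _ (fun v hv => ?_) ?_
      · obtain ⟨x, -, rfl⟩ := mem_map.1 hv
        exact x.2
      · intro u hu v hv huv hadj'
        obtain ⟨x, hx, rfl⟩ := mem_map.1 hu
        obtain ⟨y, hy, rfl⟩ := mem_map.1 hv
        exact hi (mem_toLeft.1 hx) (mem_toLeft.1 hy)
          (fun h => huv (congrArg _ (Sum.inl.inj h))) ((hadj x y).2 hadj'))
  refine ⟨L.map fun C => C.toLeft.map (Function.Embedding.subtype _), by simpa, ?_, ?_⟩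
  · intro C hC
    obtain ⟨C, hCL, rfl⟩ := List.mem_map.1 hC
    intro u hu v hv huv
    obtain ⟨x, hx, rfl⟩ := mem_map.1 hu
    obtain ⟨y, hy, rfl⟩ := mem_map.1 hv
    exact (hadj x y).1 (hc C hCL (mem_toLeft.1 hx) (mem_toLeft.1 hy)
      fun h => huv (congrArg _ (Sum.inl.inj h)))
  · intro I hI hi hd
    have h1 := hs ((I.subtype (· ∈ W)).map Function.Embedding.inl) (subset_univ _) ?_ ?_
    · rwa [card_map, card_subtype, filter_true_of_mem fun x hx => hI hx] at h1
    · intro u hu v hv huv hadj'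
      obtain ⟨x, hx, rfl⟩ := mem_map.1 hu
      obtain ⟨y, hy, rfl⟩ := mem_map.1 hv
      rw [mem_subtype] at hx hy
      exact hi hx hy (fun h => huv (congrArg _ (Subtype.ext h))) ((hadj x y).1 hadj')
    · intro C hC
      rw [disjoint_left]
      intro u huC hu
      obtain ⟨x, hx, rfl⟩ := mem_map.1 hu
      rw [mem_subtype] at hx
      exact disjoint_left.1 (hd _ (List.mem_map.2 ⟨C, hC, rfl⟩))
        (mem_map.2 ⟨x, mem_toLeft.2 huC, rfl⟩) hx

/-- Graphs with `r + 14` vertices and independence number at most `r + 4` have `r` cliques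
meeting all independent `6`-sets. -/
def AllStab (r : ℕ) : Prop :=
  ∀ (V : Type) [Fintype V] [DecidableEq V] (H : SimpleGraph V), Fintype.card V = r + 14 →
    IndepLE H univ (r + 4) → Stab H univ 5 r

variable {V : Type} [Fintype V] [DecidableEq V] {H : SimpleGraph V}

omit [Fintype V] in
theorem AllStab.stab {r : ℕ} (h : AllStab r) (W : Finset V) (hW : W.card ≤ r + 14)
    (hi : IndepLE H W (r + 4)) : Stab H W 5 r :=
  stab_of_card_le (by omega) h H W hW hi

theorem AllStab.stab_or_expanding {r : ℕ} (h : AllStab r) (hV : Fintype.card V = r + 15)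
    (hi : IndepLE H univ (r + 5)) :
    Stab H univ 5 (r + 1) ∨ (Expanding H univ ∧ r ≤ 4) := by
  have key : ∀ Q : Finset V, Q.Nonempty → H.IsClique (Q : Set V) →
      IndepLE H (univ \ Q) (r + 4) → Stab H univ 5 (r + 1) := by
    refine fun Q hQ hQc hQi => (h.stab (univ \ Q) ?_ hQi).of_sdiff hQc
    rw [card_sdiff_of_subset (subset_univ _), card_univ]
    have := hQ.card_pos
    omega
  rcases exists_clique_or_expanding hi with ⟨Q, -, hQ, hQc, hQi⟩ | hE
  · exact Or.inl (key Q hQ hQc hQi)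
  by_cases hA : IndepLE H univ (r + 4)
  · obtain ⟨v⟩ : Nonempty V := Fintype.card_pos_iff.1 (by omega)
    exact Or.inl (key {v} (by simp) (by simp) (hA.mono (subset_univ _) le_rfl))
  right
  refine ⟨hE, ?_⟩
  unfold IndepLE at hA
  push Not at hA
  obtain ⟨A, -, hAi, hAc⟩ := hA
  have h1 := hE A (subset_univ _) (card_pos.1 (by omega)) hAi
  have h2 : Disjoint A (nbr H univ A) := by
    rw [disjoint_left]
    intro v hv hvn
    obtain ⟨-, b, hb, hbv⟩ := mem_nbr.1 hvn
    exact hAi hb hv hbv.ne hbv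
  have h3 := card_le_univ (A ∪ nbr H univ A)
  rw [card_union_of_disjoint h2] at h3
  omega

omit [Fintype V] in
theorem OddCycles.exists_small {U : Finset V} {ks : List ℕ} (h : OddCycles H U ks)
    (h3 : 3 ≤ ks.length) (hU : U.card ≤ 17) :
    ∃ k c U' ks', k ≤ 3 ∧ U = (range (2 * k + 1)).image c ∪ U' ∧ Cyc H (2 * k + 1) c ∧
      OddCycles H U' ks' ∧ ks.length = ks'.length + 1 ∧
      Disjoint ((range (2 * k + 1)).image c) U' := by
  have hcard := h.card_eq
  have hpos := h.pos
  cases h with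
  | nil => simp at h3
  | @cons U ks a c hU1 hc ha hd =>
  by_cases hak : ks.length = 0 ∨ a ≤ 3
  · refine ⟨a, c, U, _, ?_, rfl, hc, hU1, rfl, hd⟩
    rw [List.length_cons] at h3
    omega
  cases hU1 with
  | nil => simp at h3
  | @cons U ks b d hU2 hc' hb hd' =>
  rw [disjoint_union_right] at hd
  refine ⟨b, d, _, _, ?_, union_left_comm _ _ _, hc', hU2.cons hc ha hd.2, rfl,
    disjoint_union_right.2 ⟨hd.1.symm, hd'⟩⟩
  cases ks with
  | nil => simp at h3
  | cons e ks =>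
    have : 1 ≤ e := hpos e (by simp)
    simp only [List.sum_cons, List.length_cons] at hcard
    omega

/-- The graph contains the disjoint union of a cycle of length `2 k + 1` and `m` edges. -/
def HasCycleMatching (H : SimpleGraph V) (k m : ℕ) : Prop :=
  ∃ c P M, Cyc H (2 * k + 1) c ∧ Matching H P M ∧ P.card = 2 * m ∧
    Disjoint ((range (2 * k + 1)).image c) P

theorem stab_three (h2 : AllStab 2) (hV : Fintype.card V = 17) (hi : IndepLE H univ 7) :
    Stab H univ 5 3 ∨ ∃ k m, k + m = 8 ∧ m ≤ 2 ∧ HasCycleMatching H k m := by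
  rcases h2.stab_or_expanding hV hi with h | ⟨hE, -⟩
  · exact Or.inl h
  obtain ⟨P, U, M, ks, hPU, hd, hM, hU⟩ := hE.hallCond.exists_factor
  have hcard : P.card + U.card = 17 := by
    rw [← card_union_of_disjoint hd, ← hPU, card_univ, hV]
  obtain ⟨m, hm, hP⟩ := hM.good
  have hUc := hU.card_eq
  by_cases h3 : 3 ≤ ks.length
  · left
    obtain ⟨k, c, U', ks', hk, rfl, hc, hU', hlen, hdis⟩ := hU.exists_small h3 (by omega)
    obtain ⟨N, j, h4, h5, h6⟩ := hU'.good (by rw [Nat.even_iff]; omega)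
    rw [card_union_of_disjoint hdis, card_image_of_injOn (by simpa using hc.injOn),
      card_range] at hcard
    refine (((hP.union h6).2 3 (by omega)).union (stab_zero_iff.2 hc.indepLE)).mono ?_
      (by omega) le_rfl
    rw [hPU]
    intro x
    simp only [mem_union]
    tauto
  match ks, hU with
  | [], _ => rw [List.sum_nil, List.length_nil] at hUc; omega
  | [k], .cons (c := c) .nil hc hk _ =>
    rw [List.sum_singleton, List.length_singleton] at hUc
    rw [union_empty] at hPU hd hUc hcard
    by_cases h3 : 3 ≤ m
    · left
      exact ((hP.2 3 h3).union (stab_zero_iff.2 hc.indepLE)).mono hPU.le (by omega) le_rfl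
    · exact Or.inr ⟨k, m, by omega, by omega, c, P, M, hc, hM, hm, hd.symm⟩
  | [k, l], _ => simp at hUc; omega
  | _ :: _ :: _ :: _, _ => simp at h3

theorem allStab_of_three_le (h3 : AllStab 3) (r : ℕ) (hr : 3 ≤ r) : AllStab r := by
  induction r, hr using Nat.le_induction with
  | base => exact h3
  | succ r hr ih =>
    intro V _ _ H hV hi
    rcases ih.stab_or_expanding hV hi with h | ⟨hE, hr4⟩
    · exact h
    obtain rfl | rfl : r = 3 ∨ r = 4 := by omega
    · exact hE.hallCond.stab (N := 9) (j := 4) (by rw [card_univ, hV]) (by norm_num)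
    · exact hE.stab_odd (N := 9) (j := 4) (by rw [card_univ, hV]) (by norm_num)

end Stabbing

namespace Stabbing

open Finset

variable {V : Type} [DecidableEq V] {H : SimpleGraph V}

theorem Cyc.two_le {k : ℕ} {c : ℕ → V} (h : Cyc H (2 * k + 1) c) (hk : 1 ≤ k)
    (htri : H.CliqueFree 3) : 2 ≤ k := by
  by_contra! hlt
  obtain rfl : k = 1 := by omega
  exact htri {c 0, c 1, c 2} (SimpleGraph.is3Clique_triple_iff.2
    ⟨h.adj 0, (h.last (L := 2)).symm, h.adj 1⟩)

/-- The graph contains the disjoint union of a triangle and a cycle of length `13`. -/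
def HasTriangleCycle (H : SimpleGraph V) : Prop :=
  ∃ T c, H.IsNClique 3 T ∧ Cyc H 13 c ∧ Disjoint ((range 13).image c) T

/-- The graph contains the disjoint union of an edge and two cycles with `14` vertices in total. -/
def HasTwoCycles (H : SimpleGraph V) (k l : ℕ) : Prop :=
  ∃ a b c d, H.Adj a b ∧ Cyc H (2 * k + 1) c ∧ Cyc H (2 * l + 1) d ∧
    Disjoint ((range (2 * k + 1)).image c) ((range (2 * l + 1)).image d) ∧
    Disjoint ((range (2 * k + 1)).image c ∪ (range (2 * l + 1)).image d) {a, b}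

/-- The graph contains the disjoint union of an edge, `m` further edges, and a cycle of length
`2 k + 1` with a pendant edge. -/
def HasPendantCycle (H : SimpleGraph V) (k m : ℕ) : Prop :=
  ∃ a b t c P M, H.Adj a b ∧ H.Adj t (c 0) ∧ Cyc H (2 * k + 1) c ∧ Matching H P M ∧
    P.card = 2 * m ∧ Disjoint ((range (2 * k + 1)).image c) P ∧
    t ∉ (range (2 * k + 1)).image c ∪ P ∧
    Disjoint (insert t ((range (2 * k + 1)).image c ∪ P)) {a, b}

theorem pendant_of_expanding {a b : V} {K : Finset V} {M : V → V} (hab : H.Adj a b)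
    (hK : Disjoint K {a, b}) (hM : Matching H K M) (hcard : K.card = 14)
    (hfac : ∀ t ∈ K, ∃ k c P N, 1 ≤ k ∧ K.erase t = P ∪ (range (2 * k + 1)).image c ∧
      Disjoint P ((range (2 * k + 1)).image c) ∧ Matching H P N ∧ Cyc H (2 * k + 1) c) :
    ∃ k m, 1 ≤ k ∧ k + m = 6 ∧ HasPendantCycle H k m := by
  have key : ∀ d, ∀ t ∈ K, ∀ k c P N, 1 ≤ k → K.erase t = P ∪ (range (2 * k + 1)).image c →
      Disjoint P ((range (2 * k + 1)).image c) → Matching H P N → Cyc H (2 * k + 1) c →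
      14 ≤ d + (P.filter fun x => N x = M x).card →
      ∃ k m, 1 ≤ k ∧ k + m = 6 ∧ HasPendantCycle H k m := by
    intro d
    induction d with
    | zero =>
      intro t ht k c P N hk hP hd hN hc hle
      have h1 := card_le_card (filter_subset (fun x => N x = M x) P)
      have h2 := card_erase_add_one ht
      rw [hP, card_union_of_disjoint hd] at h2
      omega
    | succ d ih =>
      intro t ht k c P N hk hP hd hN hc hle
      have hPt : ∀ x, x ∈ P ∪ (range (2 * k + 1)).image c ↔ x ≠ t ∧ x ∈ K := fun x => by
        rw [← hP, mem_erase]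
      have htP : t ∉ P ∪ (range (2 * k + 1)).image c := fun h => ((hPt t).1 h).1 rfl
      obtain ⟨hzK, hMz, htz⟩ := hM t ht
      rcases mem_union.1 ((hPt (M t)).2 ⟨htz.ne', hzK⟩) with hzP | hzC
      · obtain ⟨h1, h2, h3⟩ := hN _ hzP
        have hNt : N (M t) ≠ t := fun h => htP (mem_union_left _ (h ▸ h1))
        have htP' : t ∉ (P.erase (M t)).erase (N (M t)) := fun h =>
          htP (mem_union_left _ (mem_of_mem_erase (mem_of_mem_erase h)))
        have hN' := (hN.erase hzP).insert (a := M t) (b := t) (by simp) htP' htz.symm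
        refine ih (N (M t)) ((hPt _).1 (mem_union_left _ h1)).2 k c _ _ hk ?_ ?_ hN' hc ?_
        · ext x
          have hx := hPt x
          by_cases hxC : x ∈ (range (2 * k + 1)).image c
          · have h4 : x ≠ N (M t) := fun h => disjoint_left.1 hd h1 (h ▸ hxC)
            simp only [mem_erase, mem_union, hxC, or_true, iff_true]
            exact ⟨h4, (hx.1 (mem_union_right _ hxC)).2⟩
          · simp only [mem_union, hxC, or_false] at hx
            simp only [mem_erase, mem_union, mem_insert, hx, hxC, or_false]
            constructor
            · tauto
            · rintro (rfl | rfl | h)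
              exacts [⟨h3.ne, hzK⟩, ⟨hNt.symm, ht⟩, ⟨h.1, h.2.2.2⟩]
        · rw [disjoint_insert_left, disjoint_insert_left]
          exact ⟨fun h => disjoint_left.1 hd hzP h, fun h => htP (mem_union_right _ h),
            hd.mono_left ((erase_subset _ _).trans (erase_subset _ _))⟩
        · have h4 : insert t (P.filter fun x => N x = M x) ⊆
              (insert (M t) (insert t ((P.erase (M t)).erase (N (M t))))).filter fun x =>
                Function.update (Function.update N (M t) t) t (M t) x = M x := by
            intro x hx
            rw [mem_insert, mem_filter] at hx
            rcases hx with rfl | ⟨hx, hxM⟩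
            · simp
            have hxt : x ≠ t := fun h => htP (mem_union_left _ (h ▸ hx))
            have hxz : x ≠ M t := fun h => hNt (by rw [← h, hxM, h, hMz])
            have hxN : x ≠ N (M t) := fun h => by
              rw [h, h2] at hxM
              have := (hM _ ((hPt _).1 (mem_union_left _ h1)).2).2.1
              rw [← hxM, hMz] at this
              exact hNt this.symm
            rw [mem_filter, Function.update_of_ne hxt, Function.update_of_ne hxz]
            exact ⟨by simp [hx, hxz, hxN], hxM⟩
          have h5 := card_le_card h4
          rw [card_insert_of_notMem fun h => htP (mem_union_left _ (mem_filter.1 h).1)] at h5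
          omega
      · obtain ⟨i, -, hi⟩ := mem_image.1 hzC
        have hsub : (range (2 * k + 1)).image (fun j => c (i + j)) ⊆
            (range (2 * k + 1)).image c := fun x hx => by
          obtain ⟨j, -, rfl⟩ := mem_image.1 hx
          exact hc.mem _
        obtain ⟨m, hm, -⟩ := hN.good
        have h2 := card_erase_add_one ht
        rw [hP, card_union_of_disjoint hd, card_image_of_injOn (by simpa using hc.injOn),
          card_range] at h2
        refine ⟨k, m, hk, by omega, a, b, t, _, P, N, hab, ?_, hc.rotate i, hN, hm,
          hd.symm.mono_left hsub, fun h => htP ?_, hK.mono_left ?_⟩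
        · simpa [hi] using htz
        · rw [union_comm]
          exact union_subset_union_left hsub h
        · refine insert_subset ht fun x hx => ((hPt x).1 ?_).2
          rw [union_comm]
          exact union_subset_union_left hsub hx
  obtain ⟨t, ht⟩ := card_pos.1 (show 0 < K.card by omega)
  obtain ⟨k, c, P, N, hk, hP, hd, hN, hc⟩ := hfac t ht
  exact key 14 t ht k c P N hk hP hd hN hc (by omega)

variable [Fintype V]

theorem stab_two_of_triangle (hV : Fintype.card V = 16) (hi : IndepLE H univ 6)
    (htri : ¬ H.CliqueFree 3) : Stab H univ 5 2 ∨ HasTriangleCycle H := by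
  unfold SimpleGraph.CliqueFree at htri
  push Not at htri
  obtain ⟨T, hT⟩ := htri
  by_cases hS : Stab H (univ \ T) 5 1
  · exact Or.inl (hS.of_sdiff hT.isClique)
  right
  rcases exists_clique_or_expanding (hi.mono (sdiff_subset (t := T)) le_rfl) with
    ⟨Q, -, -, hQ, hQi⟩ | hE
  · exact absurd ((stab_zero_iff.2 hQi).of_sdiff hQ) hS
  obtain ⟨P, U, M, ks, hPU, hd, hM, hU⟩ := hE.hallCond.exists_factor
  have hcard : P.card + U.card = 13 := by
    rw [← card_union_of_disjoint hd, ← hPU, card_sdiff_of_subset (subset_univ _), card_univ, hV,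
      hT.card_eq]
  obtain ⟨m, hm, hP⟩ := hM.good
  have hUc := hU.card_eq
  have hs : Stab H (univ \ T) (m + ks.sum) 0 :=
    hPU ▸ stab_zero_iff.2 (hP.indepLE.union hU.indepLE)
  have hs1 : 1 ≤ m → Stab H (univ \ T) (m - 1 + ks.sum) 1 := fun h =>
    hPU ▸ (hP.2 1 h).union (stab_zero_iff.2 hU.indepLE)
  have h1 : 6 ≤ m + ks.sum := by
    by_contra! h
    exact hS (hs.mono Subset.rfl (by omega) (by omega))
  have h2 : m = 0 := by
    by_contra! h
    exact hS ((hs1 (by omega)).mono Subset.rfl (by omega) (by omega))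
  subst h2
  match ks, hU with
  | [k], .cons (c := c) .nil hc hk _ =>
    rw [List.sum_singleton, List.length_singleton] at hUc
    obtain rfl : k = 6 := by omega
    refine ⟨T, c, hT, hc, ?_⟩
    rw [union_empty] at hPU
    exact (disjoint_sdiff (s := T)).symm.mono_left (hPU ▸ subset_union_right)
  | [], _ => rw [List.sum_nil, List.length_nil] at hUc; omega
  | _ :: _ :: ks, _ => rw [List.length_cons, List.length_cons] at hUc; omega

theorem stab_two_of_cliqueFree (hV : Fintype.card V = 16) (hi : IndepLE H univ 6)
    (htri : H.CliqueFree 3) : Stab H univ 5 2 ∨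
      (∃ k l, k + l = 6 ∧ 2 ≤ k ∧ k ≤ l ∧ HasTwoCycles H k l) ∨
      ∃ k m, k + m = 6 ∧ 2 ≤ k ∧ HasPendantCycle H k m := by
  obtain ⟨a, b, hab⟩ : ∃ a b, H.Adj a b := by
    by_contra! h
    have := hi univ Subset.rfl fun x _ y _ _ => h x y
    rw [card_univ] at this
    omega
  by_cases hS : Stab H (univ \ {a, b}) 5 1
  · exact Or.inl (hS.of_sdiff (isClique_pair hab))
  right
  rcases exists_clique_or_expanding (hi.mono (sdiff_subset (t := {a, b})) le_rfl) with
    ⟨Q, -, -, hQ, hQi⟩ | hE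
  · exact absurd ((stab_zero_iff.2 hQi).of_sdiff hQ) hS
  obtain ⟨P, U, M, ks, hPU, hd, hM, hU⟩ := hE.hallCond.exists_factor
  have hKcard : (univ \ {a, b} : Finset V).card = 14 := by
    rw [card_sdiff_of_subset (subset_univ _), card_univ, hV, card_pair hab.ne]
  have hKd : Disjoint (univ \ {a, b} : Finset V) {a, b} := sdiff_disjoint
  obtain ⟨K, hK⟩ : ∃ K, K = (univ \ {a, b} : Finset V) := ⟨_, rfl⟩
  rw [← hK] at hS hE hPU hKcard hKd
  have hcard : P.card + U.card = 14 := by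
    rw [← card_union_of_disjoint hd, ← hPU, hKcard]
  obtain ⟨m, hm, hP⟩ := hM.good
  have hUc := hU.card_eq
  have hs : Stab H K (m + ks.sum) 0 :=
    hPU ▸ stab_zero_iff.2 (hP.indepLE.union hU.indepLE)
  have hs1 : 1 ≤ m → Stab H K (m - 1 + ks.sum) 1 := fun h =>
    hPU ▸ (hP.2 1 h).union (stab_zero_iff.2 hU.indepLE)
  have h1 : 6 ≤ m + ks.sum := by
    by_contra! h
    exact hS (hs.mono Subset.rfl (by omega) (by omega))
  match ks, hU with
  | [], .nil =>
    right
    rw [union_empty] at hPU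
    subst hPU
    obtain ⟨k, m, hk, hkm, h⟩ := pendant_of_expanding hab hKd hM hKcard fun t ht => by
      obtain ⟨P', U', N, ks', hPU', hd', hN, hU'⟩ := (hE.hallCond_erase t).exists_factor
      have h3 := card_erase_add_one ht
      rw [hPU', card_union_of_disjoint hd', hU'.card_eq] at h3
      obtain ⟨m', hm', hP'⟩ := hN.good
      have h6 : 6 ≤ m' + ks'.sum := by
        by_contra! h
        refine hS (Stab.of_sdiff (C := {t}) (by simp) (stab_zero_iff.2 ?_))
        rw [sdiff_singleton_eq_erase, hPU']
        exact (hP'.indepLE.union hU'.indepLE).mono Subset.rfl (by omega)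
      match ks', hU' with
      | [k], .cons (c := c) .nil hc hk _ =>
        rw [union_empty] at hPU' hd'
        exact ⟨k, c, P', N, hk, hPU', hd', hN, hc⟩
      | [], _ => rw [List.sum_nil, List.length_nil] at h3; omega
      | _ :: _ :: ks, _ => rw [List.length_cons, List.length_cons] at h3; omega
    refine ⟨k, m, hkm, ?_, h⟩
    obtain ⟨_, _, _, c, _, _, _, _, hc, _⟩ := h
    exact hc.two_le hk htri
  | [k, l], .cons (c := c) (.cons (c := d) .nil hd2 hl _) hc hk hcd =>
    left
    rw [List.sum_cons, List.sum_singleton, List.length_cons, List.length_singleton] at hUc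
    rw [List.sum_cons, List.sum_singleton] at hs1
    have h2 : m = 0 := by
      by_contra! h
      exact hS ((hs1 (by omega)).mono Subset.rfl (by omega) (by omega))
    rw [union_empty] at hcd
    have hdis : Disjoint ((range (2 * k + 1)).image c ∪ (range (2 * l + 1)).image d) {a, b} :=
      hKd.mono_left (hPU ▸ (by rw [union_empty]; exact subset_union_right))
    rcases le_total k l with hkl | hkl
    · exact ⟨k, l, by omega, hc.two_le hk htri, hkl, a, b, c, d, hab, hc, hd2, hcd, hdis⟩
    · exact ⟨l, k, by omega, hd2.two_le hl htri, hkl, a, b, d, c, hab, hd2, hc, hcd.symm,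
        union_comm (image c _) _ ▸ hdis⟩
  | [k], _ => rw [List.sum_singleton, List.length_singleton] at hUc; omega
  | _ :: _ :: _ :: ks, _ =>
    rw [List.length_cons, List.length_cons, List.length_cons] at hUc
    have := Nat.zero_le ks.length
    omega

end Stabbing

namespace Stabbing

open Finset

section Realizes

variable {V : Type*} {H : SimpleGraph V}

/-- The vertices `g 0, …, g (n - 1)` of `W` are distinct, and those related by `R` are adjacent. -/
structure Realizes (H : SimpleGraph V) (W : Finset V) (n : ℕ) (R : ℕ → ℕ → Bool) (g : ℕ → V) :
    Prop where
  mem : ∀ i < n, g i ∈ W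
  inj : Set.InjOn g (Set.Iio n)
  adj : ∀ i < n, ∀ j < i, R i j = true → H.Adj (g i) (g j)

/-- Adjacency of consecutive elements of a cycle of length `L`. -/
def cycRel (L i j : ℕ) : Bool := j + 1 == i || (j == 0 && i + 1 == L)

/-- Adjacency of `2 m` and `2 m + 1`. -/
def matchRel (i j : ℕ) : Bool := j + 1 == i && j % 2 == 0

def allRel (_ _ : ℕ) : Bool := true

def glueRel (n : ℕ) (R R' : ℕ → ℕ → Bool) (i j : ℕ) : Bool :=
  if i < n then R i j else decide (n ≤ j) && R' (i - n) (j - n)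

def addRel (R : ℕ → ℕ → Bool) (a b i j : ℕ) : Bool := R i j || (i == a && j == b)

theorem Realizes.mono {W W' : Finset V} {n : ℕ} {R R' : ℕ → ℕ → Bool} {g : ℕ → V}
    (h : Realizes H W n R g) (hW : W ⊆ W')
    (hR : ∀ i < n, ∀ j < i, R' i j = true → R i j = true) : Realizes H W' n R' g :=
  ⟨fun i hi => hW (h.mem i hi), h.inj, fun i hi j hj hij => h.adj i hi j hj (hR i hi j hj hij)⟩

theorem Realizes.add {W : Finset V} {n : ℕ} {R : ℕ → ℕ → Bool} {g : ℕ → V}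
    (h : Realizes H W n R g) {a b : ℕ} (hab : H.Adj (g a) (g b)) :
    Realizes H W n (addRel R a b) g := by
  refine ⟨h.mem, h.inj, fun i hi j hj hij => ?_⟩
  simp only [addRel, Bool.or_eq_true, Bool.and_eq_true, beq_iff_eq] at hij
  rcases hij with hij | ⟨rfl, rfl⟩
  · exact h.adj i hi j hj hij
  · exact hab

theorem Realizes.glue [DecidableEq V] {W W' : Finset V} {n n' : ℕ} {R R' : ℕ → ℕ → Bool}
    {g g' : ℕ → V} (h : Realizes H W n R g) (h' : Realizes H W' n' R' g') (hd : Disjoint W W') :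
    Realizes H (W ∪ W') (n + n') (glueRel n R R') fun i => if i < n then g i else g' (i - n) := by
  refine ⟨fun i hi => ?_, fun i hi j hj hij => ?_, fun i hi j hj hij => ?_⟩
  · split
    · exact mem_union_left _ (h.mem _ ‹_›)
    · exact mem_union_right _ (h'.mem _ (by omega))
  · rw [Set.mem_Iio] at hi hj
    split at hij <;> split at hij
    · exact h.inj ‹_› ‹_› hij
    · exact (disjoint_left.1 hd (h.mem _ ‹_›) (hij ▸ h'.mem _ (by omega))).elim
    · exact (disjoint_left.1 hd (h.mem _ ‹_›) (hij ▸ h'.mem _ (by omega))).elim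
    · have := h'.inj (show i - n < n' by omega) (show j - n < n' by omega) hij
      omega
  · rw [glueRel] at hij
    by_cases hin : i < n
    · rw [if_pos hin] at hij
      rw [if_pos hin, if_pos (hj.trans hin)]
      exact h.adj i hin j hj hij
    · rw [if_neg hin, Bool.and_eq_true, decide_eq_true_eq] at hij
      rw [if_neg hin, if_neg (not_lt.2 hij.1)]
      exact h'.adj _ (by omega) _ (by omega) hij.2

theorem realizes_single (v : V) : Realizes H {v} 1 allRel fun _ => v := by
  refine ⟨fun _ _ => mem_singleton_self v, fun i hi j hj _ => ?_, fun i hi j hj => by omega⟩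
  rw [Set.mem_Iio] at hi hj
  omega

theorem realizes_pair [DecidableEq V] {a b : V} (h : H.Adj a b) :
    ∃ g, Realizes H {a, b} 2 allRel g := by
  have h1 := ((realizes_single (H := H) a).glue (realizes_single b) (by simpa using h.ne)).add
    (a := 1) (b := 0) (by simpa using h.symm)
  refine ⟨_, h1.mono (by simp) fun i hi j hj _ => ?_⟩
  obtain ⟨rfl, rfl⟩ : i = 1 ∧ j = 0 := by omega
  rfl

theorem realizes_triangle [DecidableEq V] {T : Finset V} (h : H.IsNClique 3 T) :
    ∃ g, Realizes H T 3 allRel g := by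
  obtain ⟨a, b, c, hab, hac, hbc, rfl⟩ := SimpleGraph.is3Clique_iff.1 h
  refine ⟨fun i => if i = 0 then a else if i = 1 then b else c, ?_, ?_, ?_⟩
  · intro i _
    split_ifs <;> simp
  · intro i hi j hj hij
    have h1 := hab.ne
    have h2 := hac.ne
    have h3 := hbc.ne
    rw [Set.mem_Iio] at hi hj
    interval_cases i <;> interval_cases j <;> simp_all [eq_comm]
  · intro i hi j hj _
    interval_cases i <;> interval_cases j <;> simp [hab.symm, hac.symm, hbc.symm]

theorem Cyc.realizes [DecidableEq V] {L : ℕ} {c : ℕ → V} (h : Cyc H L c) :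
    Realizes H ((range L).image c) L (cycRel L) c := by
  refine ⟨fun i hi => mem_image_of_mem c (mem_range.2 hi), h.injOn, fun i hi j hj hij => ?_⟩
  simp only [cycRel, Bool.or_eq_true, Bool.and_eq_true, beq_iff_eq] at hij
  rcases hij with rfl | ⟨rfl, rfl⟩
  · exact (h.adj j).symm
  · exact h.last

theorem Matching.realizes [DecidableEq V] [Nonempty V] (m : ℕ) {P : Finset V} {M : V → V}
    (h : Matching H P M) (hP : P.card = 2 * m) : ∃ g, Realizes H P (2 * m) matchRel g := by
  induction m generalizing P with
  | zero => exact ⟨fun _ => Classical.arbitrary V, fun i hi => by omega, fun i hi => by simp at hi,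
      fun i hi => by omega⟩
  | succ m ih =>
    obtain ⟨x, hx⟩ := card_pos.1 (show 0 < P.card by omega)
    obtain ⟨hMx, hMM, hadj⟩ := h x hx
    have hMx' : M x ∈ P.erase x := mem_erase.2 ⟨hadj.ne', hMx⟩
    obtain ⟨g, hg⟩ := ih (h.erase hx) (by rw [card_erase_of_mem hMx', card_erase_of_mem hx]; omega)
    obtain ⟨g', hg'⟩ := realizes_pair hadj
    refine ⟨_, (hg.glue hg' ?_).mono ?_ fun i hi j hj hij => ?_⟩
    · simp
    · intro y hy
      simp only [mem_union, mem_erase, mem_insert, mem_singleton] at hy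
      rcases hy with hy | rfl | rfl
      exacts [hy.2.2, hx, hMx]
    · rw [glueRel]
      split
      · exact hij
      · simp only [matchRel, Bool.and_eq_true, beq_iff_eq] at hij
        simp only [allRel, Bool.and_true, decide_eq_true_eq]
        omega

theorem Realizes.not_valid {W : Finset V} {n E : ℕ} {R : ℕ → ℕ → Bool} {g : ℕ → V}
    (h : Realizes H W n R g)
    (hE : ∀ i < n, ∀ j < i, (IndepCert.triRow E i).testBit j = true → R i j = true) :
    ¬ (IndepCert.Clause.mk n E 0).Valid H := by
  intro hv
  obtain ⟨i, -, j, -, hij, -⟩ := hv g h.inj fun i hi j hj hij => h.adj i hi j hj (hE i hi j hj hij)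
  simp [IndepCert.triRow] at hij

theorem IndepLE.valid [Fintype V] {n D : ℕ} (h : IndepLE H univ n)
    (hD : ∀ i < n + 1, ∀ j < i, (IndepCert.triRow D i).testBit j = true) :
    (IndepCert.Clause.mk (n + 1) 0 D).Valid H := by
  classical
  intro g hg _
  by_contra! hcon
  have h1 := h ((range (n + 1)).image g) (subset_univ _) ?_
  · rw [card_image_of_injOn (by simpa using hg), card_range] at h1
    omega
  · intro x hx y hy hxy hadj
    rw [coe_image, Set.mem_image] at hx hy
    obtain ⟨i, hi, rfl⟩ := hx
    obtain ⟨j, hj, rfl⟩ := hy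
    rw [mem_coe, mem_range] at hi hj
    rcases lt_trichotomy i j with hij | rfl | hij
    · exact hcon j hj i hij (hD j hj i hij) hadj.symm
    · exact hxy rfl
    · exact hcon i hi j hij (hD i hi j hij) hadj

end Realizes

section Layouts

variable {V : Type} [DecidableEq V] {H : SimpleGraph V}

theorem HasTriangleCycle.realizes (h : HasTriangleCycle H) :
    ∃ W g, Realizes H W 16 (glueRel 13 (cycRel 13) allRel) g := by
  obtain ⟨T, c, hT, hc, hd⟩ := h
  obtain ⟨g, hg⟩ := realizes_triangle hT
  exact ⟨_, _, hc.realizes.glue hg hd⟩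

theorem HasTwoCycles.realizes {k l : ℕ} (h : HasTwoCycles H k l) :
    ∃ W g, Realizes H W (2 * k + 1 + (2 * l + 1) + 2) (glueRel (2 * k + 1 + (2 * l + 1))
      (glueRel (2 * k + 1) (cycRel (2 * k + 1)) (cycRel (2 * l + 1))) allRel) g := by
  obtain ⟨a, b, c, d, hab, hc, hd, h1, h2⟩ := h
  obtain ⟨g, hg⟩ := realizes_pair hab
  exact ⟨_, _, (hc.realizes.glue hd.realizes h1).glue hg h2⟩

theorem Cyc.apply_mem {L : ℕ} {c : ℕ → V} (h : Cyc H L c) (hL : 0 < L) (i : ℕ) :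
    c i ∈ (range L).image c :=
  mem_image.2 ⟨i % L, mem_range.2 (Nat.mod_lt _ hL), (h.eq_iff _ _).2 (Nat.mod_modEq i L)⟩

theorem HasPendantCycle.realizes {k m : ℕ} (h : HasPendantCycle H k m) :
    ∃ W g, Realizes H W (2 * k + 1 + 1 + 2 * m + 2) (glueRel (2 * k + 1 + 1 + 2 * m)
      (glueRel (2 * k + 1 + 1)
        (addRel (glueRel (2 * k + 1) (cycRel (2 * k + 1)) allRel) (2 * k + 1) (2 * k))
        matchRel) allRel) g := by
  obtain ⟨a, b, t, c, P, M, hab, ht, hc, hM, hP, h1, h2, h3⟩ := h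
  have : Nonempty V := ⟨a⟩
  rw [mem_union, not_or] at h2
  obtain ⟨g, hg⟩ := realizes_pair hab
  obtain ⟨g', hg'⟩ := hM.realizes m hP
  have hr := (hc.rotate 1).realizes.mono (image_subset_iff.2 fun i _ =>
    hc.apply_mem (by omega) (1 + i)) fun _ _ _ _ h => h
  have hlast : c (1 + 2 * k) = c 0 := (hc.eq_iff _ _).2 (by simp [Nat.ModEq, add_comm 1])
  refine ⟨_, _, (((hr.glue (realizes_single t) ?_).add ?_).glue hg' ?_).glue hg ?_⟩
  · simpa using h2.1
  · simpa [hlast] using ht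
  · rw [disjoint_union_left, disjoint_singleton_left]
    exact ⟨h1, h2.2⟩
  · refine h3.mono_left fun x hx => ?_
    simp only [mem_union, mem_singleton, mem_insert] at hx ⊢
    tauto

theorem HasCycleMatching.realizes {k m : ℕ} (h : HasCycleMatching H k m) :
    ∃ W g, Realizes H W (2 * k + 1 + 2 * m) (glueRel (2 * k + 1) (cycRel (2 * k + 1)) matchRel)
      g := by
  obtain ⟨c, P, M, hc, hM, hP, hd⟩ := h
  have : Nonempty V := ⟨c 0⟩
  obtain ⟨g, hg⟩ := hM.realizes m hP
  exact ⟨_, _, hc.realizes.glue hg hd⟩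

end Layouts

end Stabbing

namespace Stabbing

open Finset

theorem params_holds {V : Type} [Fintype V] {H : SimpleGraph V} {n r : ℕ} {tri : Bool}
    (hn : 0 < n) (hn' : n ≤ 30) (hr : 1 ≤ r)
    (h : ¬ Stab H univ 5 r) (ht : tri = true → H.CliqueFree 3) :
    IndepCert.Params.Holds ⟨n, r, tri⟩ H :=
  ⟨hn, hn', hr, unstabbed_of_not_stab h, ht⟩

section Small

variable {V : Type} [Fintype V] [DecidableEq V] {H : SimpleGraph V}

theorem HasTriangleCycle.stab (h : HasTriangleCycle H) (hV : Fintype.card V = 16)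
    (hi : IndepLE H univ 6) : Stab H univ 5 2 := by
  by_contra hs
  obtain ⟨W, g, hg⟩ := h.realizes
  exact hg.not_valid (by decide) (IndepCert.valid_of_check_single
    (params_holds (by simp) (by simp) (by simp) hs (by simp)) hV (by decide)
    IndepCert.check_triangle_cycle (hi.valid (by decide)))

theorem HasCycleMatching.stab {k m : ℕ} (h : HasCycleMatching H k m) (hkm : k + m = 8)
    (hm : m ≤ 2) (hV : Fintype.card V = 17) (hi : IndepLE H univ 7) : Stab H univ 5 3 := by
  by_contra hs
  obtain ⟨W, g, hg⟩ := h.realizes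
  have hP := params_holds (n := 17) (tri := false) (by simp) (by simp) (by simp) hs (by simp)
  have h0 : (IndepCert.Clause.mk 8 0 268435455).Valid H := hi.valid (by decide)
  interval_cases m
  · obtain rfl : k = 8 := by omega
    exact hg.not_valid (by decide) (IndepCert.valid_of_check_single hP hV (by decide)
      IndepCert.check_cycle17 h0)
  · obtain rfl : k = 7 := by omega
    exact hg.not_valid (by decide) (IndepCert.valid_of_check_single hP hV (by decide)
      IndepCert.check_cycle15_matching h0)
  · obtain rfl : k = 6 := by omega
    exact hg.not_valid (by decide) (IndepCert.valid_of_check_single hP hV (by decide)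
      IndepCert.check_cycle13_matching h0)

theorem allStab_two : AllStab 2 := by
  intro V _ _ H hV hi
  by_cases htri : H.CliqueFree 3
  · by_contra hs
    have hv := IndepCert.clauseTable_valid
      (params_holds (by simp) (by simp) (by simp) hs fun _ => htri) hV (hi.valid (by decide))
    rcases (stab_two_of_cliqueFree hV hi htri).resolve_left hs with
      ⟨k, l, hkl, hk, hl, h⟩ | ⟨k, m, hkm, hk, h⟩
    · obtain ⟨W, g, hg⟩ := h.realizes
      obtain ⟨rfl, rfl⟩ | ⟨rfl, rfl⟩ : k = 2 ∧ l = 4 ∨ k = 3 ∧ l = 3 := by omega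
      · exact hg.not_valid (by decide) (hv 386 (by simp) _ rfl)
      · exact hg.not_valid (by decide) (hv 387 (by simp) _ rfl)
    · obtain ⟨W, g, hg⟩ := h.realizes
      obtain rfl : m = 6 - k := by omega
      have hk' : k ≤ 6 := by omega
      interval_cases k
      · exact hg.not_valid (by decide) (hv 385 (by simp) _ rfl)
      · exact hg.not_valid (by decide) (hv 330 (by simp) _ rfl)
      · exact hg.not_valid (by decide) (hv 246 (by simp) _ rfl)
      · exact hg.not_valid (by decide) (hv 151 (by simp) _ rfl)
      · exact hg.not_valid (by decide) (hv 63 (by simp) _ rfl)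
  · exact (stab_two_of_triangle hV hi htri).elim id fun h => h.stab hV hi

theorem allStab_three : AllStab 3 := by
  intro V _ _ H hV hi
  rcases stab_three allStab_two hV hi with h | ⟨k, m, hkm, hm, h⟩
  · exact h
  · exact h.stab hkm hm hV hi

theorem allStab {r : ℕ} (hr : 2 ≤ r) : AllStab r := by
  rcases hr.eq_or_lt with rfl | hr
  · exact allStab_two
  · exact allStab_of_three_le allStab_three r hr

end Small

end Stabbing

namespace Stabbing

open Finset

section Arrow

variable {V : Type*} [Fintype V]

theorem vArrow_compl_iff (H : SimpleGraph V) (k r : ℕ) :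
    VArrow Hᶜ (List.replicate r 2 ++ [k]) ↔ IndepCert.Unstabbed H k r := by
  classical
  have hlen : (List.replicate r 2 ++ [k]).length = r + 1 := by simp
  have hlast : ∀ i : Fin (List.replicate r 2 ++ [k]).length, ¬ (i : ℕ) < r →
      (i : ℕ) = r ∧ (List.replicate r 2 ++ [k]).get i = k := by
    intro i hi
    have h1 : (i : ℕ) = r := by have := i.2; omega
    refine ⟨h1, ?_⟩
    simp [h1]
  have hinit : ∀ i : Fin (List.replicate r 2 ++ [k]).length, (i : ℕ) < r →
      (List.replicate r 2 ++ [k]).get i = 2 := by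
    intro i hi
    simp [hi]
  constructor
  · intro h L hL hC
    let c : V → Fin (List.replicate r 2 ++ [k]).length := fun v =>
      if h : ∃ i : Fin r, v ∈ L[i] then ⟨h.choose, by have := h.choose.2; omega⟩
      else ⟨r, by omega⟩
    obtain ⟨i, s, hs, hsc⟩ := h c
    have hc : ∀ v, (hv : ∃ i : Fin r, v ∈ L[i]) →
        ∃ j : Fin r, (c v : ℕ) = j ∧ v ∈ L[j] := fun v hv =>
      ⟨hv.choose, by simp only [c, dif_pos hv], hv.choose_spec⟩
    have hc' : ∀ v, (¬ ∃ i : Fin r, v ∈ L[i]) → (c v : ℕ) = r := fun v hv => by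
      simp only [c, dif_neg hv]
    by_cases hi : (i : ℕ) < r
    · rw [hinit i hi, SimpleGraph.isNClique_iff, card_eq_two] at hs
      obtain ⟨hs, x, y, hxy, rfl⟩ := hs
      have hmem : ∀ v ∈ ({x, y} : Finset V), v ∈ L[(i : ℕ)] := by
        intro v hv
        have h1 := hsc v hv
        by_cases hv' : ∃ i : Fin r, v ∈ L[i]
        · obtain ⟨j, hj, hjm⟩ := hc v hv'
          have h2 : (j : ℕ) = i := by rw [← hj, h1]
          simpa [← h2] using hjm
        · have := hc' v hv'
          rw [h1] at this
          omega
      have hx := hmem x (by simp)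
      have hy := hmem y (by simp)
      have h1 : Hᶜ.Adj x y := hs (by simp) (by simp) hxy
      exact ((SimpleGraph.compl_adj _ _ _).1 h1).2 (hC _ (List.getElem_mem _) hx hy hxy) |>.elim
    · obtain ⟨hir, hik⟩ := hlast i hi
      rw [hik] at hs
      refine ⟨s, by simpa using hs, fun C hC' => disjoint_left.2 fun v hv hvs => ?_⟩
      obtain ⟨j, hj, rfl⟩ := List.getElem_of_mem hC'
      obtain ⟨j', hj', -⟩ := hc v ⟨⟨j, by omega⟩, hv⟩
      have := hsc v hvs
      rw [this] at hj'
      omega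
  · intro h c
    by_contra! hcon
    have hC : ∀ C ∈ List.ofFn fun i : Fin r => univ.filter fun v => (c v : ℕ) = i,
        H.IsClique (C : Set V) := by
      intro C hC
      obtain ⟨i, rfl⟩ := List.mem_ofFn.1 hC
      intro x hx y hy hxy
      by_contra hadj
      rw [mem_coe, mem_filter] at hx hy
      obtain ⟨v, hv, hcv⟩ := hcon ⟨i, by omega⟩ {x, y} (by
        rw [hinit ⟨i, by omega⟩ i.2, SimpleGraph.isNClique_iff, card_pair hxy]
        refine ⟨?_, rfl⟩
        rw [coe_pair, SimpleGraph.isClique_pair]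
        exact fun _ => (SimpleGraph.compl_adj _ _ _).2 ⟨hxy, hadj⟩)
      simp only [mem_insert, mem_singleton] at hv
      refine hcv (Fin.ext ?_)
      rcases hv with rfl | rfl
      exacts [hx.2, hy.2]
    obtain ⟨I, hI, hd⟩ := h _ (by simp) hC
    obtain ⟨v, hv, hcv⟩ := hcon ⟨r, by omega⟩ I
      (by rw [(hlast ⟨r, by omega⟩ (by simp)).2]; simpa using hI)
    have hr : (c v : ℕ) < r := by
      have h1 := (c v).2
      have h2 : (c v : ℕ) ≠ r := fun h => hcv (Fin.ext h)
      omega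
    exact disjoint_left.1 (hd _ (List.mem_ofFn.2 ⟨⟨c v, hr⟩, rfl⟩)) (by simp) hv

theorem indepLE_univ_iff {H : SimpleGraph V} {n : ℕ} :
    IndepLE H univ n ↔ Hᶜ.CliqueFree (n + 1) := by
  constructor
  · intro h s hs
    have := h s (subset_univ _) ((SimpleGraph.isClique_compl _).1 hs.1)
    have := hs.2
    omega
  · intro h I _ hI
    by_contra! hlt
    obtain ⟨J, hJ, hc⟩ := exists_subset_card_eq (show n + 1 ≤ I.card from hlt)
    exact h J ⟨(SimpleGraph.isClique_compl _).2 (hI.mono (coe_subset.2 hJ)), hc⟩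

end Arrow

section Induction

variable {V : Type*} {H : SimpleGraph V}

/-- The graph `H` together with an isolated vertex. -/
def addIsolated (H : SimpleGraph V) : SimpleGraph (Option V) := H.map Function.Embedding.some

theorem addIsolated_adj {x y : V} : (addIsolated H).Adj (some x) (some y) ↔ H.Adj x y :=
  SimpleGraph.map_adj_apply (f := Function.Embedding.some)

theorem not_addIsolated_adj_none (x : Option V) : ¬ (addIsolated H).Adj none x := by
  rw [addIsolated, SimpleGraph.map_adj]
  rintro ⟨y, _, -, h, -⟩
  exact Option.some_ne_none y h

theorem isClique_eraseNone {C : Finset (Option V)} (hC : (addIsolated H).IsClique (C : Set _)) :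
    H.IsClique (C.eraseNone : Set V) := fun x hx y hy hxy =>
  addIsolated_adj.1 (hC (mem_eraseNone.1 hx) (mem_eraseNone.1 hy) (by simpa using hxy))

theorem indepLE_addIsolated [Fintype V] {n : ℕ} (h : IndepLE H univ n) :
    IndepLE (addIsolated H) univ (n + 1) := by
  intro I _ hI
  have h1 := h I.eraseNone (subset_univ _) fun x hx y hy hxy hadj =>
    hI (mem_eraseNone.1 hx) (mem_eraseNone.1 hy) (by simpa using hxy) (addIsolated_adj.2 hadj)
  by_cases hn : none ∈ I
  · rw [card_eraseNone_of_mem hn] at h1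
    omega
  · rw [card_eraseNone_of_not_mem hn] at h1
    omega

theorem isIndepSet_map_some {I : Finset V} (hI : H.IsIndepSet (I : Set V)) :
    (addIsolated H).IsIndepSet (I.map Function.Embedding.some : Set (Option V)) := by
  intro x hx y hy hxy hadj
  obtain ⟨x, hx', rfl⟩ := mem_map.1 (mem_coe.1 hx)
  obtain ⟨y, hy', rfl⟩ := mem_map.1 (mem_coe.1 hy)
  exact hI hx' hy' (by rintro rfl; exact hxy rfl) (addIsolated_adj.1 hadj)

theorem unstabbed_addIsolated {k r : ℕ} (h : IndepCert.Unstabbed H k r) :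
    IndepCert.Unstabbed (addIsolated H) k (r + 1) := by
  classical
  intro L hL hC
  have key : ∀ D ∈ L, ∃ I : Finset V, H.IsNIndepSet k I ∧
      ∀ C ∈ L.erase D, Disjoint C.eraseNone I := by
    intro D hD
    have hDC : ∀ C ∈ (L.erase D).map eraseNone, H.IsClique (C : Set V) := by
      intro C hC'
      obtain ⟨B, hB, rfl⟩ := List.mem_map.1 hC'
      exact isClique_eraseNone (hC B (List.mem_of_mem_erase hB))
    obtain ⟨I, hI, hd⟩ := h _ (by rw [List.length_map, List.length_erase_of_mem hD, hL]; rfl) hDC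
    exact ⟨I, hI, fun C hC' => hd _ (List.mem_map_of_mem hC')⟩
  have hmap : ∀ {C : Finset (Option V)} {I : Finset V}, Disjoint C.eraseNone I →
      Disjoint C (I.map Function.Embedding.some) := by
    intro C I hd
    refine disjoint_left.2 fun x hx hxI => ?_
    obtain ⟨y, hy, rfl⟩ := mem_map.1 hxI
    exact disjoint_left.1 hd (mem_eraseNone.2 hx) hy
  by_cases hnone : ∃ D ∈ L, none ∈ D
  · obtain ⟨D, hD, hnD⟩ := hnone
    obtain ⟨I, hI, hd⟩ := key D hD
    refine ⟨I.map Function.Embedding.some, ⟨isIndepSet_map_some hI.1, by simpa using hI.2⟩,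
      fun C hC' => ?_⟩
    by_cases hCD : C = D
    · subst hCD
      refine disjoint_left.2 fun x hx hxI => ?_
      obtain ⟨y, -, rfl⟩ := mem_map.1 hxI
      exact not_addIsolated_adj_none _ (hC C hD hnD hx (by simp))
    · exact hmap (hd C ((List.mem_erase_of_ne hCD).2 hC'))
  · push Not at hnone
    obtain ⟨D, hD⟩ := List.exists_mem_of_length_pos (show 0 < L.length by omega)
    obtain ⟨I, hI, hd⟩ := key D hD
    have hcard : (D.eraseNone ∩ I).card ≤ 1 := by
      refine card_le_one.2 fun x hx y hy => ?_
      rw [mem_inter] at hx hy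
      by_contra hxy
      exact hI.1 hx.2 hy.2 hxy (isClique_eraseNone (hC D hD) hx.1 hy.1 hxy)
    have hle : k ≤ (insert none ((I \ D.eraseNone).map Function.Embedding.some)).card := by
      rw [card_insert_of_notMem (by simp), card_map, card_sdiff, hI.2]
      omega
    obtain ⟨J, hJ, hJk⟩ := exists_subset_card_eq hle
    refine ⟨J, ⟨?_, hJk⟩, fun C hC' => Disjoint.mono_right hJ ?_⟩
    · have h1 : (addIsolated H).IsIndepSet
          (insert none ((I \ D.eraseNone).map Function.Embedding.some) : Finset (Option V)) := by
        rw [coe_insert]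
        refine (isIndepSet_map_some (hI.1.mono (coe_subset.2 sdiff_subset))).insert fun y _ _ => ?_
        exact ⟨not_addIsolated_adj_none y, fun h => not_addIsolated_adj_none y h.symm⟩
      exact h1.mono (coe_subset.2 hJ)
    · rw [disjoint_insert_right]
      refine ⟨hnone C hC', hmap ?_⟩
      by_cases hCD : C = D
      · subst hCD
        exact disjoint_sdiff
      · exact (hd C ((List.mem_erase_of_ne hCD).2 hC')).mono_right sdiff_subset

end Induction

section Base

/-- Every set of vertices below `n` which is contained in the bitset `s` and independent with
respect to the rows `adj` has at most `b` elements. -/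
def indepBound (adj : ℕ → ℕ) : ℕ → ℕ → ℕ → Bool
  | 0, _, _ => true
  | n + 1, s, b => indepBound adj n s b &&
      (!s.testBit n || (Nat.blt 0 b && indepBound adj n (s ^^^ (s &&& adj n)) (b - 1)))

theorem card_le_of_indepBound {adj : ℕ → ℕ} {n s b : ℕ} (h : indepBound adj n s b = true)
    {I : Finset ℕ} (hn : ∀ i ∈ I, i < n) (hs : ∀ i ∈ I, s.testBit i = true)
    (hI : ∀ i ∈ I, ∀ j ∈ I, (adj i).testBit j = false) : I.card ≤ b := by
  induction n generalizing s b I with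
  | zero => simp [eq_empty_of_forall_notMem fun i hi => by simpa using hn i hi]
  | succ n ih =>
    simp only [indepBound, Bool.and_eq_true, Bool.or_eq_true, Bool.not_eq_true', Nat.blt_eq] at h
    by_cases hnI : n ∈ I
    · obtain ⟨hb, h1⟩ := h.2.resolve_left (by simp [hs n hnI])
      have h2 := ih h1 (I := I.erase n) (fun i hi => ?_) (fun i hi => ?_)
        (fun i hi j hj => hI i (mem_of_mem_erase hi) j (mem_of_mem_erase hj))
      · rw [card_erase_of_mem hnI] at h2
        omega
      · have := hn i (mem_of_mem_erase hi)
        have := ne_of_mem_erase hi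
        omega
      · simp [hs i (mem_of_mem_erase hi), hI n hnI i (mem_of_mem_erase hi)]
    · refine ih h.1 (fun i hi => ?_) hs hI
      have := hn i hi
      have : i ≠ n := fun h => hnI (h ▸ hi)
      omega

/-- The rows of the adjacency matrix of a graph with seventeen vertices. -/
def baseRows : List ℕ :=
  [140, 280, 529, 35, 70, 100360, 102416, 106497, 114690, 99332, 18944, 5152, 10304, 20608, 9472,
    992, 992]

/-- The edges of the graph `baseGraph`. -/
def baseEdges : List ℕ :=
  [5, 9, 129, 10, 18, 258, 20, 516, 40, 80, 2080, 32800, 65568, 4160, 32832, 65600, 8320, 32896,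
    65664, 16640, 33024, 65792, 1536, 33280, 66048, 3072, 17408, 6144, 12288, 24576]

/-- Independent sets of `baseGraph`. -/
def baseIndep : List ℕ :=
  [9315, 11025, 20646, 18636, 103448, 116739, 5528, 107526, 21041, 11080, 1508, 108556, 17122,
    118801, 9548, 10819, 4913, 5286, 2968, 21027, 19011, 9009, 9318, 18630, 10572, 5516, 21144,
    103427, 118796, 5425, 9521, 107537, 9569, 116742, 19096, 11032, 108568, 5040, 8803, 16995,
    11073, 1254, 16614, 21154, 19138, 1484, 2508, 9572, 5540, 5016, 19144, 5552, 21168]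

def baseRow (i : ℕ) : ℕ := baseRows.getD i 0

/-- The complement of this graph is `K_7`-free and arrows `(2, 2, 6)`. -/
def baseGraph : SimpleGraph (Fin 17) where
  Adj i j := (baseRow i).testBit j = true
  symm := ⟨by decide +kernel⟩
  loopless := ⟨by decide +kernel⟩

theorem baseGraph_indepLE : IndepLE baseGraph univ 6 := by
  intro I _ hI
  have h : indepBound baseRow 17 131071 6 = true := by decide +kernel
  have hlt : ∀ i < 17, Nat.testBit 131071 i = true := by decide
  rw [← card_map Fin.valEmbedding]
  refine card_le_of_indepBound h ?_ ?_ ?_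
  · simp only [mem_map, Fin.valEmbedding_apply]
    rintro _ ⟨i, -, rfl⟩
    exact i.2
  · simp only [mem_map, Fin.valEmbedding_apply]
    rintro _ ⟨i, -, rfl⟩
    exact hlt i i.2
  · simp only [mem_map, Fin.valEmbedding_apply]
    rintro _ ⟨i, hi, rfl⟩ _ ⟨j, hj, rfl⟩
    rw [← Bool.not_eq_true]
    intro hadj
    rcases eq_or_ne i j with rfl | hij
    · exact baseGraph.loopless.irrefl i hadj
    · exact hI hi hj hij hadj

theorem exists_baseEdges {C : Finset (Fin 17)} (hC : baseGraph.IsClique (C : Set (Fin 17))) :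
    ∃ k ∈ baseEdges, ∀ x ∈ C, k.testBit x = true := by
  have h1 : ∀ x y : Fin 17, x = y ∨ (baseRow x).testBit y = true →
      ∃ k ∈ baseEdges, k.testBit x = true ∧ k.testBit y = true := by decide +kernel
  have h2 : ∀ x y : Fin 17, (baseRow x).testBit y = true → ∀ z : Fin 17,
      (baseRow x).testBit z = true → (baseRow y).testBit z = false := by decide +kernel
  rcases C.eq_empty_or_nonempty with rfl | ⟨x, hx⟩
  · exact ⟨5, by simp [baseEdges], by simp⟩
  · obtain ⟨y, hy, hCy⟩ : ∃ y ∈ C, ∀ z ∈ C, z ≠ x → z = y := by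
      by_cases hne : ∃ y ∈ C, y ≠ x
      · obtain ⟨y, hy, hyx⟩ := hne
        refine ⟨y, hy, fun z hz hzx => by_contra fun hzy => ?_⟩
        have h3 := h2 x y (hC hx hy hyx.symm) z (hC hx hz (Ne.symm hzx))
        have h4 : (baseRow y).testBit z = true := hC hy hz (Ne.symm hzy)
        simp [h3] at h4
      · push Not at hne
        exact ⟨x, hx, fun z hz hzx => (hzx (hne z hz)).elim⟩
    have hxy : x = y ∨ (baseRow x).testBit y = true := by
      rcases eq_or_ne x y with h | h
      exacts [Or.inl h, Or.inr (hC hx hy h)]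
    obtain ⟨k, hk, hkx, hky⟩ := h1 x y hxy
    refine ⟨k, hk, fun z hz => ?_⟩
    by_cases hzx : z = x
    · exact hzx ▸ hkx
    · exact hCy z hz hzx ▸ hky

theorem baseGraph_unstabbed : IndepCert.Unstabbed baseGraph 6 2 := by
  have h1 : ∀ k ∈ baseEdges, ∀ l ∈ baseEdges, ∃ w ∈ baseIndep, w &&& (k ||| l) = 0 := by
    decide +kernel
  have h2 : ∀ w ∈ baseIndep, (univ.filter fun i : Fin 17 => w.testBit i = true).card = 6 ∧
      ∀ i j : Fin 17, w.testBit i = true → w.testBit j = true →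
        ¬ (baseRow i).testBit j = true := by decide +kernel
  intro L hL hC
  obtain ⟨C, D, rfl⟩ := List.length_eq_two.1 hL
  simp only [List.mem_cons, List.not_mem_nil, or_false, forall_eq_or_imp, forall_eq] at hC ⊢
  obtain ⟨k, hk, hkC⟩ := exists_baseEdges hC.1
  obtain ⟨l, hl, hlD⟩ := exists_baseEdges hC.2
  obtain ⟨w, hw, hkl⟩ := h1 k hk l hl
  have hbit : ∀ i, w.testBit i = true → k.testBit i = false ∧ l.testBit i = false := by
    intro i hi
    have := congrArg (Nat.testBit · i) hkl
    simpa [hi] using this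
  obtain ⟨hcard, hind⟩ := h2 w hw
  refine ⟨univ.filter fun i : Fin 17 => w.testBit i = true, ⟨fun i hi j hj _ => ?_, hcard⟩,
    disjoint_left.2 fun x hx hxw => ?_, disjoint_left.2 fun x hx hxw => ?_⟩
  · rw [mem_coe, mem_filter] at hi hj
    exact hind i j hi.2 hj.2
  · simpa [hkC x hx] using (hbit x (by simpa using hxw)).1
  · simpa [hlD x hx] using (hbit x (by simpa using hxw)).2

theorem exists_unstabbed {r : ℕ} (hr : 2 ≤ r) :
    ∃ (V : Type) (_ : Fintype V) (H : SimpleGraph V), Fintype.card V = r + 15 ∧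
      IndepLE H univ (r + 4) ∧ IndepCert.Unstabbed H 6 r := by
  induction r, hr using Nat.le_induction with
  | base => exact ⟨Fin 17, inferInstance, baseGraph, by simp, baseGraph_indepLE,
      baseGraph_unstabbed⟩
  | succ r _ ih =>
    obtain ⟨V, _, H, hV, hi, hs⟩ := ih
    exact ⟨Option V, inferInstance, addIsolated H, by rw [Fintype.card_option, hV],
      by simpa [add_right_comm] using indepLE_addIsolated hi, unstabbed_addIsolated hs⟩

end Base

theorem VArrow.comap {V W : Type*} {G : SimpleGraph V} {a : List ℕ} (h : VArrow G a) (e : W ≃ V) :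
    VArrow (G.comap e) a := by
  intro c
  obtain ⟨i, s, hs, hc⟩ := h (c ∘ e.symm)
  refine ⟨i, s.map e.symm.toEmbedding, ⟨?_, by simpa using hs.2⟩, ?_⟩
  · intro x hx y hy hxy
    simp only [coe_map, Set.mem_image, mem_coe] at hx hy
    obtain ⟨x, hx, rfl⟩ := hx
    obtain ⟨y, hy, rfl⟩ := hy
    simpa using hs.1 hx hy (by rintro rfl; exact hxy rfl)
  · intro v hv
    obtain ⟨x, hx, rfl⟩ := mem_map.1 hv
    exact hc x hx

theorem folkman_two_six {r : ℕ} (hr : 2 ≤ r) :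
    folkman (List.replicate r 2 ++ [6]) (r + 5) = r + 15 := by
  refine IsLeast.csInf_eq ⟨?_, ?_⟩
  · obtain ⟨V, _, H, hV, hi, hs⟩ := exists_unstabbed hr
    let e : Fin (r + 15) ≃ V := (Fintype.equivFinOfCardEq hV).symm
    exact ⟨Hᶜ.comap e, (indepLE_univ_iff.1 hi).comap ⟨(SimpleGraph.Embedding.comap e.toEmbedding _).toCopy⟩,
      VArrow.comap ((vArrow_compl_iff H 6 r).2 hs) e⟩
  · rintro n ⟨G, hG, ha⟩
    by_contra! hlt
    rw [← compl_compl G] at hG ha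
    obtain ⟨L, hL, hC, hI⟩ := (allStab hr).stab (H := Gᶜ) univ
      (by rw [card_univ, Fintype.card_fin]; omega) (indepLE_univ_iff.2 hG)
    obtain ⟨I, hI6, hd⟩ := (vArrow_compl_iff Gᶜ 6 r).1 ha L hL hC
    have := hI I (subset_univ _) hI6.1 hd
    have := hI6.2
    omega

end Stabbing

end

/-- If `a₁ = … = a_{s−1} = 2`, `aₛ = 6` with `s ≥ 2` and `m = Σ (aᵢ − 1) + 1 ≥ 8`, then
`F_v(a₁, …, aₛ; m − 1) = m + 9`; equivalently, `F_v(2_r, 6; r + 5) = r + 15` for `r ≥ 2`. -/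
theorem folkman_two_dots_six (s : ℕ) (hs : 2 ≤ s) (a : List ℕ)
    (ha : a = List.replicate (s - 1) 2 ++ [6])
    (m : ℕ) (hm : m = (a.map (· - 1)).sum + 1) (hm8 : 8 ≤ m) :
    folkman a (m - 1) = m + 9 ∧
      ∀ r : ℕ, 2 ≤ r → folkman (List.replicate r 2 ++ [6]) (r + 5) = r + 15 := by
  refine ⟨?_, fun r hr => Stabbing.folkman_two_six hr⟩
  obtain ⟨r, rfl⟩ : ∃ r, s = r + 1 := ⟨s - 1, by omega⟩
  obtain rfl : m = r + 6 := by simpa [ha] using hm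
  rw [ha]
  exact Stabbing.folkman_two_six (by omega)
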